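/- arXiv:math/0601773 — 4 statements merged into one kernel-verified Lean document; each statement's English description precedes it below -/
import Mathlib

section
/- Let F and h be entire functions on ℂ. Then there exists an entire function ψ : ℂ² → ℂ satisfying, for all (z,x) ∈ ℂ², the singular PDE x²·∂²ψ/∂x² + (4xz − 2x²)·∂²ψ/∂x∂z + x²·∂²ψ/∂z² + (2x − 4z)·∂ψ/∂z − x²·F(z)·ψ = 0, together with ψ(z,0) = 1 and (∂ψ/∂x)(z,0) = h(z) for all z ∈ ℂ; and ψ is unique (any two entire solutions with these initial conditions are equal). -/
open Complex Metric

/-- The left-hand side of the singular PDE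
`x² ψ_xx + (4xz − 2x²) ψ_xz + x² ψ_zz + (2x − 4z) ψ_z − x² F(z) ψ`. -/
noncomputable def singPDE (F : ℂ → ℂ) (ψ : ℂ → ℂ → ℂ) (z x : ℂ) : ℂ :=
  x^2 * deriv (deriv (ψ z)) x
    + (4*x*z - 2*x^2) * deriv (fun w => deriv (ψ w) x) z
    + x^2 * deriv (deriv (fun w => ψ w x)) z
    + (2*x - 4*z) * deriv (fun w => ψ w x) z
    - x^2 * F z * ψ z x

namespace SingPDE

/-- Coefficient sequences of entire functions of one variable. -/
def B1 (a : ℕ → ℂ) : Prop := ∀ R : ℝ, 0 < R → ∃ M : ℝ, ∀ k, ‖a k‖ * R ^ k ≤ M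

/-- Sum of the power series. -/
noncomputable def T (a : ℕ → ℂ) (z : ℂ) : ℂ := ∑' k, a k * z ^ k

/-- Coefficients of the derivative. -/
noncomputable def D (a : ℕ → ℂ) (k : ℕ) : ℂ := (k + 1) * a (k + 1)

/-- Coefficients of multiplication by the variable. -/
def Sh (a : ℕ → ℂ) : ℕ → ℂ
  | 0 => 0
  | k + 1 => a k

lemma B1.summable {a : ℕ → ℂ} (ha : B1 a) {r : ℝ} (hr : 0 < r) :
    Summable (fun k => ‖a k‖ * r ^ k) := by
  obtain ⟨M, hM⟩ := ha (2 * r) (by positivity)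
  refine Summable.of_nonneg_of_le (fun k => by positivity) (fun k => ?_)
    (summable_geometric_two.mul_left M)
  have := hM k
  rw [mul_pow] at this
  have h2 : (0:ℝ) < 2 ^ k := by positivity
  rw [one_div, inv_pow, ← div_eq_mul_inv, le_div_iff₀ h2]
  linarith

lemma B1.summable_norm {a : ℕ → ℂ} (ha : B1 a) (z : ℂ) :
    Summable (fun k => ‖a k * z ^ k‖) := by
  refine Summable.of_nonneg_of_le (fun k => norm_nonneg _) (fun k => ?_)
    (ha.summable (r := ‖z‖ + 1) (by positivity))
  rw [norm_mul, norm_pow]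
  gcongr
  linarith

lemma B1.summ {a : ℕ → ℂ} (ha : B1 a) (z : ℂ) : Summable (fun k => a k * z ^ k) :=
  (ha.summable_norm z).of_norm

lemma succ_le_two_pow (k : ℕ) : (k : ℝ) + 1 ≤ 2 ^ k := by
  exact_mod_cast Nat.lt_two_pow_self (n := k)

lemma B1.D {a : ℕ → ℂ} (ha : B1 a) : B1 (D a) := by
  intro R hR
  obtain ⟨M, hM⟩ := ha (2 * R) (by positivity)
  refine ⟨M / R, fun k => ?_⟩
  have h := hM (k + 1)
  have h1 : ‖SingPDE.D a k‖ = (k + 1) * ‖a (k + 1)‖ := by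
    rw [SingPDE.D, norm_mul]; congr 1
    exact_mod_cast Complex.norm_natCast (k + 1)
  rw [h1, le_div_iff₀ hR]
  refine le_trans ?_ h
  have h2 : ((k : ℝ) + 1) ≤ 2 ^ (k + 1) := by
    have := succ_le_two_pow k
    rw [pow_succ]; nlinarith [this, (by positivity : (0 : ℝ) ≤ k)]
  calc (k + 1) * ‖a (k + 1)‖ * R ^ k * R = (k + 1) * (‖a (k + 1)‖ * R ^ (k + 1)) := by ring
    _ ≤ 2 ^ (k + 1) * (‖a (k + 1)‖ * R ^ (k + 1)) := by gcongr
    _ = _ := by ring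

lemma B1.Sh {a : ℕ → ℂ} (ha : B1 a) : B1 (Sh a) := by
  intro R hR
  obtain ⟨M, hM⟩ := ha R hR
  have hM0 : 0 ≤ M := le_trans (by positivity) (hM 0)
  refine ⟨M * R, fun k => ?_⟩
  cases k with
  | zero => simp [SingPDE.Sh]; positivity
  | succ k =>
    simp only [SingPDE.Sh]
    calc ‖a k‖ * R ^ (k + 1) = ‖a k‖ * R ^ k * R := by ring
      _ ≤ M * R := by gcongr; exact hM k

lemma T_hasDerivAt {a : ℕ → ℂ} (ha : B1 a) (z : ℂ) : HasDerivAt (T a) (T (D a) z) z := by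
  have hU : IsOpen (ball (0:ℂ) (‖z‖ + 1)) := isOpen_ball
  have hz : z ∈ ball (0:ℂ) (‖z‖ + 1) := by simp
  have hu := ha.summable (r := ‖z‖ + 1) (by positivity)
  have hd : ∀ i : ℕ, DifferentiableOn ℂ (fun w : ℂ => a i * w ^ i) (ball (0:ℂ) (‖z‖ + 1)) := by
    intro i; fun_prop
  have hb : ∀ i : ℕ, ∀ w ∈ ball (0:ℂ) (‖z‖ + 1), ‖a i * w ^ i‖ ≤ ‖a i‖ * (‖z‖ + 1) ^ i := by
    intro i w hw
    rw [norm_mul, norm_pow]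
    have : ‖w‖ < ‖z‖ + 1 := by simpa using hw
    gcongr
  have h1 := Complex.differentiableOn_tsum_of_summable_norm hu hd hU hb
  have h2 := Complex.hasSum_deriv_of_summable_norm hu hd hU hb hz
  have h3 : HasDerivAt (T a) (deriv (T a) z) z :=
    (h1.differentiableAt (hU.mem_nhds hz)).hasDerivAt
  have h4 : deriv (T a) z = T (D a) z := by
    have h5 : deriv (T a) z = ∑' i, deriv (fun w : ℂ => a i * w ^ i) z := h2.tsum_eq.symm
    rw [h5, h2.summable.tsum_eq_zero_add]
    simp only [pow_zero, mul_one, deriv_const, zero_add, T]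
    congr 1; ext k
    simp [D]; ring
  rwa [h4] at h3

lemma T_zero_arg (a : ℕ → ℂ) : T a 0 = a 0 := by
  rw [T, tsum_eq_single 0]
  · simp
  · intro k hk; simp [hk]

lemma T_eq_zero {d : ℕ → ℂ} (hd : B1 d) (h : ∀ z, T d z = 0) (k : ℕ) : d k = 0 := by
  induction k generalizing d with
  | zero => rw [← T_zero_arg d, h]
  | succ k ih =>
    have h0 : T d = fun _ => 0 := funext h
    have h1 : ∀ z, T (D d) z = 0 := by
      intro z
      rw [← (T_hasDerivAt hd z).deriv, h0]; simp
    have h2 := ih hd.D h1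
    rw [D, mul_eq_zero] at h2
    rcases h2 with h2 | h2
    · exact absurd h2 (by exact_mod_cast Nat.succ_ne_zero k)
    · exact h2

lemma T_add {a b : ℕ → ℂ} (ha : B1 a) (hb : B1 b) (z : ℂ) : T (a + b) z = T a z + T b z := by
  rw [T, T, T, ← (ha.summ z).tsum_add (hb.summ z)]
  congr 1; ext k; simp [add_mul]

lemma T_smul (t : ℂ) (a : ℕ → ℂ) (z : ℂ) : T (t • a) z = t * T a z := by
  rw [T, T, ← tsum_mul_left]
  congr 1; ext k; simp [mul_assoc]

lemma T_Sh {a : ℕ → ℂ} (ha : B1 a) (z : ℂ) : T (Sh a) z = z * T a z := by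
  rw [T, (ha.Sh.summ z).tsum_eq_zero_add, T, ← tsum_mul_left]
  simp only [Sh, zero_mul, zero_add]
  congr 1; ext k; ring

lemma B1.add {a b : ℕ → ℂ} (ha : B1 a) (hb : B1 b) : B1 (a + b) := by
  intro R hR
  obtain ⟨M, hM⟩ := ha R hR
  obtain ⟨N, hN⟩ := hb R hR
  refine ⟨M + N, fun k => ?_⟩
  calc ‖(a + b) k‖ * R ^ k ≤ (‖a k‖ + ‖b k‖) * R ^ k := by gcongr; exact norm_add_le _ _
    _ ≤ M + N := by rw [add_mul]; exact add_le_add (hM k) (hN k)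

lemma B1.smul {a : ℕ → ℂ} (t : ℂ) (ha : B1 a) : B1 (t • a) := by
  intro R hR
  obtain ⟨M, hM⟩ := ha R hR
  refine ⟨‖t‖ * M, fun k => ?_⟩
  simp only [Pi.smul_apply, smul_eq_mul, norm_mul, mul_assoc]
  gcongr; exact hM k

lemma T_inj {a b : ℕ → ℂ} (ha : B1 a) (hb : B1 b) (h : ∀ z, T a z = T b z) : a = b := by
  have h1 : B1 (a + (-1 : ℂ) • b) := ha.add (hb.smul _)
  ext k
  have := T_eq_zero h1 (fun z => by rw [T_add ha (hb.smul _), T_smul, h]; ring) k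
  simp at this
  linear_combination this

/-- Cauchy product. -/
noncomputable def conv (f a : ℕ → ℂ) (k : ℕ) : ℂ :=
  ∑ p ∈ Finset.HasAntidiagonal.antidiagonal k, f p.1 * a p.2

lemma T_conv {f a : ℕ → ℂ} (hf : B1 f) (ha : B1 a) (z : ℂ) :
    T (conv f a) z = T f z * T a z := by
  rw [T, T, T, tsum_mul_tsum_eq_tsum_sum_antidiagonal_of_summable_norm (hf.summable_norm z)
    (ha.summable_norm z)]
  congr 1; ext k
  rw [conv, Finset.sum_mul]
  refine Finset.sum_congr rfl fun p hp => ?_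
  rw [← Finset.HasAntidiagonal.mem_antidiagonal.1 hp, pow_add]; ring

/-- Taylor coefficients at zero. -/
noncomputable def tay (f : ℂ → ℂ) (n : ℕ) : ℂ := (n.factorial : ℂ)⁻¹ * iteratedDeriv n f 0

lemma tay_hasSum {f : ℂ → ℂ} (hf : Differentiable ℂ f) (z : ℂ) :
    HasSum (fun n => tay f n * z ^ n) (f z) := by
  have := Complex.hasSum_taylorSeries_of_entire hf 0 z
  have e : (fun n => tay f n * z ^ n) =
      fun n : ℕ => ((n.factorial : ℂ))⁻¹ • (z - 0) ^ n • iteratedDeriv n f 0 := by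
    ext n
    rw [tay, sub_zero, smul_eq_mul, smul_eq_mul]; ring
  rw [e]; exact this

lemma T_tay {f : ℂ → ℂ} (hf : Differentiable ℂ f) (z : ℂ) : T (tay f) z = f z :=
  (tay_hasSum hf z).tsum_eq

lemma tay_bound {f : ℂ → ℂ} (hf : Differentiable ℂ f) {R C : ℝ} (hR : 0 < R)
    (hC : ∀ z ∈ sphere (0:ℂ) R, ‖f z‖ ≤ C) (n : ℕ) : ‖tay f n‖ * R ^ n ≤ C := by
  have := Complex.norm_iteratedDeriv_le_of_forall_mem_sphere_norm_le n hR hf.diffContOnCl hC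
  have hn : (0:ℝ) < n.factorial := by positivity
  rw [tay, norm_mul, norm_inv, Complex.norm_natCast]
  rw [mul_div_assoc, ← div_le_iff₀' hn, le_div_iff₀ (by positivity)] at this
  refine le_trans (le_of_eq ?_) this
  field_simp

lemma tay_B1 {f : ℂ → ℂ} (hf : Differentiable ℂ f) : B1 (tay f) := by
  intro R hR
  obtain ⟨C, hC⟩ := (isCompact_sphere (0:ℂ) R).exists_bound_of_continuousOn
    hf.continuous.continuousOn
  exact ⟨C, tay_bound hf hR hC⟩

/-- Coefficient arrays of entire functions of two variables: `c n k` is the coefficient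
of `x ^ n * z ^ k`. -/
def B2 (c : ℕ → ℕ → ℂ) : Prop :=
  ∀ R : ℝ, 0 < R → ∃ M : ℝ, ∀ n k, ‖c n k‖ * R ^ (n + k) ≤ M

/-- Sum of the double series. -/
noncomputable def S (c : ℕ → ℕ → ℂ) (z x : ℂ) : ℂ := T (fun n => T (c n) z) x

/-- transposition -/
def tr (c : ℕ → ℕ → ℂ) : ℕ → ℕ → ℂ := fun n k => c k n

lemma B2.tr {c : ℕ → ℕ → ℂ} (hc : B2 c) : B2 (tr c) := by
  intro R hR
  obtain ⟨M, hM⟩ := hc R hR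
  exact ⟨M, fun n k => by rw [add_comm]; exact hM k n⟩

lemma B2.row {c : ℕ → ℕ → ℂ} (hc : B2 c) (n : ℕ) : B1 (c n) := by
  intro R hR
  obtain ⟨M, hM⟩ := hc R hR
  refine ⟨M / R ^ n, fun k => ?_⟩
  rw [le_div_iff₀ (by positivity)]
  refine le_trans (le_of_eq ?_) (hM n k)
  ring

lemma B2.T {c : ℕ → ℕ → ℂ} (hc : B2 c) (z : ℂ) : B1 (fun n => T (c n) z) := by
  intro R hR
  obtain ⟨M, hM⟩ := hc (2 * (‖z‖ + R)) (by positivity)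
  refine ⟨M * 2, fun n => ?_⟩
  have h1 : HasSum (fun k : ℕ => M / R ^ n * (1 / 2 : ℝ) ^ k) (M / R ^ n * 2) :=
    hasSum_geometric_two.mul_left _
  have h2 : ‖SingPDE.T (c n) z‖ ≤ M / R ^ n * 2 := by
    refine tsum_of_norm_bounded h1 fun k => ?_
    have h3 : (0:ℝ) < R ^ n := by positivity
    have h4 : (0:ℝ) < 2 ^ k := by positivity
    rw [norm_mul, norm_pow, one_div, inv_pow, ← div_eq_mul_inv, div_div, le_div_iff₀ (by positivity)]
    refine le_trans ?_ (hM n k)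
    calc ‖c n k‖ * ‖z‖ ^ k * (R ^ n * 2 ^ k) = ‖c n k‖ * (1 * R) ^ n * (2 * ‖z‖) ^ k := by
            rw [mul_pow, mul_pow]; ring
      _ ≤ ‖c n k‖ * (2 * (‖z‖ + R)) ^ n * (2 * (‖z‖ + R)) ^ k := by
            have := norm_nonneg z
            gcongr <;> linarith
      _ = _ := by ring
  calc _ ≤ M / R ^ n * 2 * R ^ n := by gcongr
    _ = M * 2 := by field_simp

lemma B2.summable {c : ℕ → ℕ → ℂ} (hc : B2 c) {r : ℝ} (hr : 0 < r) :
    Summable (fun p : ℕ × ℕ => ‖c p.1 p.2‖ * r ^ (p.1 + p.2)) := by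
  obtain ⟨M, hM⟩ := hc (2 * r) (by positivity)
  have hg : Summable (fun p : ℕ × ℕ => (1 / 2 : ℝ) ^ p.1 * (1 / 2 : ℝ) ^ p.2) :=
    summable_geometric_two.mul_of_nonneg summable_geometric_two
      (fun _ => by positivity) (fun _ => by positivity)
  refine Summable.of_nonneg_of_le (fun k => by positivity) (fun p => ?_) (hg.mul_left M)
  have := hM p.1 p.2
  rw [mul_pow] at this
  have h2 : (0:ℝ) < 2 ^ (p.1 + p.2) := by positivity
  rw [← pow_add, one_div, inv_pow, ← div_eq_mul_inv, le_div_iff₀ h2]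
  linarith

lemma term_bound (c : ℕ → ℕ → ℂ) {r : ℝ} {z x : ℂ} (hz : ‖z‖ ≤ r) (hx : ‖x‖ ≤ r) (p : ℕ × ℕ) :
    ‖c p.1 p.2 * z ^ p.2 * x ^ p.1‖ ≤ ‖c p.1 p.2‖ * r ^ (p.1 + p.2) := by
  rw [norm_mul, norm_mul, norm_pow, norm_pow, pow_add]
  calc _ ≤ ‖c p.1 p.2‖ * r ^ p.2 * r ^ p.1 := by
        have hr := (norm_nonneg z).trans hz
        gcongr
    _ = _ := by ring

lemma B2.summ {c : ℕ → ℕ → ℂ} (hc : B2 c) (z x : ℂ) :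
    Summable (fun p : ℕ × ℕ => c p.1 p.2 * z ^ p.2 * x ^ p.1) := by
  have h0 := norm_nonneg z
  have h1 := norm_nonneg x
  refine Summable.of_norm_bounded (hc.summable (r := ‖z‖ + ‖x‖ + 1) (by positivity)) fun p => ?_
  exact term_bound c (by linarith) (by linarith) p

lemma S_eq {c : ℕ → ℕ → ℂ} (z x : ℂ) : S c z x = ∑' (n : ℕ) (k : ℕ), c n k * z ^ k * x ^ n := by
  rw [S, T]
  congr 1; ext n
  rw [T, tsum_mul_right]

lemma S_swap {c : ℕ → ℕ → ℂ} (hc : B2 c) (z x : ℂ) : S c z x = S (tr c) x z := by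
  rw [S_eq, S_eq, ← Summable.tsum_comm]
  · simp only [tr]
    congr 1; ext n; congr 1; ext k; ring
  · exact hc.summ z x

lemma S_continuous {c : ℕ → ℕ → ℂ} (hc : B2 c) :
    Continuous (fun p : ℂ × ℂ => S c p.1 p.2) := by
  have h : (fun p : ℂ × ℂ => S c p.1 p.2) =
      fun q : ℂ × ℂ => ∑' p : ℕ × ℕ, c p.1 p.2 * q.1 ^ p.2 * q.2 ^ p.1 := by
    ext q
    rw [S_eq, (hc.summ q.1 q.2).tsum_prod]
  rw [h, continuous_iff_continuousAt]
  intro q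
  have hU : ball (0 : ℂ × ℂ) (‖q‖ + 1) ∈ nhds q := isOpen_ball.mem_nhds (by simp)
  refine ContinuousOn.continuousAt ?_ hU
  refine continuousOn_tsum (fun p => by fun_prop) (hc.summable (r := ‖q‖ + 1) (by positivity)) ?_
  intro p w hw
  have hw' : ‖w‖ < ‖q‖ + 1 := by simpa using hw
  exact term_bound c ((norm_fst_le w).trans hw'.le) ((norm_snd_le w).trans hw'.le) p

/-- z-derivative -/
noncomputable def Dz (c : ℕ → ℕ → ℂ) : ℕ → ℕ → ℂ := fun n => D (c n)
/-- x-derivative -/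
noncomputable def Dx (c : ℕ → ℕ → ℂ) : ℕ → ℕ → ℂ := fun n k => (n + 1) * c (n + 1) k
/-- multiplication by z -/
noncomputable def Zm (c : ℕ → ℕ → ℂ) : ℕ → ℕ → ℂ := fun n => Sh (c n)
/-- multiplication by x -/
noncomputable def Xm (c : ℕ → ℕ → ℂ) : ℕ → ℕ → ℂ
  | 0 => fun _ => 0
  | n + 1 => c n
/-- multiplication by a function of z -/
noncomputable def Cv (f : ℕ → ℂ) (c : ℕ → ℕ → ℂ) : ℕ → ℕ → ℂ := fun n => conv f (c n)

lemma Dx_eq (c : ℕ → ℕ → ℂ) : Dx c = tr (Dz (tr c)) := rfl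
lemma Xm_eq (c : ℕ → ℕ → ℂ) : Xm c = tr (Zm (tr c)) := by
  ext n k; cases n <;> rfl

lemma B2.Dz {c : ℕ → ℕ → ℂ} (hc : B2 c) : B2 (Dz c) := by
  intro R hR
  obtain ⟨M, hM⟩ := hc (2 * R) (by positivity)
  refine ⟨M / R, fun n k => ?_⟩
  have h := hM n (k + 1)
  have h1 : ‖SingPDE.Dz c n k‖ = (k + 1) * ‖c n (k + 1)‖ := by
    rw [SingPDE.Dz, D, norm_mul]; congr 1
    exact_mod_cast Complex.norm_natCast (k + 1)
  rw [h1, le_div_iff₀ hR]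
  refine le_trans ?_ h
  have h2 : ((k : ℝ) + 1) ≤ 2 ^ (n + (k + 1)) :=
    (succ_le_two_pow k).trans (pow_le_pow_right₀ (by norm_num) (by omega))
  calc (k + 1) * ‖c n (k + 1)‖ * R ^ (n + k) * R
      = (k + 1) * (‖c n (k + 1)‖ * R ^ (n + (k + 1))) := by ring
    _ ≤ 2 ^ (n + (k + 1)) * (‖c n (k + 1)‖ * R ^ (n + (k + 1))) := by gcongr
    _ = _ := by ring

lemma B2.Zm {c : ℕ → ℕ → ℂ} (hc : B2 c) : B2 (Zm c) := by
  intro R hR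
  obtain ⟨M, hM⟩ := hc R hR
  have hM0 : 0 ≤ M := le_trans (by positivity) (hM 0 0)
  refine ⟨M * R, fun n k => ?_⟩
  cases k with
  | zero => simp [SingPDE.Zm, Sh]; positivity
  | succ k =>
    simp only [SingPDE.Zm, Sh]
    calc ‖c n k‖ * R ^ (n + (k + 1)) = ‖c n k‖ * R ^ (n + k) * R := by ring
      _ ≤ M * R := by gcongr; exact hM n k

lemma B2.Dx {c : ℕ → ℕ → ℂ} (hc : B2 c) : B2 (Dx c) := hc.tr.Dz.tr
lemma B2.Xm {c : ℕ → ℕ → ℂ} (hc : B2 c) : B2 (Xm c) := by rw [Xm_eq]; exact hc.tr.Zm.tr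

lemma B2.Cv {f : ℕ → ℂ} (hf : B1 f) {c : ℕ → ℕ → ℂ} (hc : B2 c) : B2 (Cv f c) := by
  intro R hR
  obtain ⟨M, hM⟩ := hf (2 * R) (by positivity)
  obtain ⟨N, hN⟩ := hc (2 * R) (by positivity)
  have hM0 : 0 ≤ M := le_trans (by positivity) (hM 0)
  refine ⟨M * N, fun n k => ?_⟩
  have hN0 : 0 ≤ N := le_trans (by positivity) (hN 0 0)
  have h1 : ‖SingPDE.Cv f c n k‖ * (2 * R) ^ (n + k) ≤ (k + 1) * (M * N) := by
    calc ‖SingPDE.Cv f c n k‖ * (2 * R) ^ (n + k)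
        ≤ (∑ p ∈ Finset.HasAntidiagonal.antidiagonal k, ‖f p.1 * c n p.2‖) * (2 * R) ^ (n + k) := by
          refine mul_le_mul_of_nonneg_right ?_ (by positivity)
          simp only [SingPDE.Cv, conv]
          exact norm_sum_le _ _
      _ = ∑ p ∈ Finset.HasAntidiagonal.antidiagonal k, ‖f p.1 * c n p.2‖ * (2 * R) ^ (n + k) := by
          rw [Finset.sum_mul]
      _ ≤ ∑ p ∈ Finset.HasAntidiagonal.antidiagonal k, M * N := by
          refine Finset.sum_le_sum fun p hp => ?_
          rw [← Finset.HasAntidiagonal.mem_antidiagonal.1 hp, norm_mul]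
          calc _ = (‖f p.1‖ * (2 * R) ^ p.1) * (‖c n p.2‖ * (2 * R) ^ (n + p.2)) := by ring
            _ ≤ M * N := mul_le_mul (hM _) (hN _ _) (by positivity) hM0
      _ = _ := by simp
  have h2 : ((k : ℝ) + 1) ≤ 2 ^ (n + k) :=
    (succ_le_two_pow k).trans (pow_le_pow_right₀ (by norm_num) (by omega))
  have h3 : 2 ^ (n + k) * (‖SingPDE.Cv f c n k‖ * R ^ (n + k)) ≤ 2 ^ (n + k) * (M * N) := by
    calc _ = ‖SingPDE.Cv f c n k‖ * (2 * R) ^ (n + k) := by rw [mul_pow]; ring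
      _ ≤ _ := h1
      _ ≤ _ := by gcongr
  exact le_of_mul_le_mul_left h3 (by positivity)

lemma B2.add {c d : ℕ → ℕ → ℂ} (hc : B2 c) (hd : B2 d) : B2 (c + d) := by
  intro R hR
  obtain ⟨M, hM⟩ := hc R hR
  obtain ⟨N, hN⟩ := hd R hR
  refine ⟨M + N, fun n k => ?_⟩
  calc ‖(c + d) n k‖ * R ^ (n + k) ≤ (‖c n k‖ + ‖d n k‖) * R ^ (n + k) := by
        gcongr; exact norm_add_le _ _
    _ ≤ M + N := by rw [add_mul]; exact add_le_add (hM n k) (hN n k)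

lemma B2.smul {c : ℕ → ℕ → ℂ} (t : ℂ) (hc : B2 c) : B2 (t • c) := by
  intro R hR
  obtain ⟨M, hM⟩ := hc R hR
  refine ⟨‖t‖ * M, fun n k => ?_⟩
  simp only [Pi.smul_apply, smul_eq_mul, norm_mul, mul_assoc]
  gcongr; exact hM n k

lemma S_add {c d : ℕ → ℕ → ℂ} (hc : B2 c) (hd : B2 d) (z x : ℂ) :
    S (c + d) z x = S c z x + S d z x := by
  rw [S, S, S, ← T_add (hc.T z) (hd.T z)]
  congr 1; ext n
  exact T_add (hc.row n) (hd.row n) z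

lemma S_smul (t : ℂ) (c : ℕ → ℕ → ℂ) (z x : ℂ) : S (t • c) z x = t * S c z x := by
  rw [S, S, ← T_smul]
  congr 1; ext n
  exact T_smul t (c n) z

lemma S_hasDerivAt_x {c : ℕ → ℕ → ℂ} (hc : B2 c) (z x : ℂ) :
    HasDerivAt (S c z) (S (Dx c) z x) x := by
  have h := T_hasDerivAt (hc.T z) x
  have e : D (fun n => T (c n) z) = fun n => T (Dx c n) z := by
    ext n
    rw [D, ← T_smul]; rfl
  rw [e] at h
  exact h

lemma S_hasDerivAt_z {c : ℕ → ℕ → ℂ} (hc : B2 c) (z x : ℂ) :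
    HasDerivAt (fun w => S c w x) (S (Dz c) z x) z := by
  have h := S_hasDerivAt_x hc.tr x z
  rw [S_swap hc.Dz]
  have e : (fun w => S c w x) = S (tr c) x := by ext w; rw [S_swap hc]
  rw [e]; exact h

lemma S_Xm {c : ℕ → ℕ → ℂ} (hc : B2 c) (z x : ℂ) : S (Xm c) z x = x * S c z x := by
  rw [S, S, ← T_Sh (hc.T z)]
  congr 1; ext n
  cases n with
  | zero => simp [Xm, Sh, T]
  | succ n => rfl

lemma S_Zm {c : ℕ → ℕ → ℂ} (hc : B2 c) (z x : ℂ) : S (Zm c) z x = z * S c z x := by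
  rw [S_swap hc.Zm, S_swap hc, ← S_Xm hc.tr, Xm_eq]; rfl

lemma S_Cv {f : ℕ → ℂ} (hf : B1 f) {c : ℕ → ℕ → ℂ} (hc : B2 c) (z x : ℂ) :
    S (Cv f c) z x = T f z * S c z x := by
  rw [S, S, ← T_smul]
  congr 1; ext n
  exact T_conv hf (hc.row n) z

lemma S_inj {c : ℕ → ℕ → ℂ} (hc : B2 c) (h : ∀ z x, S c z x = 0) (n k : ℕ) : c n k = 0 :=
  T_eq_zero (hc.row n) (fun z => T_eq_zero (hc.T z) (h z) n) k

lemma S_differentiable {c : ℕ → ℕ → ℂ} (hc : B2 c) :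
    Differentiable ℂ (fun p : ℂ × ℂ => S c p.1 p.2) := by
  intro u
  have := hasStrictFDerivAt_uncurry_coprod (𝕜 := ℂ) (u := u) (f := S c)
    (f₁ := fun z x => ContinuousLinearMap.toSpanSingleton ℂ (S (Dz c) z x))
    (f₂ := fun z x => ContinuousLinearMap.toSpanSingleton ℂ (S (Dx c) z x))
    (Filter.Eventually.of_forall fun v => (S_hasDerivAt_z hc v.1 v.2).hasFDerivAt)
    (Filter.Eventually.of_forall fun v => (S_hasDerivAt_x hc v.1 v.2).hasFDerivAt)
    ?_ ?_
  · exact this.hasFDerivAt.differentiableAt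
  · exact ((ContinuousLinearMap.toSpanSingletonCLE (𝕜 := ℂ) (E := ℂ)).continuous.comp
      (S_continuous hc.Dz)).continuousAt
  · exact ((ContinuousLinearMap.toSpanSingletonCLE (𝕜 := ℂ) (E := ℂ)).continuous.comp
      (S_continuous hc.Dx)).continuousAt

lemma tay_param_differentiable {ψ : ℂ → ℂ → ℂ}
    (hψ : Differentiable ℂ (fun p : ℂ × ℂ => ψ p.1 p.2)) (n : ℕ) :
    Differentiable ℂ (fun z => tay (ψ z) n) := by
  have hx : ∀ z, Differentiable ℂ (ψ z) := fun z =>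
    hψ.comp (f := fun x : ℂ => (z, x)) (by fun_prop)
  have hz : ∀ x, Differentiable ℂ (fun z => ψ z x) := fun x =>
    hψ.comp (f := fun z : ℂ => (z, x)) (by fun_prop)
  induction n using Nat.strong_induction_on with
  | _ n ih =>
  -- the approximating sequence
  let t : ℕ → ℂ := fun j => ((1 / 2 : ℝ) ^ (j + 1) : ℝ)
  have ht : ∀ j, ‖t j‖ = (1 / 2 : ℝ) ^ (j + 1) := fun j => by
    simp only [t, Complex.norm_real, Real.norm_eq_abs]
    exact abs_of_pos (by positivity)
  have ht0 : ∀ j, t j ≠ 0 := fun j => by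
    rw [← norm_pos_iff, ht]; positivity
  let G : ℕ → ℂ → ℂ := fun j z =>
    (ψ z (t j) - ∑ m ∈ Finset.range n, tay (ψ z) m * t j ^ m) / t j ^ n
  have hG : ∀ j, Differentiable ℂ (G j) := by
    intro j
    refine Differentiable.div_const (Differentiable.sub (hz _) ?_) _
    refine Differentiable.fun_sum fun m hm => ?_
    exact (ih m (Finset.mem_range.1 hm)).mul_const _
  have key : ∀ ρ : ℝ, ∃ M : ℝ, ∀ z, ‖z‖ ≤ ρ → ∀ j,
      ‖tay (ψ z) n - G j z‖ ≤ M * (1 / 2 : ℝ) ^ j := by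
    intro ρ
    obtain ⟨M, hM⟩ := ((isCompact_closedBall (0:ℂ) ρ).prod
      (isCompact_sphere (0:ℂ) 1)).exists_bound_of_continuousOn hψ.continuous.continuousOn
    refine ⟨M, fun z hzρ j => ?_⟩
    have hb : ∀ m, ‖tay (ψ z) m‖ ≤ M := fun m => by
      have := tay_bound (hx z) one_pos (C := M) (fun x hxs => hM (z, x) ⟨by simpa using hzρ, hxs⟩) m
      simpa using this
    have hs := tay_hasSum (hx z) (t j)
    have h1 := (hs.summable).sum_add_tsum_nat_add (n + 1)
    rw [hs.tsum_eq, Finset.sum_range_succ] at h1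
    have h2 : tay (ψ z) n - G j z
        = - ∑' i, tay (ψ z) (i + (n + 1)) * t j ^ (i + 1) := by
      have h3 : ∑' i, tay (ψ z) (i + (n + 1)) * t j ^ (i + (n + 1)) =
          (∑' i, tay (ψ z) (i + (n + 1)) * t j ^ (i + 1)) * t j ^ n := by
        rw [← tsum_mul_right]; congr 1; ext i; ring
      have h4 : t j ^ n ≠ 0 := pow_ne_zero _ (ht0 j)
      rw [h3] at h1
      simp only [G]
      rw [← h1]
      field_simp
      ring
    rw [h2, norm_neg]
    have hg : HasSum (fun i : ℕ => M * (1 / 2 : ℝ) ^ (j + 1) * (1 / 2 : ℝ) ^ i)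
        (M * (1 / 2 : ℝ) ^ (j + 1) * 2) := hasSum_geometric_two.mul_left _
    have h5 := tsum_of_norm_bounded (f := fun i => tay (ψ z) (i + (n + 1)) * t j ^ (i + 1)) hg
      (fun i => by
        rw [norm_mul, norm_pow, ht]
        have hM0 : 0 ≤ M := (norm_nonneg _).trans (hb 0)
        have h6 : ((1 / 2 : ℝ) ^ (j + 1)) ^ (i + 1) ≤ (1 / 2 : ℝ) ^ (j + 1) * (1 / 2 : ℝ) ^ i := by
          rw [← pow_mul, ← pow_add]
          refine pow_le_pow_of_le_one (by norm_num) (by norm_num) ?_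
          nlinarith
        rw [mul_assoc]
        exact mul_le_mul (hb _) h6 (by positivity) hM0)
    refine h5.trans (le_of_eq ?_)
    rw [pow_succ]; ring
  intro z₀
  have hU : IsOpen (ball (0:ℂ) (‖z₀‖ + 1)) := isOpen_ball
  have hz₀ : z₀ ∈ ball (0:ℂ) (‖z₀‖ + 1) := by simp
  have hlim : TendstoUniformlyOn G (fun z => tay (ψ z) n) Filter.atTop
      (ball (0:ℂ) (‖z₀‖ + 1)) := by
    obtain ⟨M, hM⟩ := key (‖z₀‖ + 1)
    rw [Metric.tendstoUniformlyOn_iff]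
    intro ε hε
    have hl : Filter.Tendsto (fun j : ℕ => M * (1 / 2 : ℝ) ^ j) Filter.atTop (nhds (M * 0)) :=
      (tendsto_pow_atTop_nhds_zero_of_lt_one (by norm_num) (by norm_num)).const_mul M
    rw [mul_zero] at hl
    filter_upwards [hl.eventually_lt_const hε] with j hj z hz
    rw [dist_eq_norm]
    refine lt_of_le_of_lt (hM z ?_ j) hj
    have : ‖z‖ < ‖z₀‖ + 1 := by simpa using hz
    exact this.le
  have hd := hlim.tendstoLocallyUniformlyOn.differentiableOn
    (Filter.Eventually.of_forall fun j => (hG j).differentiableOn) hU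
  exact hd.differentiableAt (hU.mem_nhds hz₀)

/-- Every entire function of two variables is given by a double power series. -/
lemma exists_S {ψ : ℂ → ℂ → ℂ} (hψ : Differentiable ℂ (fun p : ℂ × ℂ => ψ p.1 p.2)) :
    ∃ c, B2 c ∧ ψ = S c := by
  have hx : ∀ z, Differentiable ℂ (ψ z) := fun z =>
    hψ.comp (f := fun x : ℂ => (z, x)) (by fun_prop)
  have ha := tay_param_differentiable hψ
  refine ⟨fun n => tay (fun z => tay (ψ z) n), ?_, ?_⟩
  · intro R hR
    obtain ⟨M, hM⟩ := ((isCompact_sphere (0:ℂ) R).prod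
      (isCompact_sphere (0:ℂ) R)).exists_bound_of_continuousOn hψ.continuous.continuousOn
    refine ⟨M, fun n k => ?_⟩
    have h1 : ∀ z ∈ sphere (0:ℂ) R, ‖tay (ψ z) n‖ ≤ M / R ^ n := fun z hz => by
      rw [le_div_iff₀ (by positivity)]
      exact tay_bound (hx z) hR (fun x hxs => hM (z, x) ⟨hz, hxs⟩) n
    have h2 := tay_bound (ha n) hR h1 k
    rw [le_div_iff₀ (by positivity)] at h2
    refine le_trans (le_of_eq ?_) h2
    ring
  · ext z x
    rw [S]
    have : (fun n => T (tay (fun z => tay (ψ z) n)) z) = tay (ψ z) := by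
      ext n; exact T_tay (ha n) z
    rw [this, T_tay (hx z)]

/-- The coefficient array of the PDE. -/
noncomputable def P (f : ℕ → ℂ) (c : ℕ → ℕ → ℂ) : ℕ → ℕ → ℂ :=
  Xm (Xm (Dx (Dx c))) + (4 : ℂ) • Xm (Zm (Dz (Dx c))) + (-2 : ℂ) • Xm (Xm (Dz (Dx c)))
    + Xm (Xm (Dz (Dz c))) + (2 : ℂ) • Xm (Dz c) + (-4 : ℂ) • Zm (Dz c)
    + (-1 : ℂ) • Xm (Xm (Cv f c))

lemma B2_P {f : ℕ → ℂ} (hf : B1 f) {c : ℕ → ℕ → ℂ} (hc : B2 c) : B2 (P f c) :=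
  ((((((hc.Dx.Dx.Xm.Xm).add (hc.Dx.Dz.Zm.Xm.smul _)).add (hc.Dx.Dz.Xm.Xm.smul _)).add
    hc.Dz.Dz.Xm.Xm).add (hc.Dz.Xm.smul _)).add (hc.Dz.Zm.smul _)).add
    ((B2.Cv hf hc).Xm.Xm.smul _)

lemma singPDE_S {F : ℂ → ℂ} {f : ℕ → ℂ} (hf : B1 f) (hF : ∀ z, F z = T f z)
    {c : ℕ → ℕ → ℂ} (hc : B2 c) (z x : ℂ) : singPDE F (S c) z x = S (P f c) z x := by
  have e1 : ∀ {d : ℕ → ℕ → ℂ}, B2 d → ∀ z, deriv (S d z) = S (Dx d) z := fun hd z =>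
    funext fun x => (S_hasDerivAt_x hd z x).deriv
  have e2 : ∀ {d : ℕ → ℕ → ℂ}, B2 d → ∀ x, deriv (fun w => S d w x) = fun w => S (Dz d) w x :=
    fun hd x => funext fun z => (S_hasDerivAt_z hd z x).deriv
  have e3 : (fun w => deriv (S c w) x) = fun w => S (Dx c) w x := by
    ext w; rw [e1 hc]
  have b1 := hc.Dx.Dx.Xm.Xm
  have b2 := hc.Dx.Dz.Zm.Xm.smul 4
  have b3 := hc.Dx.Dz.Xm.Xm.smul (-2)
  have b4 := hc.Dz.Dz.Xm.Xm
  have b5 := hc.Dz.Xm.smul 2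
  have b6 := hc.Dz.Zm.smul (-4)
  have b7 := (B2.Cv hf hc).Xm.Xm.smul (-1)
  rw [P, S_add (((((b1.add b2).add b3).add b4).add b5).add b6) b7,
    S_add ((((b1.add b2).add b3).add b4).add b5) b6,
    S_add (((b1.add b2).add b3).add b4) b5, S_add ((b1.add b2).add b3) b4,
    S_add (b1.add b2) b3, S_add b1 b2]
  simp only [S_smul]
  rw [S_Xm hc.Dx.Dx.Xm, S_Xm hc.Dx.Dx, S_Xm hc.Dx.Dz.Zm, S_Zm hc.Dx.Dz, S_Xm hc.Dx.Dz.Xm,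
    S_Xm hc.Dx.Dz, S_Xm hc.Dz.Dz.Xm, S_Xm hc.Dz.Dz, S_Xm hc.Dz, S_Zm hc.Dz,
    S_Xm (B2.Cv hf hc).Xm, S_Xm (B2.Cv hf hc), S_Cv hf hc, ← hF]
  rw [singPDE, e3, e1 hc, e1 hc.Dx, e2 hc.Dx, e2 hc, e2 hc.Dz]
  ring

lemma P_zero (f : ℕ → ℂ) (c : ℕ → ℕ → ℂ) (k : ℕ) : P f c 0 k = -4 * (k * c 0 k) := by
  cases k <;> simp [P, Xm, Zm, Sh, Dz, D]

lemma P_one (f : ℕ → ℂ) (c : ℕ → ℕ → ℂ) (k : ℕ) :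
    P f c 1 k = 2 * ((k + 1) * c 0 (k + 1)) := by
  cases k <;> simp [P, Xm, Zm, Sh, Dz, Dx, D]

lemma P_succ (f : ℕ → ℂ) (c : ℕ → ℕ → ℂ) (n k : ℕ) :
    P f c (n + 2) k = (n + 1) * (n + 2 + 4 * k) * c (n + 2) k
      - (2 * n * (k + 1) * c (n + 1) (k + 1) - (k + 1) * (k + 2) * c n (k + 2)
        + conv f (c n) k) := by
  cases k <;> simp [P, Xm, Zm, Sh, Dz, Dx, D, Cv] <;> ring

/-- The coefficients of the solution. -/
noncomputable def coef (f h : ℕ → ℂ) : ℕ → ℕ → ℂ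
  | 0 => fun k => if k = 0 then 1 else 0
  | 1 => h
  | n + 2 => fun k => (2 * n * (k + 1) * coef f h (n + 1) (k + 1)
      - (k + 1) * (k + 2) * coef f h n (k + 2) + conv f (coef f h n) k)
        / ((n + 1) * (n + 2 + 4 * k))

lemma den_ne (n k : ℕ) : ((n : ℂ) + 1) * (n + 2 + 4 * k) ≠ 0 := by
  have : (n + 1) * (n + 2 + 4 * k) ≠ 0 := by positivity
  exact_mod_cast this

lemma P_coef (f h : ℕ → ℂ) : P f (coef f h) = 0 := by
  ext n k
  match n with
  | 0 => rw [P_zero]; by_cases hk : k = 0 <;> simp [hk, coef]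
  | 1 => rw [P_one]; simp [coef]
  | n + 2 =>
    rw [P_succ, coef, mul_div_cancel₀ _ (den_ne n k)]; simp

lemma eq_coef {f h : ℕ → ℂ} {c : ℕ → ℕ → ℂ} (h0 : c 0 = coef f h 0) (h1 : c 1 = h)
    (hP : P f c = 0) : ∀ n, c n = coef f h n ∧ c (n + 1) = coef f h (n + 1) := by
  intro n
  induction n with
  | zero => exact ⟨h0, h1⟩
  | succ n ih =>
    refine ⟨ih.2, ?_⟩
    ext k
    have := congrFun (congrFun hP (n + 2)) k
    rw [P_succ, ih.1, ih.2] at this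
    rw [coef, eq_div_iff (den_ne n k)]
    simp only [Pi.zero_apply] at this
    linear_combination this

lemma sum_choose (n k : ℕ) :
    ∑ p ∈ Finset.HasAntidiagonal.antidiagonal k, (n + p.2).choose n = (n + k + 1).choose (n + 1) := by
  induction k with
  | zero => simp
  | succ k ih =>
    rw [Finset.Nat.sum_antidiagonal_succ]
    simp only
    rw [ih, ← add_assoc, ← Nat.choose_succ_succ]

set_option maxHeartbeats 1000000 in
lemma coef_bound {f h : ℕ → ℂ} (hf : B1 f) (hh : B1 h) : B2 (coef f h) := by
  intro R₀ hR₀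
  obtain ⟨R, hRd⟩ : ∃ R, R = 8 * R₀ := ⟨_, rfl⟩
  have hR : 0 < R := by rw [hRd]; positivity
  obtain ⟨C, hC⟩ := hf R hR
  obtain ⟨H, hH⟩ := hh R hR
  have hC0 : 0 ≤ C := le_trans (by positivity) (hC 0)
  have hH0 : 0 ≤ H := le_trans (by positivity) (hH 0)
  obtain ⟨K, hK⟩ : ∃ K, K = C * R ^ 2 := ⟨_, rfl⟩
  have hK0 : 0 ≤ K := by rw [hK]; positivity
  obtain ⟨N₀, hN₀⟩ := exists_nat_ge K
  obtain ⟨Q, hQ⟩ : ∃ Q : ℝ, Q = ∑ p ∈ Finset.range N₀ ×ˢ Finset.range N₀,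
    ‖coef f h p.1 p.2‖ * R ^ (p.1 + p.2) := ⟨_, rfl⟩
  have hQ0 : 0 ≤ Q := by rw [hQ]; exact Finset.sum_nonneg fun p _ => by positivity
  have hQb : ∀ n k, n < N₀ → k < N₀ → ‖coef f h n k‖ * R ^ (n + k) ≤ Q := by
    intro n k hn hk
    rw [hQ]
    exact Finset.single_le_sum (f := fun p : ℕ × ℕ => ‖coef f h p.1 p.2‖ * R ^ (p.1 + p.2))
      (fun p _ => by positivity) (a := (n, k)) (by simp [hn, hk])
  obtain ⟨M, hM⟩ : ∃ M : ℝ, M = 1 + H * R + Q := ⟨_, rfl⟩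
  have hHR : 0 ≤ H * R := by positivity
  have hM0 : 0 ≤ M := by rw [hM]; positivity
  have main : ∀ n, (∀ k, ‖coef f h n k‖ * R ^ (n + k) ≤ M * 4 ^ n * ((n + k).choose n : ℝ)) ∧
      (∀ k, ‖coef f h (n + 1) k‖ * R ^ (n + 1 + k)
        ≤ M * 4 ^ (n + 1) * ((n + 1 + k).choose (n + 1) : ℝ)) := by
    intro n
    induction n with
    | zero =>
      refine ⟨fun k => ?_, fun k => ?_⟩
      · by_cases hk : k = 0
        · subst hk; simp [coef]; linarith
        · simp [coef, hk]; exact hM0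
      · have h1 := hH k
        have h2 : ‖coef f h (0 + 1) k‖ * R ^ (0 + 1 + k) ≤ M := by
          calc _ = ‖h k‖ * R ^ k * R := by simp only [coef, zero_add]; ring
            _ ≤ H * R := by gcongr
            _ ≤ M := by linarith
        have h3 : (1:ℝ) ≤ ((0 + 1 + k).choose (0 + 1) : ℝ) := by
          exact_mod_cast Nat.choose_pos (by omega)
        calc _ ≤ M := h2
          _ ≤ M * 4 ^ (0 + 1) * 1 := by
            rw [zero_add, pow_one]; linarith
          _ ≤ _ := by gcongr
    | succ n ih =>
      refine ⟨ih.2, fun k => ?_⟩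
      have hu0 : (1:ℝ) ≤ ((n + 1 + 1 + k).choose (n + 1 + 1) : ℝ) := by
        exact_mod_cast Nat.choose_pos (by omega)
      by_cases hN : n + 2 + k < N₀
      · have h1 := hQb (n + 2) k (by omega) (by omega)
        have h4 : (1:ℝ) ≤ 4 ^ (n + 1 + 1) := one_le_pow₀ (by norm_num)
        calc _ ≤ Q := h1
          _ ≤ M * 1 * 1 := by linarith
          _ ≤ _ := by gcongr
      have hN' : K ≤ n + 2 + k := by
        refine hN₀.trans ?_
        exact_mod_cast not_lt.1 hN
      -- abbreviations for binomials
      obtain ⟨u0, hu⟩ : ∃ u : ℝ, u = ((n + 1 + 1 + k).choose (n + 1 + 1) : ℝ) := ⟨_, rfl⟩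
      obtain ⟨u1, hu1⟩ : ∃ u : ℝ, u = ((n + 1 + (k + 1)).choose (n + 1) : ℝ) := ⟨_, rfl⟩
      obtain ⟨u2, hu2⟩ : ∃ u : ℝ, u = ((n + (k + 2)).choose n : ℝ) := ⟨_, rfl⟩
      obtain ⟨v, hv⟩ : ∃ u : ℝ, u = ((n + k + 1).choose (n + 1) : ℝ) := ⟨_, rfl⟩
      have r1 : u0 * (n + 2) = u1 * (k + 1) := by
        have := Nat.choose_succ_right_eq (n + 1 + 1 + k) (n + 1)
        rw [show n + 1 + 1 + k - (n + 1) = k + 1 by omega] at this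
        rw [hu, hu1, show n + 1 + (k + 1) = n + 1 + 1 + k by ring]
        have t : ((n:ℝ) + 2) = ((n + 1 + 1 : ℕ) : ℝ) := by push_cast; ring
        rw [t]; exact_mod_cast this
      have r2 : u1 * (n + 1) = u2 * (k + 2) := by
        have := Nat.choose_succ_right_eq (n + (k + 2)) n
        rw [show n + (k + 2) - n = k + 2 by omega] at this
        rw [hu1, hu2, show n + 1 + (k + 1) = n + (k + 2) by ring]
        exact_mod_cast this
      have r3 : (n + k + 2) * v = u0 * (n + 2) := by
        have := Nat.add_one_mul_choose_eq (n + k + 1) (n + 1)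
        rw [hv, hu, show n + 1 + 1 + k = n + k + 1 + 1 by ring]
        have t : ((n:ℝ) + 2) = ((n + 1 + 1 : ℕ) : ℝ) := by push_cast; ring
        have t' : ((n:ℝ) + k + 2) = ((n + k + 1 + 1 : ℕ) : ℝ) := by push_cast; ring
        rw [t, t']; exact_mod_cast this
      rw [← hu] at hu0 ⊢
      have b1 := ih.2 (k + 1)
      have b2 := ih.1 (k + 2)
      rw [← hu1] at b1
      rw [← hu2] at b2
      have b3 : ‖conv f (coef f h n) k‖ * R ^ (n + 2 + k) ≤ K * (M * 4 ^ n) * v := by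
        calc _ ≤ (∑ p ∈ Finset.HasAntidiagonal.antidiagonal k, ‖f p.1 * coef f h n p.2‖)
                * R ^ (n + 2 + k) :=
              mul_le_mul_of_nonneg_right (norm_sum_le _ _) (by positivity)
          _ = ∑ p ∈ Finset.HasAntidiagonal.antidiagonal k,
                ‖f p.1 * coef f h n p.2‖ * R ^ (n + 2 + k) := by rw [Finset.sum_mul]
          _ ≤ ∑ p ∈ Finset.HasAntidiagonal.antidiagonal k,
                K * (M * 4 ^ n) * ((n + p.2).choose n : ℝ) := by
              refine Finset.sum_le_sum fun p hp => ?_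
              rw [← Finset.HasAntidiagonal.mem_antidiagonal.1 hp, norm_mul]
              calc _ = (‖f p.1‖ * R ^ p.1) * R ^ 2 * (‖coef f h n p.2‖ * R ^ (n + p.2)) := by ring
                _ ≤ C * R ^ 2 * (M * 4 ^ n * ((n + p.2).choose n : ℝ)) := by
                    refine mul_le_mul ?_ (ih.1 _) (by positivity) (by positivity)
                    exact mul_le_mul_of_nonneg_right (hC _) (by positivity)
                _ = _ := by rw [hK]; ring
          _ = _ := by
              rw [← Finset.mul_sum, hv, ← sum_choose]
              push_cast; rfl
      -- the recursion
      have hden : (0:ℝ) < ((n:ℝ) + 1) * (n + 2 + 4 * k) := by positivity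
      have hrec : ((n:ℝ) + 1) * (n + 2 + 4 * k) * ‖coef f h (n + 2) k‖ ≤
          2 * n * (k + 1) * ‖coef f h (n + 1) (k + 1)‖ + (k + 1) * (k + 2) * ‖coef f h n (k + 2)‖
            + ‖conv f (coef f h n) k‖ := by
        have e : ((n:ℂ) + 1) * (n + 2 + 4 * k) * coef f h (n + 2) k =
            2 * n * (k + 1) * coef f h (n + 1) (k + 1)
              - (k + 1) * (k + 2) * coef f h n (k + 2) + conv f (coef f h n) k := by
          rw [coef, mul_div_cancel₀ _ (den_ne n k)]
        have e1 : ‖((n:ℂ) + 1) * (n + 2 + 4 * k)‖ = ((n:ℝ) + 1) * (n + 2 + 4 * k) := by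
          exact_mod_cast Complex.norm_natCast ((n + 1) * (n + 2 + 4 * k))
        have e2 : ‖(2 * n * (k + 1) : ℂ)‖ = (2 * n * (k + 1) : ℝ) := by
          exact_mod_cast Complex.norm_natCast (2 * n * (k + 1))
        have e3 : ‖((k + 1) * (k + 2) : ℂ)‖ = ((k + 1) * (k + 2) : ℝ) := by
          exact_mod_cast Complex.norm_natCast ((k + 1) * (k + 2))
        rw [← e1, ← e2, ← e3, ← norm_mul, ← norm_mul, ← norm_mul, e]
        refine (norm_add_le _ _).trans ?_
        gcongr
        exact norm_sub_le _ _
      have hrec2 : ((n:ℝ) + 1) * (n + 2 + 4 * k) * (‖coef f h (n + 2) k‖ * R ^ (n + 2 + k)) ≤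
          2 * n * (k + 1) * (M * 4 ^ (n + 1) * u1) + (k + 1) * (k + 2) * (M * 4 ^ n * u2)
            + K * (M * 4 ^ n) * v := by
        calc _ = ((n:ℝ) + 1) * (n + 2 + 4 * k) * ‖coef f h (n + 2) k‖ * R ^ (n + 2 + k) := by ring
          _ ≤ (2 * n * (k + 1) * ‖coef f h (n + 1) (k + 1)‖
                + (k + 1) * (k + 2) * ‖coef f h n (k + 2)‖
                + ‖conv f (coef f h n) k‖) * R ^ (n + 2 + k) := by gcongr
          _ = 2 * n * (k + 1) * (‖coef f h (n + 1) (k + 1)‖ * R ^ (n + 1 + (k + 1)))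
                + (k + 1) * (k + 2) * (‖coef f h n (k + 2)‖ * R ^ (n + (k + 2)))
                + ‖conv f (coef f h n) k‖ * R ^ (n + 2 + k) := by ring
          _ ≤ _ := by gcongr
      have hKv : K * v ≤ u0 * (n + 2) := by
        rw [← r3]
        have hv0 : 0 ≤ v := by rw [hv]; positivity
        have : K ≤ n + k + 2 := by linarith
        gcongr
      have hfin : 2 * n * (k + 1) * (M * 4 ^ (n + 1) * u1) + (k + 1) * (k + 2) * (M * 4 ^ n * u2)
            + K * (M * 4 ^ n) * v ≤
          ((n:ℝ) + 1) * (n + 2 + 4 * k) * (M * 4 ^ (n + 1 + 1) * u0) := by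
        have hW : 0 ≤ M * 4 ^ n := by positivity
        have s1 : 2 * n * (k + 1) * (M * 4 ^ (n + 1) * u1) + (k + 1) * (k + 2) * (M * 4 ^ n * u2)
            + K * (M * 4 ^ n) * v
            = (M * 4 ^ n) * (8 * n * (u0 * (n + 2)) + (n + 1) * (u0 * (n + 2)) + K * v) := by
          have : (k + 1) * (k + 2) * (M * 4 ^ n * u2)
              = M * 4 ^ n * ((k + 1) * (u2 * (k + 2))) := by ring
          rw [this, ← r2]
          have : M * 4 ^ n * ((k + 1) * (u1 * (n + 1)))
              = M * 4 ^ n * ((n + 1) * (u1 * (k + 1))) := by ring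
          rw [this, r1]; ring
        have s2 : ((n:ℝ) + 1) * (n + 2 + 4 * k) * (M * 4 ^ (n + 1 + 1) * u0)
            = (M * 4 ^ n) * (16 * ((n:ℝ) + 1) * (n + 2 + 4 * k) * u0) := by ring
        rw [s1, s2]
        refine mul_le_mul_of_nonneg_left ?_ hW
        have hn0 : (0:ℝ) ≤ n := by positivity
        have hk0 : (0:ℝ) ≤ k := by positivity
        have hp : 0 ≤ ((n:ℝ) + 1) * k * u0 := by positivity
        have hp2 : 0 ≤ (n:ℝ) * (n + 2) * u0 := by positivity
        have hp3 : 0 ≤ ((n:ℝ) + 2) * u0 := by positivity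
        linarith
      exact le_of_mul_le_mul_left (hrec2.trans hfin) hden
  refine ⟨M, fun n k => ?_⟩
  have h1 := (main n).1 k
  have h2 : ((n + k).choose n : ℝ) ≤ 2 ^ (n + k) := by
    exact_mod_cast Nat.choose_le_two_pow _ _
  have h3 : (4:ℝ) ^ n ≤ 4 ^ (n + k) := pow_le_pow_right₀ (by norm_num) (by omega)
  have h4 : 8 ^ (n + k) * (‖coef f h n k‖ * R₀ ^ (n + k)) ≤ 8 ^ (n + k) * M := by
    calc _ = ‖coef f h n k‖ * R ^ (n + k) := by rw [hRd, mul_pow]; ring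
      _ ≤ M * 4 ^ n * ((n + k).choose n : ℝ) := h1
      _ ≤ M * 4 ^ (n + k) * 2 ^ (n + k) := by gcongr
      _ = (4 * 2) ^ (n + k) * M := by rw [mul_pow]; ring
      _ = _ := by norm_num
  exact le_of_mul_le_mul_left h4 (by positivity)

lemma S_zero (c : ℕ → ℕ → ℂ) (z : ℂ) : S c z 0 = T (c 0) z := by
  rw [S, T_zero_arg]

lemma deriv_S_zero {c : ℕ → ℕ → ℂ} (hc : B2 c) (z : ℂ) : deriv (S c z) 0 = T (c 1) z := by
  rw [(S_hasDerivAt_x hc z 0).deriv, S_zero]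
  congr 1; ext k; simp [Dx]

lemma T_delta (f h : ℕ → ℂ) (z : ℂ) : T (coef f h 0) z = 1 := by
  rw [T, tsum_eq_single 0]
  · simp [coef]
  · intro k hk; simp [coef, hk]

end SingPDE

/-- For entire data `F`, `h` there is a unique entire solution `ψ : ℂ² → ℂ` of the
singular PDE with `ψ(z,0) = 1` and `ψ_x(z,0) = h(z)`. -/
theorem singular_pde_entire_existence_uniqueness (F h : ℂ → ℂ)
    (hF : Differentiable ℂ F) (hh : Differentiable ℂ h) :
    ∃! ψ : ℂ → ℂ → ℂ,
      Differentiable ℂ (fun p : ℂ × ℂ => ψ p.1 p.2) ∧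
      (∀ z x : ℂ, singPDE F ψ z x = 0) ∧
      (∀ z : ℂ, ψ z 0 = 1 ∧ deriv (ψ z) 0 = h z) := by
  have hf1 := SingPDE.tay_B1 hF
  have hh1 := SingPDE.tay_B1 hh
  have hfT : ∀ z, F z = SingPDE.T (SingPDE.tay F) z := fun z => (SingPDE.T_tay hF z).symm
  have hhT : ∀ z, h z = SingPDE.T (SingPDE.tay h) z := fun z => (SingPDE.T_tay hh z).symm
  have hB := SingPDE.coef_bound hf1 hh1
  refine ⟨SingPDE.S (SingPDE.coef (SingPDE.tay F) (SingPDE.tay h)),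
    ⟨SingPDE.S_differentiable hB, fun z x => ?_, fun z => ⟨?_, ?_⟩⟩, ?_⟩
  · rw [SingPDE.singPDE_S hf1 hfT hB, SingPDE.P_coef]
    simp [SingPDE.S, SingPDE.T]
  · rw [SingPDE.S_zero, SingPDE.T_delta]
  · rw [SingPDE.deriv_S_zero hB, hhT]; rfl
  · rintro ψ ⟨hd, hpde, hini⟩
    obtain ⟨c, hc, rfl⟩ := SingPDE.exists_S hd
    have hP : SingPDE.P (SingPDE.tay F) c = 0 := by
      ext n k
      refine SingPDE.S_inj (SingPDE.B2_P hf1 hc) (fun z x => ?_) n k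
      rw [← SingPDE.singPDE_S hf1 hfT hc]; exact hpde z x
    have h0 : c 0 = SingPDE.coef (SingPDE.tay F) (SingPDE.tay h) 0 := by
      refine SingPDE.T_inj (hc.row 0) (hB.row 0) fun z => ?_
      rw [SingPDE.T_delta, ← SingPDE.S_zero]; exact (hini z).1
    have h1 : c 1 = SingPDE.tay h := by
      refine SingPDE.T_inj (hc.row 1) hh1 fun z => ?_
      rw [← SingPDE.deriv_S_zero hc, ← hhT]; exact (hini z).2
    have : c = SingPDE.coef (SingPDE.tay F) (SingPDE.tay h) :=
      funext fun n => (SingPDE.eq_coef h0 h1 hP n).1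
    rw [this]
end

section
/- Let R > 0, 0 < r₀ < r₁, d₀ = r₁ − r₀, and let F, h be continuous on D̄(0,r₁) and holomorphic on D(0,r₁). Set M = sup_{D(0,r₁)}|h| + (R/2)·sup_{D(0,r₁)}|F| and β = 3r₁. Define, for x ∈ D̄(0,R), the holomorphic function δ₀(x) : z ↦ h(z) + x·∫₀¹ u·F(z u⁴) du on D(0,r₁), and recursively δ_{k+1}(x) : z ↦ 2x·∫₀¹ u·(δ_k(ux))′(z u⁴) du − ∫₀¹ ( ∫_{[0,ux]} [ t·(δ_k(t))″(z u⁴) + 2·(δ_k(t))′(z u⁴) − t·F(z u⁴)·(δ_k(t))(z u⁴) ] dt ) du, where primes denote derivatives of the holomorphic function δ_k(t)(·) and ∫_{[0,ux]} is the integral along the segment from 0 to ux. Then for every s ∈ [0,1), every k ≥ 1 and every x ∈ D̄(0,R): sup_{|z| ≤ r₀ + s·d₀} |δ_k(x)(z)| ≤ M·( e·|x|·(α_k·|x| + β) / (r₀·d₀·(1−s)) )^k, with α_k = 1 + r₀·d₀·(1−s)·sup_{D(0,r₁)}|F| / k; and for k = 0, sup_{|z| ≤ r₀ + s·d₀} |δ₀(x)(z)|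 ≤ M. -/
open Complex Metric intervalIntegral


lemma le_biSup_ball (r₁ : ℝ) (f : ℂ → ℂ) (hf : ContinuousOn f (Metric.closedBall 0 r₁))
    (w : ℂ) (hw : w ∈ Metric.ball (0 : ℂ) r₁) :
    ‖f w‖ ≤ ⨆ w ∈ Metric.ball (0 : ℂ) r₁, ‖f w‖ := by
  obtain ⟨C, hC⟩ := (isCompact_closedBall (0 : ℂ) r₁).exists_bound_of_continuousOn hf
  have hC0 : 0 ≤ C := (norm_nonneg _).trans (hC w (Metric.ball_subset_closedBall hw))
  have hb : BddAbove (Set.range fun w : ℂ => ⨆ _ : w ∈ Metric.ball (0 : ℂ) r₁, ‖f w‖) := by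
    refine ⟨C, ?_⟩
    rintro _ ⟨v, rfl⟩
    exact Real.iSup_le (fun hv => hC v (Metric.ball_subset_closedBall hv)) hC0
  refine le_ciSup_of_le hb w ?_
  simp [hw]

lemma biSup_ball_nonneg (r₁ : ℝ) (f : ℂ → ℂ) :
    0 ≤ ⨆ w ∈ Metric.ball (0 : ℂ) r₁, ‖f w‖ :=
  Real.iSup_nonneg fun _ => Real.iSup_nonneg fun _ => norm_nonneg _

lemma cauchy_ball (f : ℂ → ℂ) (r C : ℝ) (w : ℂ) (hw : ‖w‖ < r)
    (hf : DifferentiableOn ℂ f (Metric.ball 0 r)) (hb : ∀ v, ‖v‖ < r → ‖f v‖ ≤ C) (n : ℕ) :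
    ‖iteratedDeriv n f w‖ ≤ n.factorial * C / (r - ‖w‖) ^ n := by
  have hpos : 0 < r - ‖w‖ := by linarith
  have key : ∀ ρ ∈ Set.Ioo 0 (r - ‖w‖), ‖iteratedDeriv n f w‖ ≤ n.factorial * C / ρ ^ n := by
    intro ρ hρ
    have hsub : Metric.closedBall w ρ ⊆ Metric.ball (0 : ℂ) r := by
      intro v hv
      rw [mem_closedBall, dist_eq_norm] at hv
      rw [mem_ball_zero_iff]
      have : ‖v‖ ≤ ‖v - w‖ + ‖w‖ := by simpa using norm_add_le (v - w) w
      linarith [hρ.2]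
    refine Complex.norm_iteratedDeriv_le_of_forall_mem_sphere_norm_le n hρ.1 ?_ ?_
    · exact (hf.mono hsub).diffContOnCl_ball subset_rfl
    · intro v hv
      exact hb v (by simpa using hsub (sphere_subset_closedBall hv))
  have hc : Filter.Tendsto (fun ρ : ℝ => n.factorial * C / ρ ^ n) (nhdsWithin (r - ‖w‖) (Set.Iio (r - ‖w‖)))
      (nhds (n.factorial * C / (r - ‖w‖) ^ n)) := by
    apply Filter.Tendsto.mono_left _ nhdsWithin_le_nhds
    exact ContinuousAt.div continuousAt_const (by fun_prop) (by positivity)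
  refine ge_of_tendsto hc ?_
  filter_upwards [Ioo_mem_nhdsLT hpos] with ρ hρ using key ρ hρ

lemma int_q (r r' : ℝ) (hr : 0 ≤ r) (hrr : r < r') :
    IntervalIntegrable (fun u : ℝ => u ^ 2 / (r' - r * u ^ 3) ^ 2) MeasureTheory.volume 0 1 ∧
    ∫ u in (0:ℝ)..1, u ^ 2 / (r' - r * u ^ 3) ^ 2 = 1 / (3 * r' * (r' - r)) := by
  have hq : ∀ u ∈ Set.uIcc (0:ℝ) 1, r' - r * u ^ 3 ≠ 0 := by
    intro u hu
    rw [Set.uIcc_of_le zero_le_one] at hu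
    have : u ^ 3 ≤ 1 := pow_le_one₀ hu.1 hu.2
    nlinarith
  have hi : IntervalIntegrable (fun u : ℝ => u ^ 2 / (r' - r * u ^ 3) ^ 2) MeasureTheory.volume 0 1 := by
    apply ContinuousOn.intervalIntegrable
    exact ContinuousOn.div (by fun_prop) (by fun_prop) fun u hu => pow_ne_zero _ (hq u hu)
  refine ⟨hi, ?_⟩
  have hr' : r' ≠ 0 := by linarith
  rw [intervalIntegral.integral_eq_sub_of_hasDerivAt (f := fun u => u ^ 3 / (3 * r' * (r' - r * u ^ 3))) _ hi]
  · simp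
  · intro u hu
    have h1 : HasDerivAt (fun u : ℝ => u ^ 3) (3 * u ^ 2) u := by simpa using hasDerivAt_pow 3 u
    have h2 := ((h1.const_mul r).const_sub r').const_mul (3 * r')
    have hqu := hq u hu
    refine (h1.div h2 (by positivity)).congr_deriv ?_
    rw [div_eq_div_iff (by positivity) (by positivity)]
    ring

lemma picard_step (R r₁ r r' G N : ℝ) (k : ℕ) (hr : 0 < r) (hrr : r < r') (hr' : r' ≤ r₁)
    (hG : 0 ≤ G) (hN : 0 ≤ N)
    (F : ℂ → ℂ) (hF : ∀ w, ‖w‖ < r₁ → ‖F w‖ ≤ N)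
    (D : ℂ → ℂ → ℂ)
    (hD : ∀ x ∈ Metric.closedBall (0 : ℂ) R, DifferentiableOn ℂ (D x) (Metric.ball 0 r₁))
    (x : ℂ) (hx : x ∈ Metric.closedBall (0 : ℂ) R)
    (hb : ∀ t : ℝ, 0 ≤ t → t ≤ 1 → ∀ w, ‖w‖ < r' → ‖D ((t : ℂ) * x) w‖ ≤ G * t ^ k)
    (z : ℂ) (hz : ‖z‖ ≤ r) :
    ‖2 * x * (∫ u in (0:ℝ)..1, (u : ℂ) * deriv (D ((u : ℂ) * x)) ((u : ℂ)^4 * z))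
        - ∫ u in (0:ℝ)..1, ((u : ℂ) * x) *
            ∫ s in (0:ℝ)..1,
              (((s : ℂ) * ((u : ℂ) * x)) *
                  deriv (deriv (D ((s : ℂ) * ((u : ℂ) * x)))) ((u : ℂ)^4 * z)
                + 2 * deriv (D ((s : ℂ) * ((u : ℂ) * x))) ((u : ℂ)^4 * z)
                - ((s : ℂ) * ((u : ℂ) * x)) * F ((u : ℂ)^4 * z) *
                    D ((s : ℂ) * ((u : ℂ) * x)) ((u : ℂ)^4 * z))‖ ≤
      2 * ‖x‖ * (G / (r' - r) * (1 / (k + 2))) +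
       (‖x‖ / (k + 1) * (2 * ‖x‖ * G) * (1 / (3 * r' * (r' - r)))
        + ‖x‖ / (k + 1) * (2 * G / (r' - r)) * (1 / (k + 2))
        + ‖x‖ / (k + 1) * (‖x‖ * N * G)) := by
  have hρ : 0 < r' - r := by linarith
  have hxn : ‖x‖ ≤ R := by simpa using hx
  -- position of the evaluation point
  have hwn : ∀ u : ℝ, 0 ≤ u → u ≤ 1 → ‖(u : ℂ) ^ 4 * z‖ ≤ r * u ^ 3 := by
    intro u h0 h1
    rw [norm_mul, norm_pow, Complex.norm_real, Real.norm_of_nonneg h0]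
    have h3 : u ^ 4 ≤ u ^ 3 := pow_le_pow_of_le_one h0 h1 (by norm_num)
    calc u ^ 4 * ‖z‖ ≤ u ^ 3 * r := by gcongr
      _ = _ := mul_comm _ _
  have hq3 : ∀ u : ℝ, 0 ≤ u → u ≤ 1 → r * u ^ 3 ≤ r := by
    intro u h0 h1
    have : u ^ 3 ≤ 1 := pow_le_one₀ h0 h1
    nlinarith
  have hmem : ∀ t : ℝ, 0 ≤ t → t ≤ 1 → (t : ℂ) * x ∈ Metric.closedBall (0 : ℂ) R := by
    intro t h0 h1
    rw [mem_closedBall_zero_iff, norm_mul, Complex.norm_real, Real.norm_of_nonneg h0]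
    nlinarith [norm_nonneg x]
  have hDt : ∀ t : ℝ, 0 ≤ t → t ≤ 1 → DifferentiableOn ℂ (D ((t : ℂ) * x)) (Metric.ball 0 r') :=
    fun t h0 h1 => (hD _ (hmem t h0 h1)).mono (Metric.ball_subset_ball hr')
  have hd1 : ∀ t : ℝ, 0 ≤ t → t ≤ 1 → ∀ u : ℝ, 0 ≤ u → u ≤ 1 →
      ‖deriv (D ((t : ℂ) * x)) ((u : ℂ) ^ 4 * z)‖ ≤ G * t ^ k / (r' - r) := by
    intro t h0 h1 u u0 u1
    have hw := hwn u u0 u1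
    have hw3 := hq3 u u0 u1
    have := cauchy_ball _ r' (G * t ^ k) ((u : ℂ) ^ 4 * z) (by linarith) (hDt t h0 h1) (hb t h0 h1) 1
    rw [iteratedDeriv_one] at this
    refine this.trans ?_
    simp only [Nat.factorial_one, Nat.cast_one, one_mul, pow_one]
    gcongr
    linarith
  have hd2 : ∀ t : ℝ, 0 ≤ t → t ≤ 1 → ∀ u : ℝ, 0 ≤ u → u ≤ 1 →
      ‖deriv (deriv (D ((t : ℂ) * x))) ((u : ℂ) ^ 4 * z)‖ ≤ 2 * (G * t ^ k) / (r' - r * u ^ 3) ^ 2 := by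
    intro t h0 h1 u u0 u1
    have hw := hwn u u0 u1
    have hw3 := hq3 u u0 u1
    have := cauchy_ball _ r' (G * t ^ k) ((u : ℂ) ^ 4 * z) (by linarith) (hDt t h0 h1) (hb t h0 h1) 2
    rw [iteratedDeriv_succ, iteratedDeriv_one] at this
    refine this.trans ?_
    have : 0 < r' - r * u ^ 3 := by linarith
    simp only [Nat.factorial_two, Nat.cast_ofNat]
    gcongr
  have hpowint : ∀ n : ℕ, ∫ u in (0:ℝ)..1, u ^ n = 1 / ((n : ℝ) + 1) := by
    intro n; simp [integral_pow]
  -- first integral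
  have I1 : ‖∫ u in (0:ℝ)..1, (u : ℂ) * deriv (D ((u : ℂ) * x)) ((u : ℂ)^4 * z)‖ ≤
      G / (r' - r) * (1 / (k + 2)) := by
    have e : ∫ u in (0:ℝ)..1, G / (r' - r) * u ^ (k + 1) = G / (r' - r) * (1 / (k + 2)) := by
      rw [intervalIntegral.integral_const_mul, hpowint]
      push_cast
      ring_nf
    rw [← e]
    refine intervalIntegral.norm_integral_le_of_norm_le zero_le_one ?_
      (Continuous.intervalIntegrable (by fun_prop) _ _)
    refine Filter.Eventually.of_forall fun u hu => ?_
    rw [norm_mul, Complex.norm_real, Real.norm_of_nonneg hu.1.le]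
    calc u * ‖deriv (D ((u : ℂ) * x)) ((u : ℂ) ^ 4 * z)‖ ≤ u * (G * u ^ k / (r' - r)) := by
          gcongr
          · exact hu.1.le
          · exact hd1 u hu.1.le hu.2 u hu.1.le hu.2
      _ = _ := by ring
  -- inner integral
  have I2 : ∀ u : ℝ, 0 ≤ u → u ≤ 1 → ‖∫ s in (0:ℝ)..1,
              (((s : ℂ) * ((u : ℂ) * x)) *
                  deriv (deriv (D ((s : ℂ) * ((u : ℂ) * x)))) ((u : ℂ)^4 * z)
                + 2 * deriv (D ((s : ℂ) * ((u : ℂ) * x))) ((u : ℂ)^4 * z)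
                - ((s : ℂ) * ((u : ℂ) * x)) * F ((u : ℂ)^4 * z) *
                    D ((s : ℂ) * ((u : ℂ) * x)) ((u : ℂ)^4 * z))‖ ≤
      (2 * ‖x‖ * G * (u / (r' - r * u ^ 3) ^ 2) + 2 * G / (r' - r) * u ^ k + ‖x‖ * N * G) *
        (1 / (k + 1)) := by
    intro u u0 u1
    rw [← hpowint, ← intervalIntegral.integral_const_mul]
    refine intervalIntegral.norm_integral_le_of_norm_le zero_le_one ?_
      (Continuous.intervalIntegrable (by fun_prop) _ _)
    refine Filter.Eventually.of_forall fun s hs => ?_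
    have s0 := hs.1.le
    have s1 := hs.2
    have su0 : 0 ≤ s * u := mul_nonneg s0 u0
    have su1 : s * u ≤ 1 := mul_le_one₀ s1 u0 u1
    have hsu : (s : ℂ) * ((u : ℂ) * x) = ((s * u : ℝ) : ℂ) * x := by push_cast; ring
    have hw := hwn u u0 u1
    have hw3 := hq3 u u0 u1
    have hq : 0 < r' - r * u ^ 3 := by linarith
    rw [hsu]
    have b1 := hd1 (s * u) su0 su1 u u0 u1
    have b2 := hd2 (s * u) su0 su1 u u0 u1
    have b0 := hb (s * u) su0 su1 ((u : ℂ) ^ 4 * z) (by linarith)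
    have bF := hF ((u : ℂ) ^ 4 * z) (by linarith)
    have hn : ‖((s * u : ℝ) : ℂ) * x‖ = s * u * ‖x‖ := by
      rw [norm_mul, Complex.norm_real, Real.norm_of_nonneg su0]
    have huk : u ^ k ≤ 1 := pow_le_one₀ u0 u1
    have hsk : 0 ≤ s ^ k := pow_nonneg s0 k
    refine (norm_sub_le _ _).trans ?_
    refine (add_le_add (norm_add_le _ _) le_rfl).trans ?_
    simp only [norm_mul _ (F _), norm_mul _ (deriv _ _), norm_mul _ (deriv (deriv _) _), norm_mul _ (D _ _), hn,
      Complex.norm_ofNat]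
    have t1 : s * u * ‖x‖ * ‖deriv (deriv (D (((s * u : ℝ) : ℂ) * x))) ((u : ℂ) ^ 4 * z)‖ ≤
        2 * ‖x‖ * G * (u / (r' - r * u ^ 3) ^ 2) * s ^ k := by
      calc _ ≤ s * u * ‖x‖ * (2 * (G * (s * u) ^ k) / (r' - r * u ^ 3) ^ 2) := by gcongr
        _ = (s * u ^ k) * (2 * ‖x‖ * G * (u / (r' - r * u ^ 3) ^ 2) * s ^ k) := by
          rw [mul_pow]; ring
        _ ≤ 1 * (2 * ‖x‖ * G * (u / (r' - r * u ^ 3) ^ 2) * s ^ k) := by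
          gcongr
          exact mul_le_one₀ s1 (by positivity) huk
        _ = _ := one_mul _
    have t2 : 2 * ‖deriv (D (((s * u : ℝ) : ℂ) * x)) ((u : ℂ) ^ 4 * z)‖ ≤
        2 * G / (r' - r) * u ^ k * s ^ k := by
      calc _ ≤ 2 * (G * (s * u) ^ k / (r' - r)) := by gcongr
        _ = _ := by rw [mul_pow]; ring
    have t3 : s * u * ‖x‖ * ‖F ((u : ℂ) ^ 4 * z)‖ * ‖D (((s * u : ℝ) : ℂ) * x) ((u : ℂ) ^ 4 * z)‖ ≤
        ‖x‖ * N * G * s ^ k := by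
      calc _ ≤ s * u * ‖x‖ * N * (G * (s * u) ^ k) := by gcongr
        _ = ((s * u) * u ^ k) * (‖x‖ * N * G * s ^ k) := by rw [mul_pow]; ring
        _ ≤ 1 * (‖x‖ * N * G * s ^ k) := by
          gcongr
          exact mul_le_one₀ su1 (by positivity) huk
        _ = _ := one_mul _
    linarith
  obtain ⟨hqi, hqv⟩ := int_q r r' hr.le hrr
  have I3 : ‖∫ u in (0:ℝ)..1, ((u : ℂ) * x) *
            ∫ s in (0:ℝ)..1,
              (((s : ℂ) * ((u : ℂ) * x)) *
                  deriv (deriv (D ((s : ℂ) * ((u : ℂ) * x)))) ((u : ℂ)^4 * z)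
                + 2 * deriv (D ((s : ℂ) * ((u : ℂ) * x))) ((u : ℂ)^4 * z)
                - ((s : ℂ) * ((u : ℂ) * x)) * F ((u : ℂ)^4 * z) *
                    D ((s : ℂ) * ((u : ℂ) * x)) ((u : ℂ)^4 * z))‖ ≤
       ‖x‖ / (k + 1) * (2 * ‖x‖ * G) * (1 / (3 * r' * (r' - r)))
        + ‖x‖ / (k + 1) * (2 * G / (r' - r)) * (1 / (k + 2))
        + ‖x‖ / (k + 1) * (‖x‖ * N * G) := by
    have i1 := hqi.const_mul (‖x‖ / (k + 1) * (2 * ‖x‖ * G))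
    have i2 : IntervalIntegrable (fun u : ℝ => ‖x‖ / (k + 1) * (2 * G / (r' - r)) * u ^ (k + 1))
      MeasureTheory.volume 0 1 := Continuous.intervalIntegrable (by fun_prop) _ _
    have i3 : IntervalIntegrable (fun _ : ℝ => ‖x‖ / (k + 1) * (‖x‖ * N * G))
      MeasureTheory.volume 0 1 := Continuous.intervalIntegrable (by fun_prop) _ _
    have e : ∫ u in (0:ℝ)..1, (‖x‖ / (k + 1) * (2 * ‖x‖ * G) * (u ^ 2 / (r' - r * u ^ 3) ^ 2)
        + ‖x‖ / (k + 1) * (2 * G / (r' - r)) * u ^ (k + 1)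
        + ‖x‖ / (k + 1) * (‖x‖ * N * G)) =
        ‖x‖ / (k + 1) * (2 * ‖x‖ * G) * (1 / (3 * r' * (r' - r)))
        + ‖x‖ / (k + 1) * (2 * G / (r' - r)) * (1 / (k + 2))
        + ‖x‖ / (k + 1) * (‖x‖ * N * G) := by
      rw [intervalIntegral.integral_add (i1.add i2) i3, intervalIntegral.integral_add i1 i2,
        intervalIntegral.integral_const_mul, intervalIntegral.integral_const_mul, hqv, hpowint,
        intervalIntegral.integral_const]
      have : ((k + 1 : ℕ) : ℝ) + 1 = k + 2 := by push_cast; ring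
      rw [this]
      simp
    rw [← e]
    refine intervalIntegral.norm_integral_le_of_norm_le zero_le_one ?_ ((i1.add i2).add i3)
    refine Filter.Eventually.of_forall fun u hu => ?_
    have u0 := hu.1.le
    rw [norm_mul, norm_mul, Complex.norm_real, Real.norm_of_nonneg u0]
    calc _ ≤ u * ‖x‖ * ((2 * ‖x‖ * G * (u / (r' - r * u ^ 3) ^ 2) + 2 * G / (r' - r) * u ^ k + ‖x‖ * N * G) *
        (1 / (k + 1))) := by
          gcongr
          exact I2 u u0 hu.2
      _ = ‖x‖ / (k + 1) * (2 * ‖x‖ * G) * (u ^ 2 / (r' - r * u ^ 3) ^ 2)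
        + ‖x‖ / (k + 1) * (2 * G / (r' - r)) * u ^ (k + 1)
        + u * (‖x‖ / (k + 1) * (‖x‖ * N * G)) := by ring
      _ ≤ _ := by
        refine add_le_add le_rfl ?_
        exact mul_le_of_le_one_left (by positivity) hu.2
  refine (norm_sub_le _ _).trans (add_le_add ?_ I3)
  rw [norm_mul, norm_mul, Complex.norm_ofNat]
  gcongr

lemma step_arith (r₀ r₁ r' ρ d N G X : ℝ) (k : ℕ) (hr₀ : 0 < r₀) (hr : r₀ ≤ r') (hr' : r' ≤ r₁)
    (hd : 0 < d) (hρ : ρ = d / (k + 1)) (hN : 0 ≤ N) (hG : 0 ≤ G) (hX : 0 ≤ X) :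
    2 * X * (G / ρ * (1 / (k + 2))) +
       (X / (k + 1) * (2 * X * G) * (1 / (3 * r' * ρ))
        + X / (k + 1) * (2 * G / ρ) * (1 / (k + 2))
        + X / (k + 1) * (X * N * G)) ≤
      G * (X * ((1 + r₀ * d * N / (k + 1 : ℕ)) * X + 3 * r₁) / (r₀ * d)) := by
  have hk : (0 : ℝ) < k + 1 := by positivity
  have hr'0 : 0 < r' := by linarith
  have e1 : 2 * X * (G / ρ * (1 / (k + 2))) +
       (X / (k + 1) * (2 * X * G) * (1 / (3 * r' * ρ))
        + X / (k + 1) * (2 * G / ρ) * (1 / (k + 2))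
        + X / (k + 1) * (X * N * G)) =
      G * X / d * 2 + G * X ^ 2 / d * (2 / (3 * r')) + G * X ^ 2 * N / (k + 1) := by
    subst hρ
    field_simp
    ring
  have e2 : G * (X * ((1 + r₀ * d * N / (k + 1 : ℕ)) * X + 3 * r₁) / (r₀ * d)) =
      G * X / d * (3 * r₁ / r₀) + G * X ^ 2 / d * (1 / r₀) + G * X ^ 2 * N / (k + 1) := by
    push_cast
    field_simp
    ring
  rw [e1, e2]
  have h1 : 2 ≤ 3 * r₁ / r₀ := by
    rw [le_div_iff₀ hr₀]; linarith
  have h2 : 2 / (3 * r') ≤ 1 / r₀ := by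
    rw [div_le_div_iff₀ (by positivity) hr₀]; linarith
  gcongr

lemma exp_arith (k : ℕ) (hk : 1 ≤ k) : ((k + 1 : ℝ) / k) ^ k ≤ Real.exp 1 := by
  have hk0 : (0 : ℝ) < k := by exact_mod_cast hk
  have h1 : (k + 1 : ℝ) / k ≤ Real.exp (1 / k) := by
    have := Real.add_one_le_exp (1 / (k : ℝ))
    calc (k + 1 : ℝ) / k = 1 / k + 1 := by field_simp; ring
      _ ≤ _ := this
  calc ((k + 1 : ℝ) / k) ^ k ≤ (Real.exp (1 / k)) ^ k := by gcongr
    _ = Real.exp 1 := by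
      rw [← Real.exp_nat_mul]
      congr 1
      field_simp

/-- Geometric-type bound on the successive differences `δ_k` of the Picard iterates
for the fixed-point integral equation of the singular PDE:
`sup_{|z| ≤ r₀ + s d₀} |δ_k(x)(z)| ≤ M (e |x| (α_k |x| + β)/(r₀ d₀ (1−s)))^k`,
with `α_k = 1 + r₀ d₀ (1−s) ‖F‖/k`, `β = 3 r₁`, and `M ≥ sup |δ₀(x)|`. -/
theorem picard_iterates_bound (R r₀ r₁ d₀ : ℝ)
    (hR : 0 < R) (hr₀ : 0 < r₀) (hr₀₁ : r₀ < r₁) (hd₀ : d₀ = r₁ - r₀)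
    (F h : ℂ → ℂ)
    (hFc : ContinuousOn F (Metric.closedBall 0 r₁))
    (hFd : DifferentiableOn ℂ F (Metric.ball 0 r₁))
    (hhc : ContinuousOn h (Metric.closedBall 0 r₁))
    (hhd : DifferentiableOn ℂ h (Metric.ball 0 r₁))
    (δ : ℕ → ℂ → ℂ → ℂ)
    (hδdiff : ∀ k : ℕ, ∀ x ∈ Metric.closedBall (0 : ℂ) R,
      DifferentiableOn ℂ (δ k x) (Metric.ball 0 r₁))
    (hδ0 : ∀ x ∈ Metric.closedBall (0 : ℂ) R, ∀ z ∈ Metric.ball (0 : ℂ) r₁,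
      δ 0 x z = h z + x * ∫ u in (0:ℝ)..1, (u : ℂ) * F ((u : ℂ)^4 * z))
    (hδrec : ∀ k : ℕ, ∀ x ∈ Metric.closedBall (0 : ℂ) R, ∀ z ∈ Metric.ball (0 : ℂ) r₁,
      δ (k + 1) x z =
        2 * x * (∫ u in (0:ℝ)..1, (u : ℂ) * deriv (δ k ((u : ℂ) * x)) ((u : ℂ)^4 * z))
        - ∫ u in (0:ℝ)..1, ((u : ℂ) * x) *
            ∫ s in (0:ℝ)..1,
              (((s : ℂ) * ((u : ℂ) * x)) *
                  deriv (deriv (δ k ((s : ℂ) * ((u : ℂ) * x)))) ((u : ℂ)^4 * z)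
                + 2 * deriv (δ k ((s : ℂ) * ((u : ℂ) * x))) ((u : ℂ)^4 * z)
                - ((s : ℂ) * ((u : ℂ) * x)) * F ((u : ℂ)^4 * z) *
                    δ k ((s : ℂ) * ((u : ℂ) * x)) ((u : ℂ)^4 * z))) :
    ∀ s : ℝ, 0 ≤ s → s < 1 → ∀ x ∈ Metric.closedBall (0 : ℂ) R,
      (∀ z : ℂ, ‖z‖ ≤ r₀ + s * d₀ →
        ‖δ 0 x z‖ ≤ (⨆ w ∈ Metric.ball (0 : ℂ) r₁, ‖h w‖)
          + (R/2) * (⨆ w ∈ Metric.ball (0 : ℂ) r₁, ‖F w‖)) ∧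
      (∀ k : ℕ, 1 ≤ k → ∀ z : ℂ, ‖z‖ ≤ r₀ + s * d₀ →
        ‖δ k x z‖ ≤
          ((⨆ w ∈ Metric.ball (0 : ℂ) r₁, ‖h w‖)
              + (R/2) * (⨆ w ∈ Metric.ball (0 : ℂ) r₁, ‖F w‖)) *
            (Real.exp 1 * ‖x‖ *
                ((1 + r₀ * d₀ * (1 - s) * (⨆ w ∈ Metric.ball (0 : ℂ) r₁, ‖F w‖) / k) * ‖x‖
                  + 3 * r₁) /
              (r₀ * d₀ * (1 - s)))^k) := by
  have hFN : ∀ w, ‖w‖ < r₁ → ‖F w‖ ≤ ⨆ w ∈ Metric.ball (0 : ℂ) r₁, ‖F w‖ :=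
    fun w hw => le_biSup_ball r₁ F hFc w (by simpa using hw)
  have hhN : ∀ w, ‖w‖ < r₁ → ‖h w‖ ≤ ⨆ w ∈ Metric.ball (0 : ℂ) r₁, ‖h w‖ :=
    fun w hw => le_biSup_ball r₁ h hhc w (by simpa using hw)
  have hN0 := biSup_ball_nonneg r₁ F
  have hH0 := biSup_ball_nonneg r₁ h
  generalize (⨆ w ∈ Metric.ball (0 : ℂ) r₁, ‖F w‖) = N at *
  generalize (⨆ w ∈ Metric.ball (0 : ℂ) r₁, ‖h w‖) = H at *
  have hM0 : 0 ≤ H + R / 2 * N := by positivity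
  have hd0 : 0 < d₀ := by linarith
  have hlt : ∀ s : ℝ, s < 1 → r₀ + s * d₀ < r₁ := by
    intro s hs
    nlinarith
  have zero : ∀ x ∈ Metric.closedBall (0 : ℂ) R, ∀ z : ℂ, ‖z‖ < r₁ →
      ‖δ 0 x z‖ ≤ H + R / 2 * N := by
    intro x hx z hz
    rw [hδ0 x hx z (by simpa using hz)]
    have hxn : ‖x‖ ≤ R := by simpa using hx
    have hI : ‖∫ u in (0:ℝ)..1, (u : ℂ) * F ((u : ℂ)^4 * z)‖ ≤ N / 2 := by
      have e : ∫ u in (0:ℝ)..1, N * u = N / 2 := by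
        rw [intervalIntegral.integral_const_mul, integral_id]; ring
      rw [← e]
      refine intervalIntegral.norm_integral_le_of_norm_le zero_le_one ?_
        (Continuous.intervalIntegrable (by fun_prop) _ _)
      refine Filter.Eventually.of_forall fun u hu => ?_
      rw [norm_mul, Complex.norm_real, Real.norm_of_nonneg hu.1.le, mul_comm]
      refine mul_le_mul_of_nonneg_right (hFN _ ?_) hu.1.le
      rw [norm_mul, norm_pow, Complex.norm_real, Real.norm_of_nonneg hu.1.le]
      have : u ^ 4 ≤ 1 := pow_le_one₀ hu.1.le hu.2
      nlinarith [norm_nonneg z]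
    refine (norm_add_le _ _).trans (add_le_add (hhN z hz) ?_)
    rw [norm_mul]
    calc _ ≤ R * (N / 2) := by gcongr
      _ = _ := by ring
  generalize hMdef : H + R / 2 * N = M at *
  have main : ∀ k : ℕ, ∀ s : ℝ, 0 ≤ s → s < 1 → ∀ x ∈ Metric.closedBall (0 : ℂ) R,
      ∀ z : ℂ, ‖z‖ ≤ r₀ + s * d₀ →
        ‖δ (k + 1) x z‖ ≤ M * (Real.exp 1 * ‖x‖ *
                ((1 + r₀ * d₀ * (1 - s) * N / (k + 1 : ℕ)) * ‖x‖ + 3 * r₁) /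
              (r₀ * d₀ * (1 - s))) ^ (k + 1) := by
    intro k
    induction k with
    | zero =>
      intro s hs0 hs1 x hx z hz
      have h1s : 0 < 1 - s := by linarith
      have hsd : 0 ≤ s * d₀ := by positivity
      rw [hδrec 0 x hx z (by simpa using hz.trans_lt (hlt s hs1))]
      have st := picard_step R r₁ (r₀ + s * d₀) r₁ M N 0 (by linarith) (hlt s hs1) le_rfl hM0 hN0 F hFN
        (δ 0) (hδdiff 0) x hx (fun t t0 t1 w hw => by
          rw [pow_zero, mul_one]
          refine zero _ ?_ w hw
          rw [mem_closedBall_zero_iff, norm_mul, Complex.norm_real, Real.norm_of_nonneg t0]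
          have hxn : ‖x‖ ≤ R := by simpa using hx
          nlinarith [norm_nonneg x]) z hz
      refine st.trans ?_
      have ar := step_arith r₀ r₁ r₁ (r₁ - (r₀ + s * d₀)) (d₀ * (1 - s)) N M ‖x‖ 0 hr₀ hr₀₁.le le_rfl
        (by positivity) (by subst hd₀; push_cast; ring) hN0 hM0 (norm_nonneg x)
      refine ar.trans ?_
      rw [zero_add, pow_one, ← mul_assoc r₀]
      have hr₁ : 0 < r₁ := by linarith
      have he : 1 ≤ Real.exp 1 := Real.one_le_exp zero_le_one
      gcongr
      exact le_mul_of_one_le_left (norm_nonneg x) he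
    | succ j ih =>
      intro s hs0 hs1 x hx z hz
      have h1s : 0 < 1 - s := by linarith
      have hsd : 0 ≤ s * d₀ := by positivity
      have hr₁ : 0 < r₁ := by linarith
      have hxn : ‖x‖ ≤ R := by simpa using hx
      rw [hδrec (j + 1) x hx z (by simpa using hz.trans_lt (hlt s hs1))]
      obtain ⟨s', hs'⟩ : ∃ s' : ℝ, s' = s + (1 - s) / ((j + 1 : ℕ) + 1) := ⟨_, rfl⟩
      have h1s' : 1 - s' = (1 - s) * ((j + 1 : ℕ) / ((j + 1 : ℕ) + 1)) := by
        rw [hs']; field_simp; ring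
      have hss : s < s' := by
        rw [hs']
        have : 0 < (1 - s) / (((j + 1 : ℕ) : ℝ) + 1) := by positivity
        linarith
      have h1s'0 : 0 < 1 - s' := by rw [h1s']; positivity
      have hα : r₀ * d₀ * (1 - s') * N / (j + 1 : ℕ) = r₀ * d₀ * (1 - s) * N / (j + 1 + 1 : ℕ) := by
        rw [h1s']; push_cast; field_simp
      obtain ⟨A, hA⟩ : ∃ A : ℝ, A = (1 + r₀ * d₀ * (1 - s) * N / (j + 1 + 1 : ℕ)) * ‖x‖ + 3 * r₁ :=
        ⟨_, rfl⟩
      have hA0 : 0 ≤ A := by rw [hA]; positivity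
      obtain ⟨G, hG⟩ : ∃ G : ℝ, G = M * (Real.exp 1 * ‖x‖ * A / (r₀ * d₀ * (1 - s'))) ^ (j + 1) :=
        ⟨_, rfl⟩
      have hG0 : 0 ≤ G := by rw [hG]; positivity
      have st := picard_step R r₁ (r₀ + s * d₀) (r₀ + s' * d₀) G N (j + 1) (by linarith)
        (by nlinarith) (hlt s' (by linarith)).le hG0 hN0 F hFN
        (δ (j + 1)) (hδdiff (j + 1)) x hx (fun t t0 t1 w hw => by
          have hn : ‖(t : ℂ) * x‖ = t * ‖x‖ := by
            rw [norm_mul, Complex.norm_real, Real.norm_of_nonneg t0]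
          have htx : t * ‖x‖ ≤ ‖x‖ := mul_le_of_le_one_left (norm_nonneg x) t1
          have := ih s' (by linarith) (by linarith) ((t : ℂ) * x)
            (by rw [mem_closedBall_zero_iff, hn]; linarith) w hw.le
          refine this.trans ?_
          rw [hn, hα, hG, mul_assoc M, ← mul_pow]
          have e : Real.exp 1 * ‖x‖ * A / (r₀ * d₀ * (1 - s')) * t
            = Real.exp 1 * (t * ‖x‖) * A / (r₀ * d₀ * (1 - s')) := by ring
          rw [e, hA]
          gcongr) z hz
      refine st.trans ?_
      have ar := step_arith r₀ r₁ (r₀ + s' * d₀) (r₀ + s' * d₀ - (r₀ + s * d₀)) (d₀ * (1 - s)) N G ‖x‖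
        (j + 1) hr₀ (by nlinarith) (hlt s' (by linarith)).le
        (by positivity) (by rw [hs']; field_simp; ring) hN0 hG0 (norm_nonneg x)
      refine ar.trans ?_
      rw [← mul_assoc r₀, ← hA, hG]
      have e1 : Real.exp 1 * ‖x‖ * A / (r₀ * d₀ * (1 - s')) =
          (Real.exp 1 * ‖x‖ * A / (r₀ * d₀ * (1 - s))) * ((((j + 1 : ℕ) : ℝ) + 1) / (j + 1 : ℕ)) := by
        rw [h1s']; field_simp
      have e2 := exp_arith (j + 1) (by omega)
      rw [e1, mul_pow]
      calc _ = M * (Real.exp 1 * ‖x‖ * A / (r₀ * d₀ * (1 - s))) ^ (j + 1) *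
            (‖x‖ * A / (r₀ * d₀ * (1 - s))) * ((((j + 1 : ℕ) : ℝ) + 1) / (j + 1 : ℕ)) ^ (j + 1) := by ring
        _ ≤ M * (Real.exp 1 * ‖x‖ * A / (r₀ * d₀ * (1 - s))) ^ (j + 1) *
            (‖x‖ * A / (r₀ * d₀ * (1 - s))) * Real.exp 1 := by gcongr
        _ = _ := by rw [pow_succ _ (j + 1)]; ring
  intro s hs0 hs1 x hx
  refine ⟨fun z hz => zero x hx z (hz.trans_lt (hlt s hs1)), ?_⟩
  intro k hk z hz
  obtain ⟨j, rfl⟩ : ∃ j, k = j + 1 := ⟨k - 1, by omega⟩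
  exact main j s hs0 hs1 x hx z hz
end

section
/- Let F and h be holomorphic on a neighborhood of 0 ∈ ℂ. Then there exists a function Ψ(z,ẑ), holomorphic on a neighborhood of (0,0) ∈ ℂ², such that: (i) Ψ(ẑ², ẑ) = 1 for all ẑ near 0; (ii) for all ẑ ≠ 0 near 0, −(1/(2ẑ))·(∂Ψ/∂ẑ)(ẑ², ẑ) = h(ẑ²); (iii) the function Ψ̃(z,ẑ) := Ψ(z,ẑ)/(z − ẑ²) satisfies, at every point near (0,0) with z ≠ ẑ², the linear PDE ∂²Ψ̃/∂z² − (2ẑ/(z − ẑ²))·∂²Ψ̃/∂z∂ẑ − (1/(z − ẑ²))·∂²Ψ̃/∂ẑ² = F(z)·Ψ̃. Moreover Ψ is unique as a germ at (0,0), and if F and h are entire then Ψ extends to an entire function on ℂ². -/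
open Complex Metric

/-- The left-hand side of the linear PDE
`Ψ̃_zz − (2ẑ/(z−ẑ²)) Ψ̃_zẑ − (1/(z−ẑ²)) Ψ̃_ẑẑ` for a function `Ψ̃(z,ẑ)`;
here `zh` stands for the variable `ẑ`. -/
noncomputable def pdeLHS (Ψ : ℂ → ℂ → ℂ) (z zh : ℂ) : ℂ :=
  deriv (deriv (fun w => Ψ w zh)) z
    - (2*zh/(z - zh^2)) * deriv (fun w => deriv (Ψ w) zh) z
    - (1/(z - zh^2)) * deriv (deriv (Ψ z)) zh


/-! ### Double power series -/

/-- Bounded coefficients on every smaller polydisc. -/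
def dpsS (a : ℕ → ℕ → ℂ) (r : ℝ) : Prop :=
  ∀ s : ℝ, 0 < s → s < r → ∃ M : ℝ, ∀ n k, ‖a n k‖ * s ^ (n + k) ≤ M

/-- Value of a double power series. -/
noncomputable def dpsV (a : ℕ → ℕ → ℂ) (t x : ℂ) : ℂ :=
  ∑' p : ℕ × ℕ, a p.1 p.2 * t ^ p.1 * x ^ p.2

def dpsD1 (a : ℕ → ℕ → ℂ) : ℕ → ℕ → ℂ := fun n k => (n + 1 : ℂ) * a (n + 1) k
def dpsD2 (a : ℕ → ℕ → ℂ) : ℕ → ℕ → ℂ := fun n k => (k + 1 : ℂ) * a n (k + 1)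
def dpsX1 (a : ℕ → ℕ → ℂ) : ℕ → ℕ → ℂ := fun n k => match n with
  | 0 => 0
  | m + 1 => a m k
def dpsX2 (a : ℕ → ℕ → ℂ) : ℕ → ℕ → ℂ := fun n k => match k with
  | 0 => 0
  | m + 1 => a n m
def dpsC (a b : ℕ → ℕ → ℂ) : ℕ → ℕ → ℂ := fun n k =>
  ∑ p ∈ Finset.HasAntidiagonal.antidiagonal n, ∑ q ∈ Finset.HasAntidiagonal.antidiagonal k, a p.1 q.1 * b p.2 q.2

lemma dps_geom {q : ℝ} (h0 : 0 ≤ q) (h1 : q < 1) :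
    Summable (fun p : ℕ × ℕ => q ^ (p.1 + p.2)) := by
  have := summable_geometric_of_lt_one h0 h1
  have h2 := this.mul_of_nonneg this (fun n => pow_nonneg h0 n) (fun n => pow_nonneg h0 n)
  simpa [pow_add] using h2

lemma dpsS.summable {a : ℕ → ℕ → ℂ} {r s : ℝ} (h : dpsS a r) (h0 : 0 ≤ s) (hs : s < r) :
    Summable (fun p : ℕ × ℕ => ‖a p.1 p.2‖ * s ^ (p.1 + p.2)) := by
  obtain ⟨s', h1, h2⟩ := exists_between hs
  have hs' : 0 < s' := h0.trans_lt h1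
  obtain ⟨M, hM⟩ := h s' hs' h2
  have hq : s / s' < 1 := (div_lt_one hs').2 h1
  refine Summable.of_nonneg_of_le (fun p => by positivity) (fun p => ?_)
    ((dps_geom (by positivity) hq).mul_left M)
  have := mul_le_mul_of_nonneg_right (hM p.1 p.2) (by positivity : 0 ≤ (s / s') ^ (p.1 + p.2))
  calc _ = ‖a p.1 p.2‖ * s' ^ (p.1 + p.2) * (s / s') ^ (p.1 + p.2) := by
        rw [div_pow]; field_simp
    _ ≤ _ := this

lemma dps_norm_term {a : ℕ → ℕ → ℂ} {s : ℝ} {t x : ℂ} (ht : ‖t‖ ≤ s) (hx : ‖x‖ ≤ s)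
    (n k : ℕ) : ‖a n k * t ^ n * x ^ k‖ ≤ ‖a n k‖ * s ^ (n + k) := by
  rw [norm_mul, norm_mul, norm_pow, norm_pow, pow_add, mul_assoc]
  have := (norm_nonneg t).trans ht
  gcongr

lemma dpsS.summable_norm {a : ℕ → ℕ → ℂ} {r : ℝ} {t x : ℂ} (h : dpsS a r)
    (ht : ‖t‖ < r) (hx : ‖x‖ < r) :
    Summable (fun p : ℕ × ℕ => ‖a p.1 p.2 * t ^ p.1 * x ^ p.2‖) :=
  Summable.of_nonneg_of_le (fun _ => norm_nonneg _)
    (fun p => dps_norm_term (le_max_left _ _) (le_max_right _ _) p.1 p.2)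
    (h.summable ((norm_nonneg t).trans (le_max_left _ _)) (max_lt ht hx))

lemma dpsS.summable_term {a : ℕ → ℕ → ℂ} {r : ℝ} {t x : ℂ} (h : dpsS a r)
    (ht : ‖t‖ < r) (hx : ‖x‖ < r) :
    Summable (fun p : ℕ × ℕ => a p.1 p.2 * t ^ p.1 * x ^ p.2) :=
  (h.summable_norm ht hx).of_norm

lemma dpsS.add {a b : ℕ → ℕ → ℂ} {r : ℝ} (ha : dpsS a r) (hb : dpsS b r) : dpsS (a + b) r := by
  intro s h0 h1
  obtain ⟨M, hM⟩ := ha s h0 h1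
  obtain ⟨N, hN⟩ := hb s h0 h1
  refine ⟨M + N, fun n k => ?_⟩
  have := mul_le_mul_of_nonneg_right (norm_add_le (a n k) (b n k)) (by positivity : 0 ≤ s ^ (n + k))
  simp only [Pi.add_apply]
  linarith [hM n k, hN n k]

lemma dpsS.smul {a : ℕ → ℕ → ℂ} {r : ℝ} (c : ℂ) (ha : dpsS a r) : dpsS (c • a) r := by
  intro s h0 h1
  obtain ⟨M, hM⟩ := ha s h0 h1
  refine ⟨‖c‖ * M, fun n k => ?_⟩
  simp only [Pi.smul_apply, smul_eq_mul, norm_mul, mul_assoc]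
  exact mul_le_mul_of_nonneg_left (hM n k) (norm_nonneg c)

lemma dpsS.mono {a : ℕ → ℕ → ℂ} {r r' : ℝ} (ha : dpsS a r) (h : r' ≤ r) : dpsS a r' :=
  fun s h0 h1 => ha s h0 (h1.trans_le h)

lemma dps_lin {q : ℝ} (h0 : 0 ≤ q) (h1 : q < 1) (n : ℕ) : (n + 1 : ℝ) * q ^ n ≤ (1 - q)⁻¹ := by
  have h2 : ∑ i ∈ Finset.range (n + 1), q ^ i ≤ (1 - q)⁻¹ := by
    rw [← tsum_geometric_of_lt_one h0 h1]
    exact (summable_geometric_of_lt_one h0 h1).sum_le_tsum _ (fun i _ => pow_nonneg h0 i)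
  have h3 : ∑ i ∈ Finset.range (n + 1), q ^ n ≤ ∑ i ∈ Finset.range (n + 1), q ^ i := by
    refine Finset.sum_le_sum fun i hi => pow_le_pow_of_le_one h0 h1.le ?_
    have := Finset.mem_range.1 hi
    omega
  simp at h3
  linarith

lemma dpsS.D1 {a : ℕ → ℕ → ℂ} {r : ℝ} (ha : dpsS a r) : dpsS (dpsD1 a) r := by
  intro s h0 h1
  obtain ⟨s', h2, h3⟩ := exists_between h1
  have hs' : 0 < s' := h0.trans h2
  obtain ⟨M, hM⟩ := ha s' hs' h3
  have hq : s / s' < 1 := (div_lt_one hs').2 h2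
  have hM0 : 0 ≤ M := le_trans (by positivity) (hM 0 0)
  refine ⟨M / s' * (1 - s / s')⁻¹, fun n k => ?_⟩
  have e : ‖dpsD1 a n k‖ = (n + 1 : ℝ) * ‖a (n + 1) k‖ := by
    have : ((n : ℂ) + 1) = ((n + 1 : ℝ) : ℂ) := by push_cast; rfl
    rw [dpsD1, norm_mul, this, Complex.norm_real, Real.norm_of_nonneg (by positivity)]
  calc ‖dpsD1 a n k‖ * s ^ (n + k)
      = (‖a (n + 1) k‖ * s' ^ (n + 1 + k)) / s' * (((n + 1 : ℝ) * (s / s') ^ n) * (s / s') ^ k) := by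
        rw [e, div_pow, div_pow]; field_simp; ring
    _ ≤ M / s' * ((1 - s / s')⁻¹ * 1) := by
        gcongr
        · exact hM (n + 1) k
        · exact dps_lin (by positivity) hq n
        · exact pow_le_one₀ (by positivity) hq.le
    _ = _ := by ring

lemma dpsS.swap {a : ℕ → ℕ → ℂ} {r : ℝ} (ha : dpsS a r) : dpsS (fun n k => a k n) r := by
  intro s h0 h1
  obtain ⟨M, hM⟩ := ha s h0 h1
  exact ⟨M, fun n k => by rw [add_comm]; exact hM k n⟩

lemma dpsS.D2 {a : ℕ → ℕ → ℂ} {r : ℝ} (ha : dpsS a r) : dpsS (dpsD2 a) r :=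
  ha.swap.D1.swap

lemma dpsS.X1 {a : ℕ → ℕ → ℂ} {r : ℝ} (ha : dpsS a r) : dpsS (dpsX1 a) r := by
  intro s h0 h1
  obtain ⟨M, hM⟩ := ha s h0 h1
  have hM0 : 0 ≤ M := le_trans (by positivity) (hM 0 0)
  refine ⟨M * s, fun n k => ?_⟩
  cases n with
  | zero => simp [dpsX1]; positivity
  | succ n =>
    simp only [dpsX1]
    have := mul_le_mul_of_nonneg_right (hM n k) h0.le
    calc _ = ‖a n k‖ * s ^ (n + k) * s := by ring
      _ ≤ _ := this

lemma dpsX2_eq (a : ℕ → ℕ → ℂ) : dpsX2 a = fun n k => dpsX1 (fun n k => a k n) k n := by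
  funext n k; cases k <;> rfl

lemma dpsS.X2 {a : ℕ → ℕ → ℂ} {r : ℝ} (ha : dpsS a r) : dpsS (dpsX2 a) r := by
  rw [dpsX2_eq]; exact ha.swap.X1.swap

lemma dpsV_swap (a : ℕ → ℕ → ℂ) (t x : ℂ) : dpsV (fun n k => a k n) t x = dpsV a x t := by
  unfold dpsV
  rw [← (Equiv.prodComm ℕ ℕ).tsum_eq]
  refine tsum_congr fun p => ?_
  simp; ring

lemma dpsV_add {a b : ℕ → ℕ → ℂ} {r : ℝ} {t x : ℂ} (ha : dpsS a r) (hb : dpsS b r)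
    (ht : ‖t‖ < r) (hx : ‖x‖ < r) : dpsV (a + b) t x = dpsV a t x + dpsV b t x := by
  unfold dpsV
  rw [← (ha.summable_term ht hx).tsum_add (hb.summable_term ht hx)]
  refine tsum_congr fun p => ?_
  simp; ring

lemma dpsV_smul (c : ℂ) (a : ℕ → ℕ → ℂ) (t x : ℂ) : dpsV (c • a) t x = c * dpsV a t x := by
  unfold dpsV
  rw [← tsum_mul_left]
  refine tsum_congr fun p => ?_
  simp; ring

lemma dps_tsum_succ {f : ℕ × ℕ → ℂ} (h : ∀ k, f (0, k) = 0) :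
    ∑' p : ℕ × ℕ, f p = ∑' p : ℕ × ℕ, f (p.1 + 1, p.2) := by
  have hi : Function.Injective (fun p : ℕ × ℕ => (p.1 + 1, p.2)) := by
    rintro ⟨a, b⟩ ⟨c, d⟩ h; simpa using h
  rw [hi.tsum_eq (f := f)]
  rintro ⟨n, k⟩ hp
  cases n with
  | zero => exact absurd (h k) hp
  | succ n => exact ⟨(n, k), rfl⟩

lemma dpsV_X1 (a : ℕ → ℕ → ℂ) (t x : ℂ) : dpsV (dpsX1 a) t x = t * dpsV a t x := by
  unfold dpsV
  rw [← tsum_mul_left, dps_tsum_succ]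
  · refine tsum_congr fun p => ?_
    simp [dpsX1]; ring
  · intro k; simp [dpsX1]

lemma dpsV_X2 (a : ℕ → ℕ → ℂ) (t x : ℂ) : dpsV (dpsX2 a) t x = x * dpsV a t x := by
  rw [dpsX2_eq, dpsV_swap, dpsV_X1, dpsV_swap]

/-- antidiagonals on pairs -/
instance dpsAnti : Finset.HasAntidiagonal (ℕ × ℕ) where
  antidiagonal p := (Finset.HasAntidiagonal.antidiagonal p.1 ×ˢ Finset.HasAntidiagonal.antidiagonal p.2).map
    (Equiv.prodProdProdComm ℕ ℕ ℕ ℕ).toEmbedding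
  mem_antidiagonal := by
    rintro ⟨n, k⟩ ⟨⟨a, b⟩, ⟨c, d⟩⟩
    simp only [Finset.mem_map, Finset.mem_product, Finset.HasAntidiagonal.mem_antidiagonal]
    constructor
    · rintro ⟨⟨⟨a', c'⟩, ⟨b', d'⟩⟩, ⟨h1, h2⟩, h3⟩
      simp at h3 h1 h2
      simp; omega
    · intro h
      simp at h
      exact ⟨⟨⟨a, c⟩, ⟨b, d⟩⟩, h, rfl⟩

lemma dpsC_term (a b : ℕ → ℕ → ℂ) (t x : ℂ) (p : ℕ × ℕ) :
    ∑ q ∈ Finset.HasAntidiagonal.antidiagonal p, (a q.1.1 q.1.2 * t ^ q.1.1 * x ^ q.1.2) *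
      (b q.2.1 q.2.2 * t ^ q.2.1 * x ^ q.2.2) = dpsC a b p.1 p.2 * t ^ p.1 * x ^ p.2 := by
  simp only [dpsC, Finset.sum_mul]
  change ∑ q ∈ (Finset.HasAntidiagonal.antidiagonal p.1 ×ˢ Finset.HasAntidiagonal.antidiagonal p.2).map
    (Equiv.prodProdProdComm ℕ ℕ ℕ ℕ).toEmbedding, _ = _
  rw [Finset.sum_map, Finset.sum_product]
  refine Finset.sum_congr rfl fun i hi => Finset.sum_congr rfl fun j hj => ?_
  simp only [Finset.HasAntidiagonal.mem_antidiagonal] at hi hj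
  simp only [← hi, ← hj]
  simp; ring

lemma dpsV_C {a b : ℕ → ℕ → ℂ} {r : ℝ} {t x : ℂ} (ha : dpsS a r) (hb : dpsS b r)
    (ht : ‖t‖ < r) (hx : ‖x‖ < r) : dpsV (dpsC a b) t x = dpsV a t x * dpsV b t x := by
  have h1 := Summable.tsum_mul_tsum_eq_tsum_sum_antidiagonal
    (f := fun p : ℕ × ℕ => a p.1 p.2 * t ^ p.1 * x ^ p.2)
    (g := fun p : ℕ × ℕ => b p.1 p.2 * t ^ p.1 * x ^ p.2)
    (ha.summable_term ht hx) (hb.summable_term ht hx)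
    (summable_mul_of_summable_norm (f := fun p : ℕ × ℕ => a p.1 p.2 * t ^ p.1 * x ^ p.2)
    (g := fun p : ℕ × ℕ => b p.1 p.2 * t ^ p.1 * x ^ p.2)
    (ha.summable_norm ht hx) (hb.summable_norm ht hx))
  unfold dpsV
  rw [h1]
  exact tsum_congr fun p => (dpsC_term a b t x p).symm

lemma dpsS.C {a b : ℕ → ℕ → ℂ} {r : ℝ} (ha : dpsS a r) (hb : dpsS b r) : dpsS (dpsC a b) r := by
  intro s h0 h1
  have h2 := ha.summable h0.le h1
  obtain ⟨M, hM⟩ := hb s h0 h1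
  have hM0 : 0 ≤ M := le_trans (by positivity) (hM 0 0)
  refine ⟨(∑' p : ℕ × ℕ, ‖a p.1 p.2‖ * s ^ (p.1 + p.2)) * M, fun n k => ?_⟩
  calc ‖dpsC a b n k‖ * s ^ (n + k)
      ≤ (∑ p ∈ Finset.HasAntidiagonal.antidiagonal n, ∑ q ∈ Finset.HasAntidiagonal.antidiagonal k, ‖a p.1 q.1‖ * ‖b p.2 q.2‖)
        * s ^ (n + k) := by
        gcongr
        refine (norm_sum_le _ _).trans (Finset.sum_le_sum fun p _ => ?_)
        refine (norm_sum_le _ _).trans (Finset.sum_le_sum fun q _ => ?_)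
        rw [norm_mul]
    _ = ∑ p ∈ Finset.HasAntidiagonal.antidiagonal n, ∑ q ∈ Finset.HasAntidiagonal.antidiagonal k,
        (‖a p.1 q.1‖ * s ^ (p.1 + q.1)) * (‖b p.2 q.2‖ * s ^ (p.2 + q.2)) := by
        simp only [Finset.sum_mul]
        refine Finset.sum_congr rfl fun i hi => Finset.sum_congr rfl fun j hj => ?_
        simp only [Finset.HasAntidiagonal.mem_antidiagonal] at hi hj
        simp only [← hi, ← hj]
        ring
    _ ≤ ∑ p ∈ Finset.HasAntidiagonal.antidiagonal n, ∑ q ∈ Finset.HasAntidiagonal.antidiagonal k,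
        (‖a p.1 q.1‖ * s ^ (p.1 + q.1)) * M := by
        gcongr with p _ q _
        exact hM _ _
    _ = (∑ i ∈ Finset.range (n + 1), ∑ j ∈ Finset.range (k + 1), ‖a i j‖ * s ^ (i + j)) * M := by
        simp only [← Finset.sum_mul]
        rw [Finset.Nat.sum_antidiagonal_eq_sum_range_succ
          (fun i _ => ∑ q ∈ Finset.HasAntidiagonal.antidiagonal k, ‖a i q.1‖ * s ^ (i + q.1))]
        congr 1
        refine Finset.sum_congr rfl fun i _ => ?_
        rw [Finset.Nat.sum_antidiagonal_eq_sum_range_succ (fun j _ => ‖a i j‖ * s ^ (i + j))]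
    _ ≤ _ := by
        gcongr
        rw [← Finset.sum_product']
        exact h2.sum_le_tsum _ (fun p _ => by positivity)

/-- Differentiation of a double power series. -/
lemma dpsV_hasFDerivAt {a : ℕ → ℕ → ℂ} {r : ℝ} (ha : dpsS a r) {t x : ℂ}
    (ht : ‖t‖ < r) (hx : ‖x‖ < r) :
    HasFDerivAt (fun p : ℂ × ℂ => dpsV a p.1 p.2)
      (dpsV (dpsD1 a) t x • ContinuousLinearMap.fst ℂ ℂ ℂ
        + dpsV (dpsD2 a) t x • ContinuousLinearMap.snd ℂ ℂ ℂ) (t, x) := by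
  obtain ⟨s, hs, hsr⟩ := exists_between (max_lt ht hx)
  have hs0 : 0 < s := ((norm_nonneg t).trans (le_max_left _ _)).trans_lt hs
  have hA := ha.D1.X1.summable hs0.le hsr
  have hB := ha.D2.X2.summable hs0.le hsr
  have hXD : ∀ n k, dpsX1 (dpsD1 a) n k = n * a n k := by
    intro n k; cases n <;> simp [dpsX1, dpsD1]
  have hYD : ∀ n k, dpsX2 (dpsD2 a) n k = k * a n k := by
    intro n k; cases k <;> simp [dpsX2, dpsD2]
  have hpow : ∀ (n : ℕ) (w : ℂ), ‖w‖ ≤ s → ‖(n : ℂ) * w ^ (n - 1)‖ ≤ n * s ^ n / s := by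
    intro n w hw
    cases n with
    | zero => simp
    | succ n =>
      rw [norm_mul, norm_pow, Complex.norm_natCast, pow_succ, ← mul_assoc,
        mul_div_cancel_right₀ _ hs0.ne']
      simp only [Nat.add_sub_cancel]
      gcongr
  have key := hasFDerivAt_tsum_of_isPreconnected (𝕜 := ℂ)
    (f := fun (p : ℕ × ℕ) (y : ℂ × ℂ) => a p.1 p.2 * y.1 ^ p.1 * y.2 ^ p.2)
    (f' := fun (p : ℕ × ℕ) (y : ℂ × ℂ) =>
      (a p.1 p.2 * ((p.1 : ℂ) * y.1 ^ (p.1 - 1)) * y.2 ^ p.2) • ContinuousLinearMap.fst ℂ ℂ ℂ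
      + (a p.1 p.2 * y.1 ^ p.1 * ((p.2 : ℂ) * y.2 ^ (p.2 - 1))) • ContinuousLinearMap.snd ℂ ℂ ℂ)
    (u := fun p : ℕ × ℕ => ‖dpsX1 (dpsD1 a) p.1 p.2‖ * s ^ (p.1 + p.2) / s
      + ‖dpsX2 (dpsD2 a) p.1 p.2‖ * s ^ (p.1 + p.2) / s)
    (s := Metric.ball (0 : ℂ × ℂ) s) (x₀ := (t, x)) (x := (t, x))
    ((hA.div_const s).add (hB.div_const s)) isOpen_ball (convex_ball _ _).isPreconnected
    ?_ ?_ ?_ ?_ ?_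
  · have s1 : HasSum (fun p : ℕ × ℕ => a p.1 p.2 * ((p.1 : ℂ) * t ^ (p.1 - 1)) * x ^ p.2)
        (dpsV (dpsD1 a) t x) := by
      have := (ha.D1.summable_term ht hx).hasSum
      have hi : Function.Injective (fun p : ℕ × ℕ => (p.1 + 1, p.2)) := by
        rintro ⟨a, b⟩ ⟨c, d⟩ h; simpa using h
      refine (hi.hasSum_iff ?_).1 ?_
      · rintro ⟨n, k⟩ hp
        cases n with
        | zero => simp
        | succ n => exact absurd ⟨(n, k), rfl⟩ hp
      · convert! this using 1
        funext p
        simp only [dpsD1, Function.comp_apply, Nat.add_sub_cancel]; push_cast; ring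
    have s2 : HasSum (fun p : ℕ × ℕ => a p.1 p.2 * t ^ p.1 * ((p.2 : ℂ) * x ^ (p.2 - 1)))
        (dpsV (dpsD2 a) t x) := by
      have := (ha.D2.summable_term ht hx).hasSum
      have hi : Function.Injective (fun p : ℕ × ℕ => (p.1, p.2 + 1)) := by
        rintro ⟨a, b⟩ ⟨c, d⟩ h; simpa using h
      refine (hi.hasSum_iff ?_).1 ?_
      · rintro ⟨n, k⟩ hp
        cases k with
        | zero => simp
        | succ k => exact absurd ⟨(n, k), rfl⟩ hp
      · convert! this using 1
        funext p
        simp only [dpsD2, Function.comp_apply, Nat.add_sub_cancel]; push_cast; ring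
    have := (s1.smul_const (ContinuousLinearMap.fst ℂ ℂ ℂ)).add
      (s2.smul_const (ContinuousLinearMap.snd ℂ ℂ ℂ))
    rw [this.tsum_eq] at key
    exact key
  · rintro ⟨n, k⟩ y -
    have h1 : HasFDerivAt (fun y : ℂ × ℂ => y.1 ^ n)
        (((n : ℂ) * y.1 ^ (n - 1)) • ContinuousLinearMap.fst ℂ ℂ ℂ) y :=
      (hasDerivAt_pow n y.1).comp_hasFDerivAt y hasFDerivAt_fst
    have h2 : HasFDerivAt (fun y : ℂ × ℂ => y.2 ^ k)
        (((k : ℂ) * y.2 ^ (k - 1)) • ContinuousLinearMap.snd ℂ ℂ ℂ) y :=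
      (hasDerivAt_pow k y.2).comp_hasFDerivAt y hasFDerivAt_snd
    have h3 := (h1.const_mul (a n k)).mul h2
    convert! h3 using 1
    ext <;> simp <;> ring
  · rintro ⟨n, k⟩ y hy
    have hy' : ‖y‖ < s := by simpa using hy
    have hy1 : ‖y.1‖ ≤ s := (norm_fst_le y).trans hy'.le
    have hy2 : ‖y.2‖ ≤ s := (norm_snd_le y).trans hy'.le
    simp only [hXD, hYD]
    refine (norm_add_le _ _).trans (add_le_add ?_ ?_)
    · rw [norm_smul]
      calc _ ≤ ‖a n k * ((n : ℂ) * y.1 ^ (n - 1)) * y.2 ^ k‖ * 1 := by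
            gcongr; exact ContinuousLinearMap.norm_fst_le ℂ ℂ ℂ
        _ ≤ (‖a n k‖ * (n * s ^ n / s) * s ^ k) * 1 := by
            rw [norm_mul, norm_mul, norm_pow y.2]
            gcongr
            exact hpow n _ hy1
        _ = _ := by rw [norm_mul, Complex.norm_natCast]; ring
    · rw [norm_smul]
      calc _ ≤ ‖a n k * y.1 ^ n * ((k : ℂ) * y.2 ^ (k - 1))‖ * 1 := by
            gcongr; exact ContinuousLinearMap.norm_snd_le ℂ ℂ ℂ
        _ ≤ (‖a n k‖ * s ^ n * (k * s ^ k / s)) * 1 := by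
            rw [norm_mul, norm_mul, norm_pow y.1]
            gcongr
            exact hpow k _ hy2
        _ = _ := by rw [norm_mul, Complex.norm_natCast]; ring
  · simpa [Prod.norm_def] using hs
  · exact ha.summable_term ht hx
  · simpa [Prod.norm_def] using hs


lemma dpsV_zero (a : ℕ → ℕ → ℂ) : dpsV a 0 0 = a 0 0 := by
  unfold dpsV
  rw [tsum_eq_single (0, 0)]
  · simp
  · rintro ⟨n, k⟩ h
    rcases n with _ | n
    · rcases k with _ | k
      · exact absurd rfl h
      · simp
    · simp

lemma dps_nhds {r : ℝ} (hr : 0 < r) :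
    ∀ᶠ p : ℂ × ℂ in nhds 0, ‖p.1‖ < r ∧ ‖p.2‖ < r := by
  filter_upwards [ball_mem_nhds (0 : ℂ × ℂ) hr] with p hp
  have : ‖p‖ < r := by simpa using hp
  exact ⟨(norm_fst_le p).trans_lt this, (norm_snd_le p).trans_lt this⟩

lemma dps_deriv_zero {a : ℕ → ℕ → ℂ} {r : ℝ} (hr : 0 < r) (ha : dpsS a r)
    (h : ∀ᶠ p : ℂ × ℂ in nhds 0, dpsV a p.1 p.2 = 0) :
    (∀ᶠ p : ℂ × ℂ in nhds 0, dpsV (dpsD1 a) p.1 p.2 = 0) ∧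
    (∀ᶠ p : ℂ × ℂ in nhds 0, dpsV (dpsD2 a) p.1 p.2 = 0) := by
  rw [← Filter.eventually_and]
  filter_upwards [eventually_eventually_nhds.2 h, dps_nhds hr] with p hp hpr
  have h1 := dpsV_hasFDerivAt ha hpr.1 hpr.2
  have h2 : HasFDerivAt (fun p : ℂ × ℂ => dpsV a p.1 p.2) (0 : ℂ × ℂ →L[ℂ] ℂ) p :=
    (hasFDerivAt_const (0 : ℂ) p).congr_of_eventuallyEq hp
  have h3 := h1.unique h2
  have e1 := congrArg (fun L : ℂ × ℂ →L[ℂ] ℂ => L (1, 0)) h3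
  have e2 := congrArg (fun L : ℂ × ℂ →L[ℂ] ℂ => L (0, 1)) h3
  simp at e1 e2
  exact ⟨e1, e2⟩

lemma dps_coeff_zero (n k : ℕ) : ∀ {a : ℕ → ℕ → ℂ} {r : ℝ}, 0 < r → dpsS a r →
    (∀ᶠ p : ℂ × ℂ in nhds 0, dpsV a p.1 p.2 = 0) → a n k = 0 := by
  induction n with
  | zero =>
    induction k with
    | zero =>
      intro a r hr ha h
      have := h.self_of_nhds
      simpa [dpsV_zero] using this
    | succ k ih =>
      intro a r hr ha h
      have := ih hr ha.D2 (dps_deriv_zero hr ha h).2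
      simp only [dpsD2, mul_eq_zero] at this
      exact this.resolve_left (Nat.cast_add_one_ne_zero k)
  | succ n ih =>
    intro a r hr ha h
    have := ih hr ha.D1 (dps_deriv_zero hr ha h).1
    simp only [dpsD1, mul_eq_zero] at this
    exact this.resolve_left (Nat.cast_add_one_ne_zero n)

lemma dps_unique {a b : ℕ → ℕ → ℂ} {r : ℝ} (hr : 0 < r) (ha : dpsS a r) (hb : dpsS b r)
    (h : ∀ᶠ p : ℂ × ℂ in nhds 0, dpsV a p.1 p.2 = dpsV b p.1 p.2) : a = b := by
  funext n k
  have := dps_coeff_zero n k hr (ha.add (hb.smul (-1))) (by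
    filter_upwards [h, dps_nhds hr] with p hp hpr
    rw [dpsV_add ha (hb.smul (-1)) hpr.1 hpr.2, dpsV_smul, hp]; ring)
  simp at this
  linear_combination this

/-- Power series expansion of holomorphic functions of two variables. -/
lemma dps_expand {G : ℂ → ℂ → ℂ} {r R : ℝ} (hr : 0 < r) (hrR : r < R)
    (hG : DifferentiableOn ℂ (fun p : ℂ × ℂ => G p.1 p.2) (ball 0 R ×ˢ ball 0 R)) :
    ∃ a : ℕ → ℕ → ℂ, dpsS a r ∧ ∀ t x : ℂ, ‖t‖ < r → ‖x‖ < r → G t x = dpsV a t x := by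
  have hcont := hG.continuousOn
  have hmemc : ∀ θ : ℝ, circleMap 0 r θ ∈ ball (0 : ℂ) R := by
    intro θ; simpa [abs_of_pos hr] using hrR
  have hcirc : ∀ θ : ℝ, circleMap 0 r θ ≠ 0 := fun θ => by
    have := circleMap_ne_center (c := 0) (R := r) (θ := θ) hr.ne'
    simpa using this
  -- bound
  obtain ⟨M, hM⟩ : ∃ M, ∀ p ∈ (closedBall (0 : ℂ) r ×ˢ closedBall (0 : ℂ) r),
      ‖G p.1 p.2‖ ≤ M := by
    have hc : IsCompact (closedBall (0 : ℂ) r ×ˢ closedBall (0 : ℂ) r) :=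
      (isCompact_closedBall _ _).prod (isCompact_closedBall _ _)
    exact hc.exists_bound_of_continuousOn (hcont.mono
      (Set.prod_mono (closedBall_subset_ball hrR) (closedBall_subset_ball hrR)))
  have hM0 : 0 ≤ M := (norm_nonneg _).trans (hM (0, 0) (by simp [hr.le]))
  have hd1 : ∀ x ∈ ball (0 : ℂ) R, DifferentiableOn ℂ (fun t => G t x) (ball 0 R) := by
    intro x hx
    exact hG.comp (f := fun t => (t, x)) (by fun_prop) (fun t ht => ⟨ht, hx⟩)
  have hd2 : ∀ t ∈ ball (0 : ℂ) R, DifferentiableOn ℂ (fun x => G t x) (ball 0 R) := by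
    intro t ht
    exact hG.comp (f := fun x => (t, x)) (by fun_prop) (fun x hx => ⟨ht, hx⟩)
  -- inner coefficient
  set A : ℕ → ℂ → ℂ := fun k w => (2 * Real.pi * I : ℂ)⁻¹ • ∮ y in C(0, r), (1 / y) ^ k • y⁻¹ • G w y
    with hA
  have one : ∀ f : ℂ → ℂ, DifferentiableOn ℂ f (ball 0 R) → ∀ x : ℂ, ‖x‖ < r →
      HasSum (fun k : ℕ => ((2 * Real.pi * I : ℂ)⁻¹ • ∮ y in C(0, r), (1 / y) ^ k • y⁻¹ • f y)
        * x ^ k) (f x) := by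
    intro f hf x hx
    have hf' : DifferentiableOn ℂ f (closedBall 0 r) := hf.mono (closedBall_subset_ball hrR)
    have h1 := hasSum_cauchyPowerSeries_integral (f := f) (c := 0) (R := r) (w := x)
      (hf'.continuousOn.mono sphere_subset_closedBall |>.circleIntegrable hr.le) hx
    have h2 := DiffContOnCl.two_pi_i_inv_smul_circleIntegral_sub_inv_smul (f := f) (c := 0) (R := r)
      (w := x) (hf'.diffContOnCl_ball subset_rfl) (by simpa using hx)
    rw [zero_add, h2] at h1
    convert! h1 using 1
    funext k
    rw [cauchyPowerSeries_apply]
    simp only [sub_zero, div_eq_mul_inv, one_mul, mul_pow, mul_smul, circleIntegral.integral_smul]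
    simp only [smul_eq_mul]; ring
  have bd : ∀ (f : ℂ → ℂ) (N : ℝ) (k : ℕ), (∀ y ∈ sphere (0 : ℂ) r, ‖f y‖ ≤ N) → 
      ‖(2 * Real.pi * I : ℂ)⁻¹ • ∮ y in C(0, r), (1 / y) ^ k • y⁻¹ • f y‖ ≤ N / r ^ k := by
    intro f N k hf
    refine (circleIntegral.norm_two_pi_i_inv_smul_integral_le_of_norm_le_const hr.le
      (C := N / r ^ k / r) ?_).trans_eq (by field_simp)
    intro y hy
    have : ‖y‖ = r := by simpa using hy
    rw [norm_smul, norm_smul, norm_pow, norm_div, norm_inv, this, norm_one]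
    calc _ ≤ (1 / r) ^ k * (r⁻¹ * N) := by gcongr; exact hf y hy
      _ = _ := by rw [one_div, inv_pow]; field_simp
  have hAb : ∀ k, ∀ w ∈ sphere (0 : ℂ) r, ‖A k w‖ ≤ M / r ^ k := by
    intro k w hw
    exact bd (G w) M k (fun y hy => hM (w, y)
      ⟨sphere_subset_closedBall hw, sphere_subset_closedBall hy⟩)
  have hAc : ∀ k, Continuous (fun θ : ℝ => A k (circleMap 0 r θ)) := by
    intro k
    simp only [hA, circleIntegral]
    refine Continuous.fun_const_smul ?_ _
    refine intervalIntegral.continuous_parametric_intervalIntegral_of_continuous' ?_ _ _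
    have hGc : Continuous (fun q : ℝ × ℝ => G (circleMap 0 r q.1) (circleMap 0 r q.2)) :=
      hcont.comp_continuous (f := fun q : ℝ × ℝ => (circleMap 0 r q.1, circleMap 0 r q.2))
        (by fun_prop) (fun q => ⟨hmemc _, hmemc _⟩)
    have hi : Continuous (fun q : ℝ × ℝ => (circleMap 0 r q.2)⁻¹) :=
      Continuous.inv₀ (by fun_prop) (fun q => hcirc _)
    simp only [Function.uncurry_def, deriv_circleMap, one_div, smul_eq_mul]
    have hcm : Continuous (fun q : ℝ × ℝ => circleMap 0 r q.2) := by fun_prop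
    exact (hcm.mul continuous_const).mul ((hi.pow k).mul (hi.mul hGc))
  set c : ℕ → ℕ → ℂ := fun n k => (2 * Real.pi * I : ℂ)⁻¹ • ∮ w in C(0, r), (1 / w) ^ n • w⁻¹ • A k w with hc
  have hS : dpsS c r := by
    intro s h0 hs
    refine ⟨M, fun n k => ?_⟩
    calc _ ≤ (M / r ^ k / r ^ n) * r ^ (n + k) := by
          gcongr
          exact bd (A k) _ n (hAb k)
      _ = M := by rw [pow_add]; field_simp
  refine ⟨c, hS, fun t x ht hx => ?_⟩
  have hxR : x ∈ ball (0 : ℂ) R := by simpa using hx.trans hrR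
  have H1 := one (fun w => G w x) (hd1 x hxR) t ht
  have H2 := (hS.summable_term ht hx).hasSum
  refine H1.unique (HasSum.prod_fiberwise H2 fun n => ?_)
  have H3 : HasSum (fun k => c n k * x ^ k)
      ((2 * Real.pi * I : ℂ)⁻¹ • ∮ w in C(0, r), (1 / w) ^ n • w⁻¹ • G w x) := by
    have e : ∀ k, c n k * x ^ k = (2 * Real.pi * I : ℂ)⁻¹ •
        ∮ w in C(0, r), (1 / w) ^ n • w⁻¹ • (A k w * x ^ k) := by
      intro k
      simp only [hc, smul_eq_mul, ← mul_assoc]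
      rw [mul_assoc, mul_comm _ (x ^ k), ← circleIntegral.integral_const_mul]
      congr 2
      funext w
      ring
    simp only [e]
    refine HasSum.const_smul _ ?_
    have hq : ‖x‖ / r < 1 := (div_lt_one hr).2 hx
    have hq0 : 0 ≤ ‖x‖ / r := by positivity
    refine intervalIntegral.hasSum_integral_of_dominated_convergence
      (fun k _ => (1 / r) ^ n * M * (‖x‖ / r) ^ k) (fun k => ?_) (fun k => ?_) ?_ ?_ ?_
    · refine Continuous.aestronglyMeasurable ?_
      have hi : Continuous (fun q : ℝ => (circleMap 0 r q)⁻¹) :=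
        Continuous.inv₀ (by fun_prop) (fun q => hcirc _)
      simp only [deriv_circleMap, one_div, smul_eq_mul]
      have hcm : Continuous (fun q : ℝ => circleMap 0 r q) := by fun_prop
      exact (hcm.mul continuous_const).mul ((hi.pow n).mul (hi.mul ((hAc k).mul continuous_const)))
    · refine Filter.Eventually.of_forall fun θ _ => ?_
      have hb := hAb k (circleMap 0 r θ) (circleMap_mem_sphere 0 hr.le θ)
      have hn : ‖circleMap 0 r θ‖ = r := by simp [abs_of_pos hr]
      rw [norm_smul, norm_smul, norm_smul, norm_mul, norm_pow, norm_pow, norm_div, norm_inv,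
        deriv_circleMap, norm_mul, hn, norm_one, norm_I]
      calc _ ≤ r * 1 * ((1 / r) ^ n * (r⁻¹ * (M / r ^ k * ‖x‖ ^ k))) := by gcongr
        _ = _ := by rw [div_pow ‖x‖]; field_simp
    · exact Filter.Eventually.of_forall fun _ _ =>
        (summable_geometric_of_lt_one hq0 hq).mul_left _
    · exact intervalIntegrable_const
    · refine Filter.Eventually.of_forall fun θ _ => ?_
      have := one (G (circleMap 0 r θ)) (hd2 _ (hmemc θ)) x hx
      exact ((this.const_smul _).const_smul _).const_smul _
  have := H3.mul_right (t ^ n)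
  exact this.congr_fun fun k => by simp only; ring

lemma dpsV_dz {a : ℕ → ℕ → ℂ} {r : ℝ} (ha : dpsS a r) {z x : ℂ}
    (ht : ‖z - x ^ 2‖ < r) (hx : ‖x‖ < r) :
    HasDerivAt (fun w => dpsV a (w - x ^ 2) x) (dpsV (dpsD1 a) (z - x ^ 2) x) z := by
  have h1 := dpsV_hasFDerivAt ha ht hx
  have h2 : HasDerivAt (fun w : ℂ => (w - x ^ 2, x)) ((1 : ℂ), (0 : ℂ)) z :=
    ((hasDerivAt_id z).sub_const _).prodMk (hasDerivAt_const _ _)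
  have h3 := HasFDerivAt.comp_hasDerivAt (f := fun w : ℂ => (w - x ^ 2, x)) z h1 h2
  simpa [Function.comp_def] using h3

lemma dpsV_dx {a : ℕ → ℕ → ℂ} {r : ℝ} (ha : dpsS a r) {z x : ℂ}
    (ht : ‖z - x ^ 2‖ < r) (hx : ‖x‖ < r) :
    HasDerivAt (fun y => dpsV a (z - y ^ 2) y)
      (-2 * x * dpsV (dpsD1 a) (z - x ^ 2) x + dpsV (dpsD2 a) (z - x ^ 2) x) x := by
  have h1 := dpsV_hasFDerivAt ha ht hx
  have h2 : HasDerivAt (fun y : ℂ => (z - y ^ 2, y)) (-(2 * x), (1 : ℂ)) x := by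
    have := ((hasDerivAt_pow 2 x).const_sub z).prodMk (hasDerivAt_id x)
    simpa using this
  have h3 := HasFDerivAt.comp_hasDerivAt (f := fun y : ℂ => (z - y ^ 2, y)) x h1 h2
  convert! h3 using 1
  simp; ring

lemma dps_D_comm (a : ℕ → ℕ → ℂ) : dpsD2 (dpsD1 a) = dpsD1 (dpsD2 a) := by
  funext n k; simp only [dpsD1, dpsD2]; ring

lemma pde_formula {a : ℕ → ℕ → ℂ} {r : ℝ} (ha : dpsS a r) {Ψ : ℂ → ℂ → ℂ} {z x : ℂ}
    (hU : ∀ᶠ p : ℂ × ℂ in nhds (z, x), Ψ p.1 p.2 = dpsV a (p.1 - p.2 ^ 2) p.2)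
    (h1 : ‖z - x ^ 2‖ < r) (h2 : ‖x‖ < r) (hD : z ≠ x ^ 2) :
    pdeLHS (fun a b => Ψ a b / (a - b ^ 2)) z x * (z - x ^ 2) ^ 3 =
      (z - x ^ 2) ^ 2 * dpsV (dpsD1 (dpsD1 a)) (z - x ^ 2) x
      + 2 * x * (z - x ^ 2) * dpsV (dpsD1 (dpsD2 a)) (z - x ^ 2) x
      - (z - x ^ 2) * dpsV (dpsD2 (dpsD2 a)) (z - x ^ 2) x
      - 2 * x * dpsV (dpsD2 a) (z - x ^ 2) x := by
  have good : ∀ᶠ p : ℂ × ℂ in nhds (z, x), Ψ p.1 p.2 = dpsV a (p.1 - p.2 ^ 2) p.2 ∧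
      ‖p.1 - p.2 ^ 2‖ < r ∧ ‖p.2‖ < r ∧ p.1 - p.2 ^ 2 ≠ 0 := by
    refine hU.and (Filter.Eventually.and ?_ (Filter.Eventually.and ?_ ?_))
    · exact (Continuous.continuousAt (f := fun p : ℂ × ℂ => ‖p.1 - p.2 ^ 2‖)
        (by fun_prop)).eventually_lt continuousAt_const h1
    · exact (Continuous.continuousAt (f := fun p : ℂ × ℂ => ‖p.2‖)
        (by fun_prop)).eventually_lt continuousAt_const h2
    · exact (Continuous.continuousAt (f := fun p : ℂ × ℂ => p.1 - p.2 ^ 2)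
        (by fun_prop)).eventually_ne (sub_ne_zero.2 hD)
  have slice1 : ∀ {w y : ℂ} {P : ℂ × ℂ → Prop}, (∀ᶠ p in nhds (w, y), P p) →
      ∀ᶠ v in nhds w, P (v, y) := fun {w y P} h =>
    (Continuous.tendsto (f := fun v : ℂ => (v, y)) (by fun_prop) w).eventually h
  have slice2 : ∀ {w y : ℂ} {P : ℂ × ℂ → Prop}, (∀ᶠ p in nhds (w, y), P p) →
      ∀ᶠ v in nhds y, P (w, v) := fun {w y P} h =>
    (Continuous.tendsto (f := fun v : ℂ => (w, v)) (by fun_prop) y).eventually h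
  have good2 := eventually_eventually_nhds.2 good
  have dD1 : ∀ w y : ℂ, HasDerivAt (fun w : ℂ => w - y ^ 2) 1 w := fun w y =>
    (hasDerivAt_id w).sub_const _
  have dD2 : ∀ w y : ℂ, HasDerivAt (fun y : ℂ => w - y ^ 2) (-2 * y) y := fun w y => by
    simpa using (hasDerivAt_pow 2 y).const_sub w
  have step1 : ∀ᶠ p : ℂ × ℂ in nhds (z, x),
      deriv (fun w => Ψ w p.2 / (w - p.2 ^ 2)) p.1 =
        dpsV (dpsD1 a) (p.1 - p.2 ^ 2) p.2 / (p.1 - p.2 ^ 2)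
        - dpsV a (p.1 - p.2 ^ 2) p.2 / (p.1 - p.2 ^ 2) ^ 2 := by
    filter_upwards [good2] with p hp
    obtain ⟨w, y⟩ := p
    obtain ⟨-, g1, g2, g3⟩ := hp.self_of_nhds
    have e : (fun w => Ψ w y / (w - y ^ 2)) =ᶠ[nhds w]
        (fun w => dpsV a (w - y ^ 2) y / (w - y ^ 2)) := by
      filter_upwards [slice1 hp] with v hv
      rw [hv.1]
    rw [e.deriv_eq]
    simp only at g1 g2 g3 ⊢
    rw [((dpsV_dz ha g1 g2).fun_div (dD1 w y) g3).deriv]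
    field_simp
  have step2 : ∀ᶠ p : ℂ × ℂ in nhds (z, x),
      deriv (fun y => Ψ p.1 y / (p.1 - y ^ 2)) p.2 =
        (-2 * p.2 * dpsV (dpsD1 a) (p.1 - p.2 ^ 2) p.2 + dpsV (dpsD2 a) (p.1 - p.2 ^ 2) p.2)
          / (p.1 - p.2 ^ 2)
        + 2 * p.2 * dpsV a (p.1 - p.2 ^ 2) p.2 / (p.1 - p.2 ^ 2) ^ 2 := by
    filter_upwards [good2] with p hp
    obtain ⟨w, y⟩ := p
    obtain ⟨-, g1, g2, g3⟩ := hp.self_of_nhds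
    have e : (fun y => Ψ w y / (w - y ^ 2)) =ᶠ[nhds y]
        (fun y => dpsV a (w - y ^ 2) y / (w - y ^ 2)) := by
      filter_upwards [slice2 hp] with v hv
      rw [hv.1]
    rw [e.deriv_eq]
    simp only at g1 g2 g3 ⊢
    rw [((dpsV_dx ha g1 g2).fun_div (dD2 w y) g3).deriv]
    field_simp
    ring
  have hD0 : z - x ^ 2 ≠ 0 := sub_ne_zero.2 hD
  have e1 : deriv (fun w => Ψ w x / (w - x ^ 2)) =ᶠ[nhds z] fun w =>
      dpsV (dpsD1 a) (w - x ^ 2) x / (w - x ^ 2) - dpsV a (w - x ^ 2) x / (w - x ^ 2) ^ 2 :=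
    slice1 (P := fun p => deriv (fun w => Ψ w p.2 / (w - p.2 ^ 2)) p.1 =
        dpsV (dpsD1 a) (p.1 - p.2 ^ 2) p.2 / (p.1 - p.2 ^ 2)
        - dpsV a (p.1 - p.2 ^ 2) p.2 / (p.1 - p.2 ^ 2) ^ 2) step1
  have e2 : (fun w => deriv (fun y => Ψ w y / (w - y ^ 2)) x) =ᶠ[nhds z] fun w =>
      (-2 * x * dpsV (dpsD1 a) (w - x ^ 2) x + dpsV (dpsD2 a) (w - x ^ 2) x) / (w - x ^ 2)
        + 2 * x * dpsV a (w - x ^ 2) x / (w - x ^ 2) ^ 2 :=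
    slice1 (P := fun p => deriv (fun y => Ψ p.1 y / (p.1 - y ^ 2)) p.2 =
        (-2 * p.2 * dpsV (dpsD1 a) (p.1 - p.2 ^ 2) p.2 + dpsV (dpsD2 a) (p.1 - p.2 ^ 2) p.2)
          / (p.1 - p.2 ^ 2)
        + 2 * p.2 * dpsV a (p.1 - p.2 ^ 2) p.2 / (p.1 - p.2 ^ 2) ^ 2) step2
  have e3 : deriv (fun y => Ψ z y / (z - y ^ 2)) =ᶠ[nhds x] fun y =>
      (-2 * y * dpsV (dpsD1 a) (z - y ^ 2) y + dpsV (dpsD2 a) (z - y ^ 2) y) / (z - y ^ 2)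
        + 2 * y * dpsV a (z - y ^ 2) y / (z - y ^ 2) ^ 2 :=
    slice2 (P := fun p => deriv (fun y => Ψ p.1 y / (p.1 - y ^ 2)) p.2 =
        (-2 * p.2 * dpsV (dpsD1 a) (p.1 - p.2 ^ 2) p.2 + dpsV (dpsD2 a) (p.1 - p.2 ^ 2) p.2)
          / (p.1 - p.2 ^ 2)
        + 2 * p.2 * dpsV a (p.1 - p.2 ^ 2) p.2 / (p.1 - p.2 ^ 2) ^ 2) step2
  have A1 := e1.deriv_eq.trans
      (((dpsV_dz ha.D1 h1 h2).fun_div (dD1 z x) hD0).fun_sub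
        ((dpsV_dz ha h1 h2).fun_div ((dD1 z x).fun_pow 2) (pow_ne_zero 2 hD0))).deriv
  have A2 := e2.deriv_eq.trans
      (((((dpsV_dz ha.D1 h1 h2).const_mul (-2 * x)).fun_add (dpsV_dz ha.D2 h1 h2)).fun_div (dD1 z x)
        hD0).fun_add
        (((dpsV_dz ha h1 h2).const_mul (2 * x)).fun_div ((dD1 z x).fun_pow 2)
          (pow_ne_zero 2 hD0))).deriv
  have A3 := e3.deriv_eq.trans
      ((((((hasDerivAt_id' x).const_mul (-2)).fun_mul (dpsV_dx ha.D1 h1 h2)).fun_add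
        (dpsV_dx ha.D2 h1 h2)).fun_div (dD2 z x) hD0).fun_add
        ((((hasDerivAt_id' x).const_mul 2).fun_mul (dpsV_dx ha h1 h2)).fun_div
          ((dD2 z x).fun_pow 2) (pow_ne_zero 2 hD0))).deriv
  unfold pdeLHS
  rw [A1, A2, A3]
  simp only [dps_D_comm, id]
  generalize dpsV (dpsD1 (dpsD1 a)) (z - x ^ 2) x = Gtt
  generalize dpsV (dpsD1 (dpsD2 a)) (z - x ^ 2) x = Gtx
  generalize dpsV (dpsD2 (dpsD2 a)) (z - x ^ 2) x = Gxx
  generalize dpsV (dpsD1 a) (z - x ^ 2) x = Gt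
  generalize dpsV (dpsD2 a) (z - x ^ 2) x = Gx
  generalize dpsV a (z - x ^ 2) x = G
  obtain ⟨t, rfl⟩ : ∃ t, z = t + x ^ 2 := ⟨z - x ^ 2, by ring⟩
  simp only [add_sub_cancel_right] at hD0 ⊢
  field_simp
  ring

/-- Coefficients of the transformed equation. -/
noncomputable def dpsE (f a : ℕ → ℕ → ℂ) : ℕ → ℕ → ℂ :=
  dpsX1 (dpsX1 (dpsD1 (dpsD1 a))) + ((2 : ℂ) • dpsX2 (dpsX1 (dpsD1 (dpsD2 a)))
    + ((-1 : ℂ) • dpsX1 (dpsD2 (dpsD2 a)) + ((-2 : ℂ) • dpsX2 (dpsD2 a)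
    + (-1 : ℂ) • dpsX1 (dpsX1 (dpsC f a)))))

lemma dpsE_S {f a : ℕ → ℕ → ℂ} {r : ℝ} (hf : dpsS f r) (ha : dpsS a r) : dpsS (dpsE f a) r :=
  ha.D1.D1.X1.X1.add ((ha.D2.D1.X1.X2.smul 2).add ((ha.D2.D2.X1.smul (-1)).add
    ((ha.D2.X2.smul (-2)).add ((hf.C ha).X1.X1.smul (-1)))))

lemma dpsE_V {f a : ℕ → ℕ → ℂ} {r : ℝ} (hf : dpsS f r) (ha : dpsS a r) {t x : ℂ}
    (ht : ‖t‖ < r) (hx : ‖x‖ < r) : dpsV (dpsE f a) t x =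
      t ^ 2 * dpsV (dpsD1 (dpsD1 a)) t x + 2 * x * t * dpsV (dpsD1 (dpsD2 a)) t x
      - t * dpsV (dpsD2 (dpsD2 a)) t x - 2 * x * dpsV (dpsD2 a) t x
      - t ^ 2 * (dpsV f t x * dpsV a t x) := by
  have h5 := (hf.C ha).X1.X1.smul (-1)
  have h4 := ha.D2.X2.smul (-2)
  have h3 := ha.D2.D2.X1.smul (-1)
  have h2 := ha.D2.D1.X1.X2.smul 2
  have h1 := ha.D1.D1.X1.X1
  unfold dpsE
  rw [dpsV_add h1 (h2.add (h3.add (h4.add h5))) ht hx, dpsV_add h2 (h3.add (h4.add h5)) ht hx,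
    dpsV_add h3 (h4.add h5) ht hx, dpsV_add h4 h5 ht hx]
  simp only [dpsV_smul, dpsV_X1, dpsV_X2, dpsV_C hf ha ht hx]
  ring

lemma dpsE_0 (f a : ℕ → ℕ → ℂ) (k : ℕ) : dpsE f a 0 k = -2 * k * a 0 k := by
  cases k with
  | zero => simp [dpsE, dpsX1, dpsX2, dpsD1, dpsD2]
  | succ k => simp [dpsE, dpsX1, dpsX2, dpsD1, dpsD2]; ring

lemma dpsE_1 (f a : ℕ → ℕ → ℂ) (k : ℕ) :
    dpsE f a 1 k = 2 * k * a 1 k - 2 * k * a 1 k - ((k + 1) * (k + 2)) * a 0 (k + 2) := by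
  cases k <;> simp only [dpsE, Pi.add_apply, Pi.smul_apply, smul_eq_mul, dpsX1, dpsX2, dpsD1,
    dpsD2] <;> push_cast <;> ring

lemma dpsE_2 (f a : ℕ → ℕ → ℂ) (n k : ℕ) :
    dpsE f a (n + 2) k = (n + 1) * (n + 2 + 2 * k) * a (n + 2) k
      - (k + 1) * (k + 2) * a (n + 1) (k + 2) - dpsC f a n k := by
  cases k <;> simp [dpsE, dpsX1, dpsX2, dpsD1, dpsD2] <;> ring

/-- Coefficients of the amplitude. -/
noncomputable def ampC (f : ℕ → ℕ → ℂ) (g : ℕ → ℂ) : ℕ → ℕ → ℂ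
  | 0 => fun k => if k = 0 then 1 else 0
  | 1 => g
  | n + 2 => fun k => (((k : ℂ) + 1) * (k + 2) * ampC f g (n + 1) (k + 2)
      + ∑ p ∈ (Finset.HasAntidiagonal.antidiagonal n).attach,
        ∑ q ∈ Finset.HasAntidiagonal.antidiagonal k, f p.1.1 q.1 * ampC f g p.1.2 q.2)
      / (((n : ℂ) + 1) * (n + 2 + 2 * k))
  termination_by n => n
  decreasing_by
  · omega
  · have := Finset.HasAntidiagonal.mem_antidiagonal.1 p.2
    omega

lemma amp_den (n k : ℕ) : ((n : ℂ) + 1) * (n + 2 + 2 * k) ≠ 0 := by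
  have : (((n + 1) * (n + 2 + 2 * k) : ℕ) : ℂ) ≠ 0 := Nat.cast_ne_zero.2 (by positivity)
  push_cast at this
  exact this

lemma ampC_0 (f : ℕ → ℕ → ℂ) (g : ℕ → ℂ) (k : ℕ) : ampC f g 0 k = if k = 0 then 1 else 0 := by
  rw [ampC]

lemma ampC_1 (f : ℕ → ℕ → ℂ) (g : ℕ → ℂ) (k : ℕ) : ampC f g 1 k = g k := by
  rw [ampC]

lemma ampC_2 (f : ℕ → ℕ → ℂ) (g : ℕ → ℂ) (n k : ℕ) :
    ((n : ℂ) + 1) * (n + 2 + 2 * k) * ampC f g (n + 2) k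
      = (k + 1) * (k + 2) * ampC f g (n + 1) (k + 2) + dpsC f (ampC f g) n k := by
  rw [ampC, mul_div_cancel₀ _ (amp_den n k)]
  congr 1
  exact Finset.sum_attach (Finset.HasAntidiagonal.antidiagonal n) (fun p =>
    ∑ q ∈ Finset.HasAntidiagonal.antidiagonal k, f p.1 q.1 * ampC f g p.2 q.2)

lemma amp_choose_mono {m n l' l : ℕ} (h : m ≤ n) (h' : l' ≤ l) :
    (m + l').choose m ≤ (n + l).choose n := by
  calc (m + l').choose m ≤ (m + l).choose m := Nat.choose_le_choose _ (by omega)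
    _ = (m + l).choose l := by rw [← Nat.choose_symm_add]
    _ ≤ (n + l).choose l := Nat.choose_le_choose _ (by omega)
    _ = _ := by rw [← Nat.choose_symm_add]

lemma amp_bound (b φ : ℕ → ℕ → ℝ) (T β : ℝ) (hb : ∀ n k, 0 ≤ b n k) (hφ : ∀ n k, 0 ≤ φ n k)
    (hT : ∀ n k, ∑ p ∈ Finset.HasAntidiagonal.antidiagonal n,
      ∑ q ∈ Finset.HasAntidiagonal.antidiagonal k, φ p.1 q.1 ≤ T)
    (h0 : ∀ k, b 0 k ≤ 1) (h1 : ∀ k, b 1 k ≤ β)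
    (hrec : ∀ n k : ℕ, ((n : ℝ) + 1) * (n + 2 + 2 * k) * b (n + 2) k ≤
      (k + 1) * (k + 2) * b (n + 1) (k + 2) +
      ∑ p ∈ Finset.HasAntidiagonal.antidiagonal n,
        ∑ q ∈ Finset.HasAntidiagonal.antidiagonal k, φ p.1 q.1 * b p.2 q.2) :
    ∃ M, ∀ n k, b n k ≤ M * ((n + (k + 1) / 2).choose n : ℝ) := by
  have hT0 : 0 ≤ T := le_trans (Finset.sum_nonneg fun p _ => Finset.sum_nonneg fun q _ => hφ _ _)
    (hT 0 0)
  have hβ : 0 ≤ β := (hb 1 0).trans (h1 0)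
  obtain ⟨D, hD⟩ := exists_nat_gt (2 * T)
  have hD0 : 0 < D := by
    have : (0 : ℝ) < D := by linarith
    exact_mod_cast this
  have hfin0 : 0 ≤ ∑ n ∈ Finset.range D, ∑ k ∈ Finset.range (2 * D), b n k :=
    Finset.sum_nonneg fun p _ => Finset.sum_nonneg fun q _ => hb _ _
  obtain ⟨M, hM⟩ : ∃ M, M = 1 + 2 * β + ∑ n ∈ Finset.range D, ∑ k ∈ Finset.range (2 * D), b n k :=
    ⟨_, rfl⟩
  have hM0 : 0 ≤ M := by linarith
  have hC1 : ∀ n l : ℕ, (1 : ℝ) ≤ ((n + l).choose n : ℝ) := fun n l => by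
    exact_mod_cast Nat.choose_pos (by omega)
  refine ⟨M, ?_⟩
  suffices H : ∀ d n k, n + (k + 1) / 2 = d → b n k ≤ M * ((n + (k + 1) / 2).choose n : ℝ) from
    fun n k => H _ n k rfl
  intro d
  induction d using Nat.strong_induction_on with
  | _ d ih =>
  intro n k hd
  have hle : M ≤ M * ((n + (k + 1) / 2).choose n : ℝ) := le_mul_of_one_le_right hM0 (hC1 _ _)
  by_cases hdD : d < D
  · refine le_trans ?_ hle
    have e1 : b n k ≤ ∑ k ∈ Finset.range (2 * D), b n k :=
      Finset.single_le_sum (f := fun k => b n k) (fun i _ => hb n i)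
        (Finset.mem_range.2 (by omega))
    have e2 : ∑ k ∈ Finset.range (2 * D), b n k ≤ ∑ n ∈ Finset.range D,
        ∑ k ∈ Finset.range (2 * D), b n k :=
      Finset.single_le_sum (f := fun n => ∑ k ∈ Finset.range (2 * D), b n k)
        (fun i _ => Finset.sum_nonneg fun q _ => hb _ _) (Finset.mem_range.2 (by omega))
    linarith
  push Not at hdD
  have hdT : 2 * T < d := hD.trans_le (by exact_mod_cast hdD)
  have hd0 : (0 : ℝ) < d := by linarith
  cases n with
  | zero => exact (h0 k).trans (by linarith)
  | succ n =>
  -- inner claim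
  have claim : ∀ n k, n + 1 + (k + 1) / 2 = d →
      b (n + 1) k * ((d - 1) * d) ≤ (β * ((d - 1) * d) + n * (T * M)) *
        ((n + (k + 1) / 2).choose n : ℝ) := by
    intro n
    induction n with
    | zero =>
      intro k hk
      have : (1 : ℝ) ≤ d := by exact_mod_cast (by omega : 1 ≤ d)
      have h2 : (0 : ℝ) ≤ (d - 1) * d := mul_nonneg (by linarith) hd0.le
      simpa using mul_le_mul_of_nonneg_right (h1 k) h2
    | succ n ihn =>
      intro k hk
      obtain ⟨l, hl⟩ : ∃ l, (k + 1) / 2 = l := ⟨_, rfl⟩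
      have hl2 : (k + 2 + 1) / 2 = l + 1 := by omega
      have i1 := ihn (k + 2) (by omega)
      rw [hl2] at i1
      rw [hl] at hk ⊢
      have i2 := hrec n k
      have i3 : ∑ p ∈ Finset.HasAntidiagonal.antidiagonal n,
          ∑ q ∈ Finset.HasAntidiagonal.antidiagonal k, φ p.1 q.1 * b p.2 q.2 ≤
          T * (M * ((n + l).choose n : ℝ)) := by
        refine le_trans ?_ (mul_le_mul_of_nonneg_right (hT n k) (by positivity))
        rw [Finset.sum_mul]
        refine Finset.sum_le_sum fun p hp => ?_
        rw [Finset.sum_mul]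
        refine Finset.sum_le_sum fun q hq => ?_
        have hp' := Finset.HasAntidiagonal.mem_antidiagonal.1 hp
        have hq' := Finset.HasAntidiagonal.mem_antidiagonal.1 hq
        refine mul_le_mul_of_nonneg_left ?_ (hφ _ _)
        refine (ih (p.2 + (q.2 + 1) / 2) (by omega) p.2 q.2 rfl).trans ?_
        refine mul_le_mul_of_nonneg_left ?_ hM0
        exact_mod_cast amp_choose_mono (by omega) (by omega)
      have c1 : ((n + 1 + l).choose (n + 1) : ℝ) * (n + 1) = ((n + (l + 1)).choose n : ℝ) * (l + 1) := by
        have := Nat.choose_succ_right_eq (n + 1 + l) n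
        rw [show n + 1 + l - n = l + 1 by omega] at this
        rw [show n + (l + 1) = n + 1 + l by omega]
        exact_mod_cast this
      have c2 : ((n : ℝ) + 1 + l) * ((n + l).choose n : ℝ) = ((n + 1 + l).choose (n + 1) : ℝ) * (n + 1) := by
        have := Nat.add_one_mul_choose_eq (n + l) n
        rw [show n + l + 1 = n + 1 + l by omega] at this
        exact_mod_cast this
      have hdl : (d : ℝ) = n + 2 + l := by rw [← hk]; push_cast; ring
      have hkl : (k : ℝ) ≤ 2 * l := by exact_mod_cast (by omega : k ≤ 2 * l)
      have hlk : (l : ℝ) ≤ 2 * k := by exact_mod_cast (by omega : l ≤ 2 * k)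
      have hk0 : (0 : ℝ) ≤ k := by positivity
      have hn0 : (0 : ℝ) ≤ n := by positivity
      have hl0 : (0 : ℝ) ≤ l := by positivity
      have hCa := hC1 n (l + 1)
      have hCb := hC1 n l
      have hCc := hC1 (n + 1) l
      push_cast at *
      generalize ((n + (l + 1)).choose n : ℝ) = Ca at *
      generalize ((n + l).choose n : ℝ) = Cb at *
      generalize ((n + 1 + l).choose (n + 1) : ℝ) = Cc at *
      have hE : (0 : ℝ) ≤ (d - 1) * d := by rw [hdl]; apply mul_nonneg <;> linarith
      have hpos : (0 : ℝ) < (n + 1) * (n + 2 + 2 * k) := by positivity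
      refine le_of_mul_le_mul_left ?_ hpos
      have hTM : 0 ≤ T * M := by positivity
      have hX : 0 ≤ β * ((d - 1) * d) + n * (T * M) := by positivity
      have s1 : ((k : ℝ) + 1) * (k + 2) ≤ (n + 2 + 2 * k) * (l + 1) := by nlinarith
      calc ((n : ℝ) + 1) * (n + 2 + 2 * k) * (b (n + 1 + 1) k * ((d - 1) * d))
          = ((n : ℝ) + 1) * (n + 2 + 2 * k) * b (n + 2) k * ((d - 1) * d) := by ring_nf
        _ ≤ ((k + 1) * (k + 2) * b (n + 1) (k + 2) + T * (M * Cb)) * ((d - 1) * d) :=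
            mul_le_mul_of_nonneg_right (by linarith) hE
        _ = (k + 1) * (k + 2) * (b (n + 1) (k + 2) * ((d - 1) * d)) + T * M * Cb * ((d - 1) * d) := by
            ring
        _ ≤ (k + 1) * (k + 2) * ((β * ((d - 1) * d) + n * (T * M)) * Ca)
            + T * M * Cb * ((d - 1) * d) := by gcongr
        _ ≤ (n + 2 + 2 * k) * (l + 1) * ((β * ((d - 1) * d) + n * (T * M)) * Ca)
            + T * M * Cb * ((d - 1) * d) := by gcongr
        _ = (n + 2 + 2 * k) * (β * ((d - 1) * d) + n * (T * M)) * (Cc * (n + 1))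
            + T * M * d * (Cc * (n + 1)) := by
            rw [← c2, show ((n : ℝ) + 1 + l) * Cb = Ca * (l + 1) by rw [c2, c1], hdl,
              show T * M * (n + 2 + l) * (Ca * (l + 1)) = T * M * (n + 2 + l) * ((n + 1 + l) * Cb) by
                rw [c2, c1]]
            ring
        _ ≤ (n + 2 + 2 * k) * (β * ((d - 1) * d) + n * (T * M)) * (Cc * (n + 1))
            + T * M * (n + 2 + 2 * k) * (Cc * (n + 1)) := by
            gcongr
            rw [hdl]; linarith
        _ = _ := by push_cast; ring
  have c := claim n k hd
  by_cases hd1 : d = 1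
  · have hn : n = 0 := by omega
    subst hn
    exact (h1 k).trans (by linarith)
  have hd2 : (2 : ℝ) ≤ d := by exact_mod_cast (by omega : 2 ≤ d)
  have hnd : (n : ℝ) ≤ d - 1 := by
    rw [le_sub_iff_add_le]; exact_mod_cast (by omega : n + 1 ≤ d)
  have hE : (0 : ℝ) < (d - 1) * d := by apply mul_pos <;> linarith
  have hCC : ((n + (k + 1) / 2).choose n : ℝ) ≤ ((n + 1 + (k + 1) / 2).choose (n + 1) : ℝ) := by
    exact_mod_cast amp_choose_mono (by omega) le_rfl
  refine le_of_mul_le_mul_right (c.trans ?_) hE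
  calc _ ≤ (β * ((d - 1) * d) + (d - 1) * (d / 2 * M)) * ((n + (k + 1) / 2).choose n : ℝ) := by
        gcongr
        · linarith
        · linarith
    _ = (β + M / 2) * ((d - 1) * d) * ((n + (k + 1) / 2).choose n : ℝ) := by ring
    _ ≤ M * ((d - 1) * d) * ((n + 1 + (k + 1) / 2).choose (n + 1) : ℝ) := by
        gcongr
        linarith
    _ = _ := by ring

lemma amp_S {f : ℕ → ℕ → ℂ} {g : ℕ → ℂ} {R s r B : ℝ} (hf : dpsS f R) (hs : 0 < s) (hs1 : s < R)
    (hs2 : s ^ 2 < R) (hg : ∀ k, ‖g k‖ * s ^ k ≤ B) (hr1 : 2 * r ≤ s) (hr2 : 2 * r ≤ s ^ 2) :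
    dpsS (ampC f g) r := by
  have hm0 : 0 ≤ max s (s ^ 2) := hs.le.trans (le_max_left _ _)
  have hsum := hf.summable hm0 (max_lt hs1 hs2)
  set T := ∑' p : ℕ × ℕ, s ^ 4 * (‖f p.1 p.2‖ * max s (s ^ 2) ^ (p.1 + p.2)) with hT
  have hsum2 := hsum.mul_left (s ^ 4)
  have key : ∃ M, ∀ n k, ‖ampC f g n k‖ * s ^ (2 * n + k) ≤ M * ((n + (k + 1) / 2).choose n : ℝ) := by
    refine amp_bound (fun n k => ‖ampC f g n k‖ * s ^ (2 * n + k))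
      (fun n k => s ^ 4 * (‖f n k‖ * s ^ (2 * n + k))) T (s ^ 2 * B)
      (fun n k => by positivity) (fun n k => by positivity) (fun n k => ?_) (fun k => ?_)
      (fun k => ?_) (fun n k => ?_)
    · rw [Finset.Nat.sum_antidiagonal_eq_sum_range_succ
        (fun i _ => ∑ q ∈ Finset.HasAntidiagonal.antidiagonal k,
          s ^ 4 * (‖f i q.1‖ * s ^ (2 * i + q.1)))]
      have e : ∀ i ∈ Finset.range n.succ, ∑ q ∈ Finset.HasAntidiagonal.antidiagonal k,
          s ^ 4 * (‖f i q.1‖ * s ^ (2 * i + q.1)) = ∑ j ∈ Finset.range k.succ,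
          s ^ 4 * (‖f i j‖ * s ^ (2 * i + j)) := fun i _ => by
        rw [Finset.Nat.sum_antidiagonal_eq_sum_range_succ
          (fun j _ => s ^ 4 * (‖f i j‖ * s ^ (2 * i + j)))]
      rw [Finset.sum_congr rfl e, ← Finset.sum_product']
      refine le_trans (Finset.sum_le_sum fun p _ => ?_)
        (hsum2.sum_le_tsum (Finset.range n.succ ×ˢ Finset.range k.succ) (fun p _ => by positivity))
      gcongr
      rw [pow_add, pow_add, pow_mul]
      gcongr
      · exact le_max_right _ _
      · exact le_max_left _ _
    · simp only [ampC_0]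
      split_ifs with h
      · simp [h]
      · simp
    · simp only [ampC_1]
      calc ‖g k‖ * s ^ (2 * 1 + k) = s ^ 2 * (‖g k‖ * s ^ k) := by ring
        _ ≤ _ := by gcongr; exact hg k
    · have h1 := congrArg norm (ampC_2 f g n k)
      have e1 : ‖((n : ℂ) + 1) * (n + 2 + 2 * k) * ampC f g (n + 2) k‖ =
          ((n : ℝ) + 1) * (n + 2 + 2 * k) * ‖ampC f g (n + 2) k‖ := by
        rw [norm_mul]
        congr 1
        have := Complex.norm_natCast ((n + 1) * (n + 2 + 2 * k))
        push_cast at this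
        exact this
      have e2 : ‖((k : ℂ) + 1) * (k + 2) * ampC f g (n + 1) (k + 2)‖ =
          ((k : ℝ) + 1) * (k + 2) * ‖ampC f g (n + 1) (k + 2)‖ := by
        rw [norm_mul]
        congr 1
        have := Complex.norm_natCast ((k + 1) * (k + 2))
        push_cast at this
        exact this
      have h2 := norm_add_le (((k : ℂ) + 1) * (k + 2) * ampC f g (n + 1) (k + 2))
        (dpsC f (ampC f g) n k)
      rw [← h1, e1, e2] at h2
      have h3 : ‖dpsC f (ampC f g) n k‖ ≤ ∑ p ∈ Finset.HasAntidiagonal.antidiagonal n,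
          ∑ q ∈ Finset.HasAntidiagonal.antidiagonal k, ‖f p.1 q.1‖ * ‖ampC f g p.2 q.2‖ := by
        refine (norm_sum_le _ _).trans (Finset.sum_le_sum fun p _ => ?_)
        refine (norm_sum_le _ _).trans (Finset.sum_le_sum fun q _ => ?_)
        rw [norm_mul]
      have h4 : ∑ p ∈ Finset.HasAntidiagonal.antidiagonal n,
          ∑ q ∈ Finset.HasAntidiagonal.antidiagonal k, s ^ 4 * (‖f p.1 q.1‖ * s ^ (2 * p.1 + q.1)) *
            (‖ampC f g p.2 q.2‖ * s ^ (2 * p.2 + q.2)) =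
          (∑ p ∈ Finset.HasAntidiagonal.antidiagonal n,
          ∑ q ∈ Finset.HasAntidiagonal.antidiagonal k, ‖f p.1 q.1‖ * ‖ampC f g p.2 q.2‖) *
            s ^ (2 * (n + 2) + k) := by
        simp only [Finset.sum_mul]
        refine Finset.sum_congr rfl fun i hi => Finset.sum_congr rfl fun j hj => ?_
        simp only [Finset.HasAntidiagonal.mem_antidiagonal] at hi hj
        simp only [← hi, ← hj]
        ring
      have h5 := mul_le_mul_of_nonneg_right (h2.trans (add_le_add_right h3 _))
        (by positivity : 0 ≤ s ^ (2 * (n + 2) + k))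
      rw [h4]
      have e3 : s ^ (2 * (n + 1) + (k + 2)) = s ^ (2 * (n + 2) + k) := by congr 1; omega
      simp only [e3]
      linarith
  obtain ⟨M, hM⟩ := key
  intro u hu hur
  refine ⟨M, fun n k => ?_⟩
  have hM0 : 0 ≤ M := by
    have := hM 0 0
    simp at this
    exact le_trans (by positivity) this
  have h1 : ((n + (k + 1) / 2).choose n : ℝ) ≤ 2 ^ (n + k) := by
    have h2 : (n + (k + 1) / 2).choose n ≤ 2 ^ (n + (k + 1) / 2) := Nat.choose_le_two_pow _ _
    have h3 : 2 ^ (n + (k + 1) / 2) ≤ 2 ^ (n + k) := Nat.pow_le_pow_right (by norm_num) (by omega)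
    exact_mod_cast h2.trans h3
  have h4 : (2 * u) ^ (n + k) ≤ s ^ (2 * n + k) := by
    rw [pow_add, pow_add, pow_mul]
    gcongr <;> linarith
  have h5 : ‖ampC f g n k‖ * (2 * u) ^ (n + k) ≤ M * 2 ^ (n + k) :=
    (mul_le_mul_of_nonneg_left h4 (norm_nonneg _)).trans ((hM n k).trans (by gcongr))
  rw [mul_pow] at h5
  have h6 : (0 : ℝ) < 2 ^ (n + k) := by positivity
  refine le_of_mul_le_mul_right ?_ h6
  linarith

lemma dpsV_row {a b : ℕ → ℕ → ℂ} (h : ∀ k, a 0 k = b 0 k) (x : ℂ) : dpsV a 0 x = dpsV b 0 x := by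
  unfold dpsV
  refine tsum_congr fun p => ?_
  rcases p with ⟨n, k⟩
  cases n with
  | zero => simp [h]
  | succ n => simp

lemma dpsV_row_const {a : ℕ → ℕ → ℂ} (h : ∀ k, a 0 (k + 1) = 0) (x : ℂ) :
    dpsV a 0 x = a 0 0 := by
  unfold dpsV
  rw [tsum_eq_single (0, 0)]
  · simp
  · rintro ⟨n, k⟩ hnk
    rcases n with _ | n
    · rcases k with _ | k
      · exact absurd rfl hnk
      · simp [h]
    · simp

lemma dps_row {a b : ℕ → ℕ → ℂ} {r : ℝ} (hr : 0 < r) (ha : dpsS a r) (hb : dpsS b r)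
    (h : ∀ x, ‖x‖ < r → dpsV a 0 x = dpsV b 0 x) (k : ℕ) : a 0 k = b 0 k := by
  have hab := ha.add (hb.smul (-1))
  set c : ℕ → ℕ → ℂ := fun n k => if n = 0 then (a + (-1 : ℂ) • b) n k else 0 with hc
  have hcS : dpsS c r := by
    intro s h0 h1
    obtain ⟨M, hM⟩ := hab s h0 h1
    refine ⟨M, fun n k => le_trans ?_ (hM n k)⟩
    gcongr
    simp only [hc]
    split_ifs
    · exact le_rfl
    · simp
  have := dps_coeff_zero 0 k hr hcS (by
    filter_upwards [dps_nhds hr] with p hp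
    have e1 : dpsV c p.1 p.2 = dpsV c 0 p.2 := by
      unfold dpsV
      refine tsum_congr fun q => ?_
      rcases q with ⟨n, k⟩
      cases n <;> simp [hc]
    have e2 : dpsV c 0 p.2 = dpsV (a + (-1 : ℂ) • b) 0 p.2 := dpsV_row (fun k => by simp [hc]) _
    rw [e1, e2, dpsV_add ha (hb.smul (-1)) (by simpa using hr) hp.2, dpsV_smul, h _ hp.2]
    ring)
  simp [hc] at this
  linear_combination this

lemma amp_unique {f a : ℕ → ℕ → ℂ} {g : ℕ → ℂ} (h0 : ∀ k, a 0 k = if k = 0 then 1 else 0)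
    (h1 : ∀ k, a 1 k = g k)
    (h2 : ∀ n k, dpsE f a (n + 2) k = 0) : a = ampC f g := by
  have H : ∀ n k, a n k = ampC f g n k := by
    intro n
    induction n using Nat.strong_induction_on with
    | _ n ih =>
    intro k
    match n, ih with
    | 0, _ => rw [h0, ampC_0]
    | 1, _ => rw [h1, ampC_1]
    | n + 2, ih =>
      have e := h2 n k
      rw [dpsE_2] at e
      have e2 := ampC_2 f g n k
      have e3 : dpsC f a n k = dpsC f (ampC f g) n k := by
        refine Finset.sum_congr rfl fun p hp => Finset.sum_congr rfl fun q _ => ?_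
        have := Finset.HasAntidiagonal.mem_antidiagonal.1 hp
        rw [ih p.2 (by omega)]
      rw [ih (n + 1) (by omega), e3] at e
      refine mul_left_cancel₀ (amp_den n k) ?_
      linear_combination e - e2
  funext n k
  exact H n k

lemma amp_E (f : ℕ → ℕ → ℂ) (g : ℕ → ℂ) : dpsE f (ampC f g) = 0 := by
  funext n k
  match n with
  | 0 =>
    rw [dpsE_0, ampC_0]
    by_cases h : k = 0 <;> simp [h]
  | 1 => rw [dpsE_1, ampC_0]; simp
  | n + 2 => rw [dpsE_2, ampC_2]; simp

lemma F_expand {F : ℂ → ℂ} {r R : ℝ} (hr : 0 < r) (hrR : r < R)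
    (hF : DifferentiableOn ℂ F (ball 0 (R + R ^ 2))) :
    ∃ f, dpsS f r ∧ ∀ t x, ‖t‖ < r → ‖x‖ < r → F (t + x ^ 2) = dpsV f t x := by
  refine dps_expand (G := fun t x => F (t + x ^ 2)) hr hrR ?_
  refine DifferentiableOn.comp (g := F) (f := fun p : ℂ × ℂ => p.1 + p.2 ^ 2) hF
    (by fun_prop) ?_
  rintro ⟨t, x⟩ ⟨ht, hx⟩
  simp only [mem_ball_zero_iff] at ht hx ⊢
  refine (norm_add_le _ _).trans_lt (add_lt_add ht ?_)
  rw [norm_pow]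
  gcongr

lemma h_expand {h : ℂ → ℂ} {r R : ℝ} (hr : 0 < r) (hrR : r < R)
    (hF : DifferentiableOn ℂ h (ball 0 (R + R ^ 2))) :
    ∃ f, dpsS f r ∧ ∀ t x, ‖t‖ < r → ‖x‖ < r → h (x ^ 2) = dpsV f t x := by
  refine dps_expand (G := fun t x => h (x ^ 2)) hr hrR ?_
  refine DifferentiableOn.comp (g := h) (f := fun p : ℂ × ℂ => p.2 ^ 2) hF
    (by fun_prop) ?_
  rintro ⟨t, x⟩ ⟨ht, hx⟩
  simp only [mem_ball_zero_iff] at ht hx ⊢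
  rw [norm_pow]
  have : ‖x‖ ^ 2 < R ^ 2 := by gcongr
  linarith

lemma an_ball {F : ℂ → ℂ} (hF : AnalyticAt ℂ F 0) :
    ∃ ρ, 0 < ρ ∧ DifferentiableOn ℂ F (ball 0 ρ) := by
  obtain ⟨ρ, h0, h1⟩ := Metric.eventually_nhds_iff_ball.1 hF.eventually_analyticAt
  exact ⟨ρ, h0, fun y hy => (h1 y hy).differentiableAt.differentiableWithinAt⟩

lemma dps_nrm {z x : ℂ} {r : ℝ} (hr : r ≤ 1) (hz : ‖z‖ < r / 2) (hx : ‖x‖ < r / 2) :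
    ‖z - x ^ 2‖ < r ∧ ‖x‖ < r ∧ ‖z + x ^ 2‖ < r := by
  have h0 := norm_nonneg x
  have h1 : ‖x ^ 2‖ < r / 2 := by
    rw [norm_pow]; nlinarith
  refine ⟨(norm_sub_le _ _).trans_lt (by linarith), by linarith,
    (norm_add_le _ _).trans_lt (by linarith)⟩

lemma amp_uniq_main {F h : ℂ → ℂ} {f g : ℕ → ℕ → ℂ} {R : ℝ} (hR : 0 < R) (hf : dpsS f R)
    (hg : dpsS g R)
    (hfV : ∀ t x, ‖t‖ < R → ‖x‖ < R → F (t + x ^ 2) = dpsV f t x)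
    (hgV : ∀ t x, ‖t‖ < R → ‖x‖ < R → h (x ^ 2) = dpsV g t x)
    (r' : ℝ) (Ψ' : ℂ → ℂ → ℂ) (hr' : 0 < r')
    (hd : DifferentiableOn ℂ (fun p : ℂ × ℂ => Ψ' p.1 p.2) (ball 0 r' ×ˢ ball 0 r'))
    (h1 : ∀ zh ∈ ball (0 : ℂ) r', Ψ' (zh^2) zh = 1)
    (h2 : ∀ zh ∈ ball (0 : ℂ) r', zh ≠ 0 → -(1/(2*zh)) * deriv (Ψ' (zh^2)) zh = h (zh^2))
    (h3 : ∀ z ∈ ball (0 : ℂ) r', ∀ zh ∈ ball (0 : ℂ) r', z ≠ zh^2 →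
          pdeLHS (fun a b => Ψ' a b / (a - b^2)) z zh = F z * (Ψ' z zh / (z - zh^2))) :
    ∃ r'' : ℝ, 0 < r'' ∧ ∀ z ∈ ball (0 : ℂ) r'', ∀ zh ∈ ball (0 : ℂ) r'',
      dpsV (ampC f (g 0)) (z - zh ^ 2) zh = Ψ' z zh := by
  obtain ⟨δ, hδ⟩ : ∃ δ, δ = min (min r' 1) R := ⟨_, rfl⟩
  have hδ0 : 0 < δ := by rw [hδ]; positivity
  have hδr : δ ≤ r' := hδ ▸ (min_le_left _ _).trans (min_le_left _ _)
  have hδ1 : δ ≤ 1 := hδ ▸ (min_le_left _ _).trans (min_le_right _ _)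
  have hδR : δ ≤ R := hδ ▸ min_le_right _ _
  obtain ⟨a, ha, haV⟩ := dps_expand (G := fun t x => Ψ' (t + x ^ 2) x) (r := δ / 4) (R := δ / 2)
    (by linarith) (by linarith) (by
      refine DifferentiableOn.comp (g := fun p : ℂ × ℂ => Ψ' p.1 p.2)
        (f := fun p : ℂ × ℂ => (p.1 + p.2 ^ 2, p.2)) hd (by fun_prop) ?_
      rintro ⟨t, x⟩ ⟨ht, hx⟩
      simp only [mem_ball_zero_iff, Set.mem_prod] at ht hx ⊢
      have := dps_nrm hδ1 ht hx
      constructor <;> linarith [this.2.1, this.2.2])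
  set r := δ / 4 with hr
  have hr0 : 0 < r := by linarith
  have hf' := hf.mono (by linarith : r ≤ R)
  have hg' := hg.mono (by linarith : r ≤ R)
  have hz0 : ‖(0 : ℂ)‖ < r := by simpa using hr0
  have haV' : ∀ z x, ‖z - x ^ 2‖ < r → ‖x‖ < r → Ψ' z x = dpsV a (z - x ^ 2) x := by
    intro z x h4 h5
    have := haV (z - x ^ 2) x h4 h5
    simpa using this
  have hmem : ∀ t x : ℂ, ‖t‖ < r → ‖x‖ < r → t + x ^ 2 ∈ ball (0 : ℂ) r' := by
    intro t x ht hx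
    rw [mem_ball_zero_iff]
    have := (dps_nrm hδ1 (by linarith : ‖t‖ < δ / 2) (by linarith : ‖x‖ < δ / 2)).2.2
    linarith
  have hmem2 : ∀ x : ℂ, ‖x‖ < r → x ∈ ball (0 : ℂ) r' := by
    intro x hx; rw [mem_ball_zero_iff]; linarith
  have hev : ∀ z x, ‖z - x ^ 2‖ < r → ‖x‖ < r →
      ∀ᶠ p : ℂ × ℂ in nhds (z, x), Ψ' p.1 p.2 = dpsV a (p.1 - p.2 ^ 2) p.2 := by
    intro z x h4 h5
    filter_upwards [(Continuous.continuousAt (f := fun p : ℂ × ℂ => ‖p.1 - p.2 ^ 2‖)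
        (by fun_prop)).eventually_lt continuousAt_const h4,
      (Continuous.continuousAt (f := fun p : ℂ × ℂ => ‖p.2‖)
        (by fun_prop)).eventually_lt continuousAt_const h5] with p hp1 hp2
    exact haV' _ _ hp1 hp2
  have hE : ∀ t x, ‖t‖ < r → ‖x‖ < r → t ≠ 0 → dpsV (dpsE f a) t x = 0 := by
    intro t x ht hx ht0
    have e := dpsE_V hf' ha ht hx
    have hts : t + x ^ 2 - x ^ 2 = t := by ring
    have hne : t + x ^ 2 ≠ x ^ 2 := by simpa using ht0
    have p := pde_formula (z := t + x ^ 2) (x := x) ha (hev _ _ (by rwa [hts]) hx) (by rwa [hts])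
      hx hne
    rw [h3 _ (hmem t x ht hx) _ (hmem2 x hx) hne, hts, haV' _ _ (by rwa [hts]) hx, hts,
      hfV t x (by linarith) (by linarith)] at p
    rw [e]
    have : dpsV f t x * (dpsV a t x / t) * t ^ 3 = t ^ 2 * (dpsV f t x * dpsV a t x) := by
      field_simp
    linear_combination this - p
  have hE0 : ∀ n k, dpsE f a n k = 0 := by
    intro n k
    refine dps_coeff_zero (n + 1) k hr0 (dpsE_S hf' ha).X1 ?_
    filter_upwards [dps_nhds hr0] with p hp
    rw [dpsV_X1]
    by_cases h0 : p.1 = 0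
    · rw [h0, zero_mul]
    · rw [hE _ _ hp.1 hp.2 h0, mul_zero]
  have ha0 : ∀ k, a 0 (k + 1) = 0 := by
    intro k
    have := hE0 0 (k + 1)
    rw [dpsE_0] at this
    have hk : ((k : ℂ) + 1) ≠ 0 := by exact_mod_cast Nat.succ_ne_zero k
    push_cast at this
    simpa [hk] using this
  have ha00 : a 0 0 = 1 := by
    have e := h1 0 (by simpa using hr')
    rw [haV' _ _ (by simpa using hr0) hz0] at e
    simpa [dpsV_zero] using e
  have ha1 : ∀ k, a 1 k = g 0 k := by
    intro k
    have := dps_row hr0 ha.D1.X2 hg'.X2 (fun x hx => by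
      rw [dpsV_X2, dpsV_X2]
      by_cases hx0 : x = 0
      · simp [hx0]
      have d := dpsV_dx (z := x ^ 2) ha (by simpa using hr0) hx
      have ev : Ψ' (x ^ 2) =ᶠ[nhds x] fun y => dpsV a (x ^ 2 - y ^ 2) y := by
        have := (Continuous.tendsto (f := fun v : ℂ => (x ^ 2, v)) (by fun_prop) x).eventually
          (hev (x ^ 2) x (by simpa using hr0) hx)
        exact this
      have e := h2 x (hmem2 x hx) hx0
      rw [ev.deriv_eq, d.deriv, hgV 0 x (by simpa using hR) (by linarith), sub_self,
        dpsV_row_const (a := dpsD2 a) (fun k => by simp [dpsD2, ha0])] at e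
      have : dpsD2 a 0 0 = 0 := by simp [dpsD2, ha0]
      rw [this] at e
      rw [← e]
      field_simp
      ring) (k + 1)
    simpa [dpsX2, dpsD1] using this
  have hau : a = ampC f (g 0) := by
    refine amp_unique (fun k => ?_) ha1 (fun n k => hE0 _ _)
    cases k with
    | zero => simpa using ha00
    | succ k => simpa using ha0 k
  refine ⟨r / 2, by linarith, fun z hz x hx => ?_⟩
  rw [mem_ball_zero_iff] at hz hx
  have := dps_nrm (by linarith : r ≤ 1) hz hx
  rw [haV' z x this.1 this.2.1, hau]

/-- Existence and germ-uniqueness of the amplitude `Ψ(z,ẑ)`, holomorphic near `(0,0)`,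
with `Ψ(ẑ²,ẑ) = 1`, `−(1/(2ẑ)) Ψ_ẑ(ẑ²,ẑ) = h(ẑ²)`, such that `Ψ̃ = Ψ/(z−ẑ²)` solves the
linear PDE away from `z = ẑ²`; if `F` and `h` are entire, `Ψ` extends to an entire
function on `ℂ²`. -/
theorem amplitude_existence_uniqueness (F h : ℂ → ℂ)
    (hF : AnalyticAt ℂ F 0) (hh : AnalyticAt ℂ h 0) :
    ∃ (r : ℝ) (Ψ : ℂ → ℂ → ℂ), 0 < r ∧ r ≤ 1 ∧
      DifferentiableOn ℂ (fun p : ℂ × ℂ => Ψ p.1 p.2)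
        (Metric.ball 0 r ×ˢ Metric.ball 0 r) ∧
      (∀ zh ∈ Metric.ball (0 : ℂ) r, Ψ (zh^2) zh = 1) ∧
      (∀ zh ∈ Metric.ball (0 : ℂ) r, zh ≠ 0 →
        -(1/(2*zh)) * deriv (Ψ (zh^2)) zh = h (zh^2)) ∧
      (∀ z ∈ Metric.ball (0 : ℂ) r, ∀ zh ∈ Metric.ball (0 : ℂ) r, z ≠ zh^2 →
        pdeLHS (fun a b => Ψ a b / (a - b^2)) z zh = F z * (Ψ z zh / (z - zh^2))) ∧
      (∀ (r' : ℝ) (Ψ' : ℂ → ℂ → ℂ), 0 < r' →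
        DifferentiableOn ℂ (fun p : ℂ × ℂ => Ψ' p.1 p.2)
          (Metric.ball 0 r' ×ˢ Metric.ball 0 r') →
        (∀ zh ∈ Metric.ball (0 : ℂ) r', Ψ' (zh^2) zh = 1) →
        (∀ zh ∈ Metric.ball (0 : ℂ) r', zh ≠ 0 →
          -(1/(2*zh)) * deriv (Ψ' (zh^2)) zh = h (zh^2)) →
        (∀ z ∈ Metric.ball (0 : ℂ) r', ∀ zh ∈ Metric.ball (0 : ℂ) r', z ≠ zh^2 →
          pdeLHS (fun a b => Ψ' a b / (a - b^2)) z zh = F z * (Ψ' z zh / (z - zh^2))) →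
        ∃ r'' : ℝ, 0 < r'' ∧
          ∀ z ∈ Metric.ball (0 : ℂ) r'', ∀ zh ∈ Metric.ball (0 : ℂ) r'', Ψ z zh = Ψ' z zh) ∧
      (Differentiable ℂ F → Differentiable ℂ h →
        ∃ Ψe : ℂ → ℂ → ℂ, Differentiable ℂ (fun p : ℂ × ℂ => Ψe p.1 p.2) ∧
          ∀ z ∈ Metric.ball (0 : ℂ) r, ∀ zh ∈ Metric.ball (0 : ℂ) r, Ψe z zh = Ψ z zh) := by
  obtain ⟨ρ1, hρ1, hF1⟩ := an_ball hF
  obtain ⟨ρ2, hρ2, hh1⟩ := an_ball hh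
  obtain ⟨ρ, hρ⟩ : ∃ ρ, ρ = min (min ρ1 ρ2) 1 / 2 := ⟨_, rfl⟩
  have hm0 : 0 < min (min ρ1 ρ2) 1 := by positivity
  have hρ0 : 0 < ρ := by linarith
  have hρ1' : ρ ≤ 1 / 2 := by linarith [min_le_right (min ρ1 ρ2) 1]
  have hρle : ρ + ρ ^ 2 ≤ min ρ1 ρ2 := by
    have := min_le_left (min ρ1 ρ2) 1
    nlinarith
  obtain ⟨R, hR⟩ : ∃ R, R = ρ / 2 := ⟨_, rfl⟩
  have hR0 : 0 < R := by linarith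
  obtain ⟨f, hf, hfV⟩ := F_expand (r := R) (R := ρ) hR0 (by linarith)
    (hF1.mono (ball_subset_ball (hρle.trans (min_le_left _ _))))
  obtain ⟨g, hg, hgV⟩ := h_expand (r := R) (R := ρ) hR0 (by linarith)
    (hh1.mono (ball_subset_ball (hρle.trans (min_le_right _ _))))
  obtain ⟨s, hs⟩ : ∃ s, s = R / 2 := ⟨_, rfl⟩
  have hs0 : 0 < s := by linarith
  have hss : s ^ 2 ≤ s := by nlinarith
  obtain ⟨B, hB⟩ := hg s hs0 (by linarith)
  obtain ⟨r1, hr1⟩ : ∃ r1, r1 = s ^ 2 / 2 := ⟨_, rfl⟩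
  have hr10 : 0 < r1 := by rw [hr1]; positivity
  have hr1R : r1 < R := by linarith
  have ha : dpsS (ampC f (g 0)) r1 := amp_S hf hs0 (by linarith) (by linarith)
    (fun k => by simpa using hB 0 k) (by linarith) (by linarith)
  have hr11 : r1 ≤ 1 := by linarith
  have hz0 : ‖(0 : ℂ)‖ < r1 := by simpa using hr10
  have hdiff : ∀ {r : ℝ} {z x : ℂ}, dpsS (ampC f (g 0)) r → ‖z - x ^ 2‖ < r → ‖x‖ < r →
      DifferentiableAt ℂ (fun p : ℂ × ℂ => dpsV (ampC f (g 0)) (p.1 - p.2 ^ 2) p.2) (z, x) := by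
    intro r z x hS h1 h2
    exact DifferentiableAt.comp (g := fun p : ℂ × ℂ => dpsV (ampC f (g 0)) p.1 p.2)
      (f := fun p : ℂ × ℂ => (p.1 - p.2 ^ 2, p.2)) (z, x)
      (dpsV_hasFDerivAt hS h1 h2).differentiableAt (by fun_prop)
  have ha0 : ∀ k, ampC f (g 0) 0 (k + 1) = 0 := fun k => by simp [ampC_0]
  refine ⟨r1 / 2, fun z x => dpsV (ampC f (g 0)) (z - x ^ 2) x, by linarith, by linarith,
    ?_, ?_, ?_, ?_, ?_, ?_⟩
  · rintro ⟨z, x⟩ ⟨hz, hx⟩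
    simp only [mem_ball_zero_iff] at hz hx
    have := dps_nrm hr11 hz hx
    exact (hdiff ha this.1 this.2.1).differentiableWithinAt
  · intro x _
    simp only [sub_self]
    rw [dpsV_row_const ha0, ampC_0]
    simp
  · intro x hx hx0
    rw [mem_ball_zero_iff] at hx
    have hx' : ‖x‖ < r1 := by linarith
    have d := dpsV_dx (z := x ^ 2) ha (by simpa using hr10) hx'
    rw [d.deriv, sub_self, dpsV_row_const (a := dpsD2 (ampC f (g 0)))
      (fun k => by simp [dpsD2, ha0]), hgV 0 x (by simpa using hR0) (by linarith),
      dpsV_row (a := dpsD1 (ampC f (g 0))) (b := g) (fun k => by simp [dpsD1, ampC_1])]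
    have : dpsD2 (ampC f (g 0)) 0 0 = 0 := by simp [dpsD2, ha0]
    rw [this]
    field_simp
    ring
  · intro z hz x hx hne
    rw [mem_ball_zero_iff] at hz hx
    obtain ⟨n1, n2, -⟩ := dps_nrm hr11 hz hx
    have p := pde_formula (Ψ := fun z x => dpsV (ampC f (g 0)) (z - x ^ 2) x) ha
      (Filter.Eventually.of_forall fun _ => rfl) n1 n2 hne
    have e := dpsE_V (hf.mono hr1R.le) ha n1 n2
    have e0 : dpsV (dpsE f (ampC f (g 0))) (z - x ^ 2) x = 0 := by
      rw [amp_E]; simp [dpsV]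
    have hD : z - x ^ 2 ≠ 0 := sub_ne_zero.2 hne
    have hFz := hfV (z - x ^ 2) x (by linarith) (by linarith)
    rw [sub_add_cancel] at hFz
    refine mul_right_cancel₀ (pow_ne_zero 3 hD) ?_
    rw [p, hFz]
    have e3 : dpsV f (z - x ^ 2) x * (dpsV (ampC f (g 0)) (z - x ^ 2) x / (z - x ^ 2))
        * (z - x ^ 2) ^ 3 = (z - x ^ 2) ^ 2 *
        (dpsV f (z - x ^ 2) x * dpsV (ampC f (g 0)) (z - x ^ 2) x) := by
      field_simp
    rw [e3]
    linear_combination e0 - e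
  · intro r' Ψ' hr' hd h1 h2 h3
    exact amp_uniq_main hR0 hf hg hfV hgV r' Ψ' hr' hd h1 h2 h3
  · intro hFe hhe
    have hfS : ∀ r, dpsS f r := by
      intro r
      have hmx : 0 < max r R := hR0.trans_le (le_max_right _ _)
      obtain ⟨f', hf', hfV'⟩ := F_expand (F := F) (r := max r R) (R := max r R + 1) hmx (by linarith)
        hFe.differentiableOn
      have : f = f' := dps_unique hR0 hf (hf'.mono (le_max_right _ _)) (by
        filter_upwards [dps_nhds hR0] with p hp
        rw [← hfV _ _ hp.1 hp.2, ← hfV' _ _ (hp.1.trans_le (le_max_right _ _))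
          (hp.2.trans_le (le_max_right _ _))])
      rw [this]
      exact hf'.mono (le_max_left _ _)
    have hgS : ∀ r, dpsS g r := by
      intro r
      have hmx : 0 < max r R := hR0.trans_le (le_max_right _ _)
      obtain ⟨f', hf', hfV'⟩ := h_expand (h := h) (r := max r R) (R := max r R + 1) hmx (by linarith)
        hhe.differentiableOn
      have : g = f' := dps_unique hR0 hg (hf'.mono (le_max_right _ _)) (by
        filter_upwards [dps_nhds hR0] with p hp
        rw [← hgV _ _ hp.1 hp.2, ← hfV' _ _ (hp.1.trans_le (le_max_right _ _))
          (hp.2.trans_le (le_max_right _ _))])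
      rw [this]
      exact hf'.mono (le_max_left _ _)
    have haS : ∀ r, 0 < r → dpsS (ampC f (g 0)) r := by
      intro r hr
      have hs0 : 0 < 2 * r + 1 := by linarith
      obtain ⟨B, hB⟩ := hgS (2 * r + 2) (2 * r + 1) hs0 (by linarith)
      refine amp_S (hfS ((2 * r + 1) ^ 2 + (2 * r + 1) + 1)) hs0 (by nlinarith) (by linarith)
        (fun k => by simpa using hB 0 k) (by linarith) (by nlinarith)
    refine ⟨fun z x => dpsV (ampC f (g 0)) (z - x ^ 2) x, ?_, fun _ _ _ _ => rfl⟩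
    rintro ⟨z, x⟩
    have n1 := norm_nonneg (z - x ^ 2)
    have n2 := norm_nonneg x
    exact hdiff (haS (‖z - x ^ 2‖ + ‖x‖ + 1) (by linarith)) (by linarith) (by linarith)
end

section
/- Let F be holomorphic on an open set U ⊆ ℂ and let ψ be holomorphic on an open set Ω ⊆ U × ℂ. Then the following are equivalent: (a) ψ satisfies x²·∂²ψ/∂x² + (4xz − 2x²)·∂²ψ/∂x∂z + x²·∂²ψ/∂z² + (2x − 4z)·∂ψ/∂z − x²·F(z)·ψ = 0 at every point (z,x) ∈ Ω with x ≠ 0; (b) the function Ψ̃(z,ẑ) := ψ(z, z − ẑ²)/(z − ẑ²) satisfies ∂²Ψ̃/∂z² − (2ẑ/(z − ẑ²))·∂²Ψ̃/∂z∂ẑ − (1/(z − ẑ²))·∂²Ψ̃/∂ẑ² = F(z)·Ψ̃ at every point (z,ẑ) ∈ ℂ² with (z, z − ẑ²) ∈ Ω and z ≠ ẑ². -/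
open Complex Metric

/-- Directional derivatives of a holomorphic function of two variables are holomorphic. -/
lemma differentiableAt_fderiv_apply (f : ℂ × ℂ → ℂ) (Ω : Set (ℂ × ℂ)) (hΩ : IsOpen Ω)
    (hf : DifferentiableOn ℂ f Ω) (v : ℂ × ℂ) (hv : ‖v‖ ≤ 1) (p₀ : ℂ × ℂ) (hp₀ : p₀ ∈ Ω) :
    DifferentiableAt ℂ (fun p => fderiv ℂ f p v) p₀ := by
  have hfd : ∀ p ∈ Ω, DifferentiableAt ℂ f p := fun p hp =>
    hf.differentiableAt (hΩ.mem_nhds hp)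
  have hev : ∀ᶠ p in nhds p₀, p ∈ Ω ∧ f p ∈ ball (f p₀) 1 :=
    (Filter.eventually_of_mem (hΩ.mem_nhds hp₀) fun _ h => h).and
      ((hfd p₀ hp₀).continuousAt (ball_mem_nhds _ one_pos))
  obtain ⟨R, hR, hball⟩ := Metric.eventually_nhds_iff_ball.1 hev
  obtain ⟨r, hr, rfl⟩ : ∃ r : ℝ, 0 < r ∧ R = 4 * r := ⟨R / 4, by positivity, by ring⟩
  have hmem : ∀ p ∈ ball p₀ r, ∀ t : ℂ, ‖t‖ ≤ r → p + t • v ∈ ball p₀ (2 * r) := by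
    intro p hp t ht
    rw [mem_ball, dist_eq_norm] at *
    have h1 : ‖t • v‖ ≤ r := by
      rw [norm_smul]
      nlinarith [norm_nonneg t, norm_nonneg v]
    calc ‖p + t • v - p₀‖ = ‖(p - p₀) + t • v‖ := by congr 1; abel
      _ ≤ ‖p - p₀‖ + ‖t • v‖ := norm_add_le _ _
      _ < 2 * r := by linarith
  have hsub : ∀ q ∈ ball p₀ (2 * r), q ∈ Ω := fun q hq =>
    (hball q (ball_subset_ball (by linarith) hq)).1
  have hbd : ∀ q ∈ ball p₀ (2 * r), ‖fderiv ℂ f q‖ ≤ 2 / (2 * r) := by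
    intro q hq
    have hb : ball q (2 * r) ⊆ ball p₀ (4 * r) := by
      apply ball_subset_ball'
      rw [mem_ball] at hq
      linarith
    refine Complex.norm_fderiv_le_div_of_mapsTo_ball (fun x hx =>
      (hfd x (hball x (hb hx)).1).differentiableWithinAt) (fun x hx => ?_) (by positivity)
    have h1 := (hball x (hb hx)).2
    have h2 := (hball q (hb (mem_ball_self (by positivity)))).2
    rw [mem_ball] at h1 h2
    rw [mem_closedBall]
    have := dist_triangle_right (f x) (f q) (f p₀)
    linarith
  set k : ℝ → ℂ := fun θ => deriv (circleMap 0 r) θ * (1 / (circleMap 0 r θ - 0) ^ 2) with hk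
  have hkc : Continuous k := by
    have h0 : ∀ θ, (circleMap 0 r θ - 0) ^ 2 ≠ 0 := fun θ => by
      rw [sub_zero]; exact pow_ne_zero 2 (circleMap_ne_center hr.ne')
    have : Continuous (deriv (circleMap 0 r)) := by
      have : deriv (circleMap 0 r) = fun θ => circleMap 0 r θ * I := by
        ext θ; simp [deriv_circleMap]
      rw [this]; exact (continuous_circleMap 0 r).mul continuous_const
    exact this.mul (continuous_const.div (((continuous_circleMap 0 r).sub continuous_const).pow 2) h0)
  have hcn : ∀ θ, ‖circleMap 0 r θ‖ ≤ r := fun θ => by simp [abs_of_pos hr]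
  have hformula : ∀ p ∈ ball p₀ r, fderiv ℂ f p v = (2 * Real.pi * I)⁻¹ *
      ∫ θ in (0 : ℝ)..2 * Real.pi, k θ * f (p + circleMap 0 r θ • v) := by
    intro p hp
    have hd : ∀ t ∈ closedBall (0 : ℂ) r, HasDerivAt (fun t : ℂ => f (p + t • v))
        (fderiv ℂ f (p + t • v) v) t := by
      intro t ht
      have h1 : HasFDerivAt f (fderiv ℂ f (p + t • v)) (p + t • v) :=
        (hfd _ (hsub _ (hmem p hp t (by simpa using ht)))).hasFDerivAt
      have h2 : HasDerivAt (fun t : ℂ => p + t • v) v t := by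
        simpa using ((hasDerivAt_id t).smul_const v).const_add p
      exact h1.comp_hasDerivAt t h2
    have h3 := DifferentiableOn.deriv_eq_smul_circleIntegral hr
      (fun t ht => (hd t ht).differentiableAt.differentiableWithinAt)
    rw [(hd 0 (by simp [hr.le])).deriv] at h3
    simp only [zero_smul, add_zero, circleIntegral, smul_eq_mul, ← mul_assoc] at h3
    rw [hk, h3, ← mul_assoc, inv_mul_cancel₀ Complex.two_pi_I_ne_zero, one_mul]
  have hcont : ∀ p ∈ ball p₀ r, Continuous (fun θ => k θ * f (p + circleMap 0 r θ • v)) := by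
    intro p hp
    refine hkc.mul (continuous_iff_continuousAt.2 fun θ => ?_)
    have h1 : ContinuousAt f (p + circleMap 0 r θ • v) :=
      (hfd _ (hsub _ (hmem p hp _ (hcn θ)))).continuousAt
    exact ContinuousAt.comp (f := fun θ => p + circleMap 0 r θ • v) h1
      (by have := continuous_circleMap 0 r; fun_prop)
  have hmain := intervalIntegral.hasFDerivAt_integral_of_dominated_of_fderiv_le (𝕜 := ℂ)
    (μ := MeasureTheory.volume)
    (F := fun p θ => k θ * f (p + circleMap 0 r θ • v))
    (F' := fun p θ => k θ • fderiv ℂ f (p + circleMap 0 r θ • v)) (x₀ := p₀)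
    (bound := fun θ => ‖k θ‖ * (2 / (2 * r)))
    (a := 0) (b := 2 * Real.pi) (ball_mem_nhds p₀ hr)
    (Filter.eventually_of_mem (ball_mem_nhds p₀ hr) fun p hp =>
      (hcont p hp).aestronglyMeasurable)
    ((hcont p₀ (mem_ball_self hr)).intervalIntegrable _ _)
    (by
      have h1 : Measurable (fun θ : ℝ => fderiv ℂ f (p₀ + circleMap 0 r θ • v)) :=
        (measurable_fderiv ℂ f).comp (Continuous.measurable
          (by have := continuous_circleMap 0 r; fun_prop))
      exact hkc.aestronglyMeasurable.smul h1.stronglyMeasurable.aestronglyMeasurable)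
    (Filter.Eventually.of_forall fun θ _ p hp => by
      rw [norm_smul]
      exact mul_le_mul_of_nonneg_left (hbd _ (hmem p hp _ (hcn θ))) (norm_nonneg _))
    ((hkc.norm.mul continuous_const).intervalIntegrable _ _)
    (Filter.Eventually.of_forall fun θ _ p hp => by
      have h1 : HasFDerivAt f (fderiv ℂ f (p + circleMap 0 r θ • v)) (p + circleMap 0 r θ • v) :=
        (hfd _ (hsub _ (hmem p hp _ (hcn θ)))).hasFDerivAt
      exact ((hasFDerivAt_comp_add_right _).2 h1).const_smul (k θ))
  refine ((hmain.differentiableAt.const_mul (2 * Real.pi * I)⁻¹)).congr_of_eventuallyEq ?_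
  exact Filter.eventually_of_mem (ball_mem_nhds p₀ hr) hformula

/-- Chain rule along a curve in `ℂ × ℂ`. -/
lemma hasDerivAt_curve {G : ℂ × ℂ → ℂ} {c d : ℂ → ℂ} {t c' d' : ℂ}
    (hG : DifferentiableAt ℂ G (c t, d t)) (hc : HasDerivAt c c' t) (hd : HasDerivAt d d' t) :
    HasDerivAt (fun s => G (c s, d s))
      (c' * fderiv ℂ G (c t, d t) (1, 0) + d' * fderiv ℂ G (c t, d t) (0, 1)) t := by
  have h := hG.hasFDerivAt.comp_hasDerivAt t (hc.prodMk hd)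
  have e : ((c', d') : ℂ × ℂ) = c' • (1, 0) + d' • (0, 1) := by simp
  rw [e, map_add, map_smul, map_smul] at h
  exact h

lemma fderiv_symm (f : ℂ × ℂ → ℂ) (Ω : Set (ℂ × ℂ)) (hΩ : IsOpen Ω)
    (hf : DifferentiableOn ℂ f Ω) (p : ℂ × ℂ) (hp : p ∈ Ω) :
    fderiv ℂ (fun q => fderiv ℂ f q (1, 0)) p (0, 1)
      = fderiv ℂ (fun q => fderiv ℂ f q (0, 1)) p (1, 0) := by
  have hA := differentiableAt_fderiv_apply f Ω hΩ hf (1, 0) (by simp [Prod.norm_def]) p hp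
  have hB := differentiableAt_fderiv_apply f Ω hΩ hf (0, 1) (by simp [Prod.norm_def]) p hp
  have e : fderiv ℂ f = fun q => fderiv ℂ f q (1, 0) • ContinuousLinearMap.fst ℂ ℂ ℂ
      + fderiv ℂ f q (0, 1) • ContinuousLinearMap.snd ℂ ℂ ℂ := by
    funext q
    ext <;> simp
  have h2 := (hA.hasFDerivAt.smul_const (ContinuousLinearMap.fst ℂ ℂ ℂ)).add
    (hB.hasFDerivAt.smul_const (ContinuousLinearMap.snd ℂ ℂ ℂ))
  have h3 := second_derivative_symmetric_of_eventually (f := f) (f' := fun q =>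
      fderiv ℂ f q (1, 0) • ContinuousLinearMap.fst ℂ ℂ ℂ
      + fderiv ℂ f q (0, 1) • ContinuousLinearMap.snd ℂ ℂ ℂ)
    (Filter.eventually_of_mem (hΩ.mem_nhds hp) (fun q hq => by
      have := (hf.differentiableAt (hΩ.mem_nhds hq)).hasFDerivAt
      rwa [congrFun e q] at this)) h2 (0, 1) (1, 0)
  simpa using h3

lemma pde_pointwise (F : ℂ → ℂ)
    (Ω : Set (ℂ × ℂ)) (hΩ : IsOpen Ω) (ψ : ℂ → ℂ → ℂ)
    (hψ : DifferentiableOn ℂ (fun p : ℂ × ℂ => ψ p.1 p.2) Ω) (z h : ℂ)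
    (hm : (z, z - h^2) ∈ Ω) (hne : z - h^2 ≠ 0) :
    pdeLHS (fun a b => ψ a (a - b^2) / (a - b^2)) z h - F z * (ψ z (z - h^2) / (z - h^2))
      = singPDE F ψ z (z - h^2) / (z - h^2)^3 := by
  set P : ℂ × ℂ → ℂ := fun p => ψ p.1 p.2 with hP
  set A : ℂ × ℂ → ℂ := fun q => fderiv ℂ P q (1, 0) with hA
  set B : ℂ × ℂ → ℂ := fun q => fderiv ℂ P q (0, 1) with hB
  have dP : ∀ p ∈ Ω, DifferentiableAt ℂ P p := fun p hp =>
    hψ.differentiableAt (hΩ.mem_nhds hp)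
  have dA : ∀ p ∈ Ω, DifferentiableAt ℂ A p := fun p hp =>
    differentiableAt_fderiv_apply P Ω hΩ hψ (1, 0) (by simp [Prod.norm_def]) p hp
  have dB : ∀ p ∈ Ω, DifferentiableAt ℂ B p := fun p hp =>
    differentiableAt_fderiv_apply P Ω hΩ hψ (0, 1) (by simp [Prod.norm_def]) p hp
  have hsym : fderiv ℂ A (z, z - h^2) (0, 1) = fderiv ℂ B (z, z - h^2) (1, 0) :=
    fderiv_symm P Ω hΩ hψ _ hm
  -- derivatives of `ψ`
  have dx : ∀ a b, (a, b) ∈ Ω → HasDerivAt (ψ a) (B (a, b)) b := fun a b hab => by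
    simpa using hasDerivAt_curve (G := P) (c := fun _ => a) (d := fun s => s) (dP _ hab)
      (hasDerivAt_const b a) (hasDerivAt_id b)
  have dz : ∀ a b, (a, b) ∈ Ω → HasDerivAt (fun w => ψ w b) (A (a, b)) a := fun a b hab => by
    simpa using hasDerivAt_curve (G := P) (c := fun s => s) (d := fun _ => b) (dP _ hab)
      (hasDerivAt_id a) (hasDerivAt_const a b)
  -- neighbourhoods
  have nx : ∀ᶠ x in nhds (z - h^2), (z, x) ∈ Ω :=
    (Continuous.prodMk continuous_const continuous_id).continuousAt.preimage_mem_nhds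
      (hΩ.mem_nhds hm)
  have nz : ∀ᶠ w in nhds z, (w, z - h^2) ∈ Ω :=
    (Continuous.prodMk continuous_id continuous_const).continuousAt.preimage_mem_nhds
      (hΩ.mem_nhds hm)
  have nΨz : ∀ᶠ w in nhds z, (w, w - h^2) ∈ Ω ∧ w - h^2 ≠ 0 :=
    Filter.Eventually.and
      ((show Continuous fun w : ℂ => (w, w - h^2) by fun_prop).continuousAt.preimage_mem_nhds
        (hΩ.mem_nhds hm))
      ((show Continuous fun w : ℂ => w - h^2 by fun_prop).continuousAt.eventually_ne hne)
  have nΨh : ∀ᶠ b in nhds h, (z, z - b^2) ∈ Ω ∧ z - b^2 ≠ 0 :=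
    Filter.Eventually.and
      ((show Continuous fun b : ℂ => (z, z - b^2) by fun_prop).continuousAt.preimage_mem_nhds
        (hΩ.mem_nhds hm))
      ((show Continuous fun b : ℂ => z - b^2 by fun_prop).continuousAt.eventually_ne hne)
  -- second derivatives of `ψ`
  have exx : deriv (deriv (ψ z)) (z - h^2) = fderiv ℂ B (z, z - h^2) (0, 1) := by
    have e : deriv (ψ z) =ᶠ[nhds (z - h^2)] fun x => B (z, x) := by
      filter_upwards [nx] with x hx using (dx z x hx).deriv
    rw [e.deriv_eq]
    simpa using (hasDerivAt_curve (G := B) (c := fun _ => z) (d := fun s => s) (dB _ hm)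
      (hasDerivAt_const (z - h^2) z) (hasDerivAt_id (z - h^2))).deriv
  have exz : deriv (fun w => deriv (ψ w) (z - h^2)) z = fderiv ℂ B (z, z - h^2) (1, 0) := by
    have e : (fun w => deriv (ψ w) (z - h^2)) =ᶠ[nhds z] fun w => B (w, z - h^2) := by
      filter_upwards [nz] with w hw using (dx w _ hw).deriv
    rw [e.deriv_eq]
    simpa using (hasDerivAt_curve (G := B) (c := fun s => s) (d := fun _ => z - h^2) (dB _ hm)
      (hasDerivAt_id z) (hasDerivAt_const z (z - h^2))).deriv
  have ezz : deriv (deriv (fun w => ψ w (z - h^2))) z = fderiv ℂ A (z, z - h^2) (1, 0) := by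
    have e : deriv (fun w => ψ w (z - h^2)) =ᶠ[nhds z] fun w => A (w, z - h^2) := by
      filter_upwards [nz] with w hw using (dz w _ hw).deriv
    rw [e.deriv_eq]
    simpa using (hasDerivAt_curve (G := A) (c := fun s => s) (d := fun _ => z - h^2) (dA _ hm)
      (hasDerivAt_id z) (hasDerivAt_const z (z - h^2))).deriv
  -- chain rule along the two coordinate curves
  have cz : ∀ (G : ℂ × ℂ → ℂ) (w : ℂ), DifferentiableAt ℂ G (w, w - h^2) →
      HasDerivAt (fun s => G (s, s - h^2))
        (fderiv ℂ G (w, w - h^2) (1, 0) + fderiv ℂ G (w, w - h^2) (0, 1)) w := by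
    intro G w hG
    simpa using hasDerivAt_curve (G := G) (c := fun s => s) (d := fun s => s - h^2) hG
      (hasDerivAt_id w) ((hasDerivAt_id w).sub_const (h^2))
  have lz : ∀ w : ℂ, HasDerivAt (fun s : ℂ => s - h^2) 1 w := fun w =>
    (hasDerivAt_id w).sub_const (h^2)
  have lh : ∀ a b : ℂ, HasDerivAt (fun s : ℂ => a - s^2) (-(2 * b)) b := fun a b => by
    simpa using (hasDerivAt_pow 2 b).const_sub a
  have ch : ∀ (G : ℂ × ℂ → ℂ) (a b : ℂ), DifferentiableAt ℂ G (a, a - b^2) →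
      HasDerivAt (fun s => G (a, a - s^2)) (-(2 * b) * fderiv ℂ G (a, a - b^2) (0, 1)) b := by
    intro G a b hG
    simpa using hasDerivAt_curve (G := G) (c := fun _ => a) (d := fun s => a - s^2) hG
      (hasDerivAt_const b a) (lh a b)
  have lz2 : HasDerivAt (fun s : ℂ => (s - h^2)^2) (2 * (z - h^2) * 1) z := by
    simpa [Function.comp_def] using (hasDerivAt_pow 2 (z - h^2)).comp z (lz z)
  have lh2 : HasDerivAt (fun s : ℂ => (z - s^2)^2) (2 * (z - h^2) * (-(2 * h))) h := by
    simpa [Function.comp_def] using (hasDerivAt_pow 2 (z - h^2)).comp h (lh z h)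
  -- derivatives of the transformed function
  have Ezz : deriv (deriv (fun w => ψ w (w - h^2) / (w - h^2))) z = 
      ((((fderiv ℂ A (z, z - h^2) (1, 0) + fderiv ℂ A (z, z - h^2) (0, 1)) + (fderiv ℂ B (z, z - h^2) (1, 0) + fderiv ℂ B (z, z - h^2) (0, 1))) * (z - h^2)
        + (A (z, z - h^2) + B (z, z - h^2)) * 1 - (A (z, z - h^2) + B (z, z - h^2)) * 1) * (z - h^2)^2
        - ((A (z, z - h^2) + B (z, z - h^2)) * (z - h^2) - P (z, z - h^2) * 1) * (2 * (z - h^2) * 1)) / ((z - h^2)^2)^2 := by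
    have e : deriv (fun w => ψ w (w - h^2) / (w - h^2)) =ᶠ[nhds z]
        fun w => ((A (w, w - h^2) + B (w, w - h^2)) * (w - h^2) - P (w, w - h^2) * 1)
          / (w - h^2)^2 := by
      filter_upwards [nΨz] with w hw
      exact ((cz P w (dP _ hw.1)).div (lz w) hw.2).deriv
    rw [e.deriv_eq]
    exact ((((cz A z (dA _ hm)).add (cz B z (dB _ hm))).mul (lz z)).sub
      ((cz P z (dP _ hm)).mul_const 1)).div (lz2) (pow_ne_zero 2 hne) |>.deriv
  have dΨh : ∀ a b : ℂ, (a, a - b^2) ∈ Ω → a - b^2 ≠ 0 →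
      deriv (fun s => ψ a (a - s^2) / (a - s^2)) b =
        (-(2 * b) * B (a, a - b^2) * (a - b^2) - P (a, a - b^2) * (-(2 * b))) / (a - b^2)^2 :=
    fun a b hab hn => ((ch P a b (dP _ hab)).div (lh a b) hn).deriv
  have Ezh : deriv (fun w => deriv (fun s => ψ w (w - s^2) / (w - s^2)) h) z = 
      ((-(2 * h) * (fderiv ℂ B (z, z - h^2) (1, 0) + fderiv ℂ B (z, z - h^2) (0, 1)) * (z - h^2)
        + -(2 * h) * B (z, z - h^2) * 1 - (A (z, z - h^2) + B (z, z - h^2)) * (-(2 * h))) * (z - h^2)^2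
        - (-(2 * h) * B (z, z - h^2) * (z - h^2) - P (z, z - h^2) * (-(2 * h))) * (2 * (z - h^2) * 1)) / ((z - h^2)^2)^2 := by
    have e : (fun w => deriv (fun s => ψ w (w - s^2) / (w - s^2)) h) =ᶠ[nhds z]
        fun w => (-(2 * h) * B (w, w - h^2) * (w - h^2) - P (w, w - h^2) * (-(2 * h)))
          / (w - h^2)^2 := by
      filter_upwards [nΨz] with w hw using dΨh w h hw.1 hw.2
    rw [e.deriv_eq]
    exact ((((cz B z (dB _ hm)).const_mul (-(2 * h))).mul (lz z)).sub
      ((cz P z (dP _ hm)).mul_const (-(2 * h)))).div (lz2) (pow_ne_zero 2 hne) |>.deriv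
  have l2 : HasDerivAt (fun s : ℂ => -(2 * s)) (-2) h := by
    simpa using (hasDerivAt_id h).const_mul (-2 : ℂ)
  have Ehh : deriv (deriv (fun s => ψ z (z - s^2) / (z - s^2))) h = 
      (((-2 * B (z, z - h^2) + -(2 * h) * (-(2 * h) * fderiv ℂ B (z, z - h^2) (0, 1))) * (z - h^2)
        + -(2 * h) * B (z, z - h^2) * (-(2 * h)) - (-(2 * h) * B (z, z - h^2) * (-(2 * h)) + P (z, z - h^2) * (-2))) * (z - h^2)^2
        - (-(2 * h) * B (z, z - h^2) * (z - h^2) - P (z, z - h^2) * (-(2 * h))) * (2 * (z - h^2) * (-(2 * h)))) / ((z - h^2)^2)^2 := by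
    have e : deriv (fun s => ψ z (z - s^2) / (z - s^2)) =ᶠ[nhds h]
        fun b => (-(2 * b) * B (z, z - b^2) * (z - b^2) - P (z, z - b^2) * (-(2 * b)))
          / (z - b^2)^2 := by
      filter_upwards [nΨh] with b hb using dΨh z b hb.1 hb.2
    rw [e.deriv_eq]
    exact (((l2.mul (ch B z h (dB _ hm))).mul (lh z h)).sub
      ((ch P z h (dP _ hm)).mul l2)).div (lh2) (pow_ne_zero 2 hne) |>.deriv
  unfold pdeLHS singPDE
  rw [Ezz, Ezh, Ehh, exx, exz, ezz, (dz z _ hm).deriv, hsym]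
  change _ - F z * (P (z, z - h^2) / (z - h^2)) = (_ - _ * P (z, z - h^2)) / _
  generalize P (z, z - h^2) = p
  generalize A (z, z - h^2) = a
  generalize B (z, z - h^2) = b
  generalize fderiv ℂ A (z, z - h^2) (1, 0) = azz
  generalize fderiv ℂ B (z, z - h^2) (1, 0) = bz
  generalize fderiv ℂ B (z, z - h^2) (0, 1) = bx
  generalize F z = f
  obtain ⟨x, hx⟩ : ∃ x, x = z - h^2 := ⟨_, rfl⟩
  have hz : z = x + h^2 := by rw [hx]; ring
  rw [← hx] at hne ⊢
  clear hx
  rw [hz]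
  field_simp
  ring

/-- Equivalence of the singular PDE for `ψ(z,x)` and the linear PDE for
`Ψ̃(z,ẑ) = ψ(z, z−ẑ²)/(z−ẑ²)` under the change of variables `x = z − ẑ²`. -/
theorem singular_pde_change_of_variables (U : Set ℂ) (hU : IsOpen U)
    (F : ℂ → ℂ) (hF : DifferentiableOn ℂ F U)
    (Ω : Set (ℂ × ℂ)) (hΩ : IsOpen Ω) (hΩU : ∀ p ∈ Ω, p.1 ∈ U)
    (ψ : ℂ → ℂ → ℂ)
    (hψ : DifferentiableOn ℂ (fun p : ℂ × ℂ => ψ p.1 p.2) Ω) :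
    (∀ z x : ℂ, (z, x) ∈ Ω → x ≠ 0 → singPDE F ψ z x = 0) ↔
    (∀ z zh : ℂ, (z, z - zh^2) ∈ Ω → z ≠ zh^2 →
      pdeLHS (fun a b => ψ a (a - b^2) / (a - b^2)) z zh
        = F z * (ψ z (z - zh^2) / (z - zh^2))) := by
  constructor
  · intro H z zh hm hne
    have hx : z - zh^2 ≠ 0 := sub_ne_zero.2 hne
    have h := pde_pointwise F Ω hΩ ψ hψ z zh hm hx
    rw [H z _ hm hx, zero_div] at h
    exact sub_eq_zero.1 h
  · intro H z x hm hx
    obtain ⟨zh, hzh⟩ : ∃ zh : ℂ, zh^2 = z - x := 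
      IsAlgClosed.exists_pow_nat_eq (z - x) (by norm_num)
    obtain rfl : x = z - zh^2 := by rw [hzh]; ring
    have h := pde_pointwise F Ω hΩ ψ hψ z zh hm hx
    rw [H z zh hm (sub_ne_zero.1 hx), sub_self] at h
    exact (div_eq_zero_iff.1 h.symm).resolve_right (pow_ne_zero 3 hx)
end
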